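/- arXiv:1804.02517 — 3 statements merged into one kernel-verified Lean document; each statement's English description precedes it below -/
import Mathlib

section
/- Let X be a Peano continuum having a free arc. If X admits a sensitive commutative subsemigroup F of C^0(X) consisting of continuous open maps, then either X is an arc or X is a circle. -/
open Set Metric Topology

/-- The whole space `X` is an arc, i.e. homeomorphic to `[0,1]`. -/
def SpaceIsArc (X : Type*) [TopologicalSpace X] : Prop :=
  Nonempty (X ≃ₜ Set.Icc (0:ℝ) 1)

/-- The whole space `X` is a circle, i.e. homeomorphic to the unit circle in `ℂ`. -/
def SpaceIsCircle (X : Type*) [TopologicalSpace X] : Prop :=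
  Nonempty (X ≃ₜ Metric.sphere (0:ℂ) 1)

/-- A subset `A` is an arc: with the subspace topology it is homeomorphic to `[0,1]`. -/
def IsArc {X : Type*} [TopologicalSpace X] (A : Set X) : Prop :=
  Nonempty (A ≃ₜ Set.Icc (0:ℝ) 1)

/-- A subset `A` is a circle: with the subspace topology it is homeomorphic to `S¹`. -/
def IsCircleSet {X : Type*} [TopologicalSpace X] (A : Set X) : Prop :=
  Nonempty (A ≃ₜ Metric.sphere (0:ℂ) 1)

/-- `A` is an arc with endpoints `a` and `b`: it is the image of a continuous
injective parametrization of `[0,1]` with `γ 0 = a` and `γ 1 = b`. -/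
def IsArcEnds {X : Type*} [TopologicalSpace X] (A : Set X) (a b : X) : Prop :=
  ∃ γ : ℝ → X, ContinuousOn γ (Set.Icc 0 1) ∧ Set.InjOn γ (Set.Icc 0 1) ∧
    γ '' Set.Icc 0 1 = A ∧ γ 0 = a ∧ γ 1 = b

/-- A free open interval: an open subset homeomorphic to `(0,1)`. -/
def IsFreeOpenInterval {X : Type*} [TopologicalSpace X] (J : Set X) : Prop :=
  IsOpen J ∧ Nonempty (J ≃ₜ Set.Ioo (0:ℝ) 1)

/-- A free arc: the closure of a free open interval, homeomorphic to `[0,1]`. -/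
def IsFreeArc {X : Type*} [TopologicalSpace X] (A : Set X) : Prop :=
  ∃ J : Set X, IsFreeOpenInterval J ∧ A = closure J ∧ IsArc A

/-- A maximal free open interval: no free open interval properly contains it. -/
def IsMaxFreeOpenInterval {X : Type*} [TopologicalSpace X] (J : Set X) : Prop :=
  IsFreeOpenInterval J ∧ ∀ K : Set X, IsFreeOpenInterval K → J ⊆ K → J = K

/-- `x` is an endpoint of the space `X`: every open set containing `x` contains an
open neighborhood of `x` whose boundary is a single point. -/
def IsEndpointOf (X : Type*) [TopologicalSpace X] (x : X) : Prop :=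
  ∀ U : Set X, IsOpen U → x ∈ U → ∃ V : Set X, IsOpen V ∧ x ∈ V ∧ V ⊆ U ∧
    ∃ y : X, frontier V = {y}

/-- A maximal free open interval of Type I: its closure is an arc `J ∪ {a,b}` with
`a, b ∉ J` and at least one of `a, b` an endpoint of `X`. -/
def IsTypeI {X : Type*} [TopologicalSpace X] (J : Set X) : Prop :=
  IsMaxFreeOpenInterval J ∧ ∃ a b : X, a ≠ b ∧ a ∉ J ∧ b ∉ J ∧
    closure J = J ∪ {a, b} ∧ IsArcEnds (closure J) a b ∧
    (IsEndpointOf X a ∨ IsEndpointOf X b)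

/-- The model simple triod in the complex plane: three unit segments from the
origin in directions `π/3`, `π`, `5π/3`. -/
noncomputable def triodModel : Set ℂ :=
  ⋃ θ ∈ ({Real.pi / 3, Real.pi, 5 * Real.pi / 3} : Set ℝ),
    (fun r : ℝ => (r : ℂ) * Complex.exp (θ * Complex.I)) '' Set.Icc (0:ℝ) 1

/-- `A` is a simple triod. -/
def IsSimpleTriod {X : Type*} [TopologicalSpace X] (A : Set X) : Prop :=
  Nonempty (A ≃ₜ triodModel)

/-- `U` contains no simple triod. -/
def ContainsNoTriod {X : Type*} [TopologicalSpace X] (U : Set X) : Prop :=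
  ∀ A : Set X, A ⊆ U → ¬ IsSimpleTriod A

/-- The distance between two subsets of a metric space:
`d(S,T) = inf { dist s t | s ∈ S, t ∈ T }`. -/
noncomputable def setDist {X : Type*} [MetricSpace X] (S T : Set X) : ℝ :=
  sInf (Set.image2 dist S T)

section OpenCurves

open Filter

variable {X : Type*} [TopologicalSpace X] {φ : ℝ → X}

/-- A preconnected set that meets the image of an open interval under an open map, and avoids the
images of the endpoints, lies in the image of that interval. -/
lemma subset_image_Ioo_of_isPreconnected [T2Space X] (hc : Continuous φ) (ho : IsOpenMap φ)
    {a b : ℝ} {s : Set X} (hs : IsPreconnected s) (ha : φ a ∉ s) (hb : φ b ∉ s)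
    (hne : (s ∩ φ '' Ioo a b).Nonempty) : s ⊆ φ '' Ioo a b := by
  refine IsPreconnected.subset_left_of_subset_union (v := (φ '' Icc a b)ᶜ) (ho _ isOpen_Ioo)
    (isCompact_Icc.image hc).isClosed.isOpen_compl
    (disjoint_compl_right.mono_left (image_mono Ioo_subset_Icc_self)) ?_ hne hs
  intro x hx
  by_cases h : x ∈ φ '' Icc a b
  · obtain ⟨t, ht, rfl⟩ := h
    refine Or.inl ⟨t, ⟨lt_of_le_of_ne ht.1 ?_, lt_of_le_of_ne ht.2 ?_⟩, rfl⟩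
    · rintro rfl; exact ha hx
    · rintro rfl; exact hb hx
  · exact Or.inr h

/-- A parameter outside a fibre but between two of its points lies in a complementary interval
of that fibre. -/
lemma exists_Ioo_disjoint_fiber [T1Space X] (hc : Continuous φ) {y : X} {p q w : ℝ}
    (hp : φ p = y) (hq : φ q = y) (hpw : p < w) (hwq : w < q) (hw : φ w ≠ y) :
    ∃ a b, p ≤ a ∧ a < w ∧ w < b ∧ b ≤ q ∧ φ a = y ∧ φ b = y ∧ ∀ x ∈ Ioo a b, φ x ≠ y := by
  have hcl : IsClosed (φ ⁻¹' {y}) := isClosed_singleton.preimage hc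
  obtain ⟨a, ⟨ha, hay⟩, hau⟩ := (isCompact_Icc.inter_right hcl).exists_isGreatest
    ⟨p, left_mem_Icc.2 hpw.le, hp⟩
  obtain ⟨b, ⟨hb, hby⟩, hbl⟩ := (isCompact_Icc.inter_right hcl).exists_isLeast
    ⟨q, right_mem_Icc.2 hwq.le, hq⟩
  refine ⟨a, b, ha.1, lt_of_le_of_ne ha.2 ?_, lt_of_le_of_ne hb.1 ?_, hb.2, hay, hby, ?_⟩
  · rintro rfl; exact hw hay
  · rintro rfl; exact hw hby
  · intro x hx hxy
    rcases le_total x w with h | h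
    · exact absurd (hau ⟨⟨ha.1.trans hx.1.le, h⟩, hxy⟩) (not_le.2 hx.1)
    · exact absurd (hbl ⟨⟨h, hx.2.le.trans hb.2⟩, hxy⟩) (not_le.2 hx.2)

lemma isOpenMap_comp_neg (ho : IsOpenMap φ) : IsOpenMap fun x => φ (-x) :=
  ho.comp (Homeomorph.neg ℝ).isOpenMap

lemma exists_mem_Ioo_ne [T1Space X] [ConnectedSpace X] [Nontrivial X] (ho : IsOpenMap φ)
    {p q : ℝ} (hpq : p < q) (y : X) : ∃ w ∈ Ioo p q, φ w ≠ y := by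
  by_contra! h
  have h1 : φ '' Ioo p q = {y} := by
    ext x
    constructor
    · rintro ⟨t, ht, rfl⟩; exact h t ht
    · rintro rfl
      obtain ⟨t, ht⟩ := nonempty_Ioo.2 hpq
      exact ⟨t, ht, h t ht⟩
  have h2 : IsClopen ({y} : Set X) := ⟨isClosed_singleton, h1 ▸ ho _ isOpen_Ioo⟩
  rcases isClopen_iff.1 h2 with h3 | h3
  · simp at h3
  · obtain ⟨z, hz⟩ := exists_ne y
    exact hz (h3 ▸ mem_univ z : z ∈ ({y} : Set X))

lemma eventually_nhdsGT_ne [T2Space X] [ConnectedSpace X] [Nontrivial X] (hc : Continuous φ)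
    (ho : IsOpenMap φ) (T : ℝ) : ∀ᶠ x in 𝓝[>] T, φ x ≠ φ T := by
  by_contra hcon
  have hfr : ∀ u > T, ∃ e, T < e ∧ e < u ∧ φ e = φ T := by
    intro u hu
    have h : ∃ᶠ x in 𝓝[>] T, φ x = φ T := fun h => hcon h
    obtain ⟨e, he, h1, h2⟩ := (h.and_eventually (Ioo_mem_nhdsGT hu)).exists
    exact ⟨e, h1, h2, he⟩
  obtain ⟨q, hTq, -, hq⟩ := hfr (T + 1) (by linarith)
  obtain ⟨p, hTp, hpq, hp⟩ := hfr q hTq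
  obtain ⟨w, hw, hwy⟩ := exists_mem_Ioo_ne ho hpq (φ T)
  obtain ⟨a, b, hpa, haw, hwb, hbq, ha, hb, hab⟩ :=
    exists_Ioo_disjoint_fiber hc hp hq hw.1 hw.2 hwy
  have hz : ∀ᶠ x in 𝓝[>] T, φ x ≠ φ w :=
    (hc.continuousAt.eventually_ne hwy.symm).filter_mono nhdsWithin_le_nhds
  obtain ⟨u, hTu, hu⟩ := (mem_nhdsGT_iff_exists_Ioo_subset).1 hz
  obtain ⟨e₂, hT2, h2u, he2⟩ := hfr u hTu
  obtain ⟨e₁, hT1, h12, he1⟩ := hfr e₂ hT2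
  obtain ⟨e₀, hT0, h01, he0⟩ := hfr e₁ hT1
  have hnb : φ '' Ioo e₀ e₂ ∈ 𝓝 (φ a) := by
    rw [ha, ← he1]
    exact ho.image_mem_nhds (Ioo_mem_nhds h01 h12)
  have h3 : ∀ᶠ x in 𝓝[>] a, φ x ∈ φ '' Ioo e₀ e₂ :=
    (hc.continuousAt.eventually hnb).filter_mono nhdsWithin_le_nhds
  obtain ⟨x, ⟨w', hw', hww⟩, hx⟩ := (h3.and (Ioo_mem_nhdsGT (haw.trans hwb))).exists
  obtain ⟨a', b', h0a, haw', hwb', hb2, ha', hb', hab'⟩ :=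
    exists_Ioo_disjoint_fiber hc he0 he2 hw'.1 hw'.2 (hww ▸ hab x hx)
  have hsub : φ '' Ioo a b ⊆ φ '' Ioo a' b' := by
    refine subset_image_Ioo_of_isPreconnected hc ho (isPreconnected_Ioo.image _ hc.continuousOn)
      ?_ ?_ ⟨φ x, ⟨x, hx, rfl⟩, ⟨w', ⟨haw', hwb'⟩, hww⟩⟩
    · rw [ha']; rintro ⟨v, hv, hvy⟩; exact hab v hv hvy
    · rw [hb']; rintro ⟨v, hv, hvy⟩; exact hab v hv hvy
  obtain ⟨v, hv, hvw⟩ := hsub ⟨w, ⟨haw, hwb⟩, rfl⟩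
  exact hu ⟨by linarith [hv.1], by linarith [hv.2]⟩ hvw

/-- Fibres of a continuous open curve are discrete. -/
lemma eventually_nhdsNE_ne [T2Space X] [ConnectedSpace X] [Nontrivial X] (hc : Continuous φ)
    (ho : IsOpenMap φ) (T : ℝ) : ∀ᶠ x in 𝓝[≠] T, φ x ≠ φ T := by
  rw [← nhdsLT_sup_nhdsGT, eventually_sup]
  refine ⟨?_, eventually_nhdsGT_ne hc ho T⟩
  have h := eventually_nhdsGT_ne (hc.comp continuous_neg) (isOpenMap_comp_neg ho) (-T)
  have h2 : Tendsto (fun x : ℝ => -x) (𝓝[<] T) (𝓝[>] (-T)) := tendsto_neg_nhdsLT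
  filter_upwards [h2.eventually h] with x hx
  simpa using hx

/-- A continuous open curve is injective on some subinterval of any interval. -/
lemma exists_injOn_Icc [T2Space X] [ConnectedSpace X] [Nontrivial X] (hc : Continuous φ)
    (ho : IsOpenMap φ) {p q : ℝ} (hpq : p < q) :
    ∃ c d, p < c ∧ c < d ∧ d < q ∧ InjOn φ (Icc c d) := by
  let E : ℕ → Set ℝ := fun k => {x | ∀ x', φ x' = φ x → x' = x ∨ 1 / ((k : ℝ) + 1) ≤ |x' - x|}
  have hE : ∀ k, IsClosed (E k) := by
    intro k
    rw [← isOpen_compl_iff, isOpen_iff_mem_nhds]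
    intro x hx
    simp only [E, mem_compl_iff, mem_ofPred_eq, not_forall, not_or, not_le] at hx
    obtain ⟨x', hxx, hne, hlt⟩ := hx
    have h1 : ∀ᶠ z in 𝓝 (x, x'), z.2 ≠ z.1 ∧ |z.2 - z.1| < 1 / ((k : ℝ) + 1) := by
      refine Filter.Eventually.and ?_ ?_
      · exact (isOpen_ne_fun continuous_snd continuous_fst).eventually_mem hne
      · exact (continuous_snd.sub continuous_fst).abs.continuousAt.eventually_lt_const hlt
    rw [nhds_prod_eq] at h1
    obtain ⟨U, hU, U', hU', hUU⟩ := mem_prod_iff.1 h1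
    have h2 : ∀ᶠ z in 𝓝 x, φ z ∈ φ '' U' :=
      hc.continuousAt.eventually (hxx ▸ ho.image_mem_nhds hU')
    filter_upwards [hU, h2] with z hz ⟨z', hz', hzz⟩ hzE
    have h3 := hUU (mk_mem_prod hz hz')
    rcases hzE z' hzz with h | h
    · exact h3.1 h
    · exact absurd h3.2 (not_lt.2 h)
  have hcov : ⋃ k, E k = univ := by
    refine eq_univ_of_forall fun x => mem_iUnion.2 ?_
    have h1 := eventually_nhdsNE_ne hc ho x
    obtain ⟨ε, hε, h⟩ := Metric.mem_nhdsWithin_iff.1 h1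
    obtain ⟨k, hk⟩ := exists_nat_one_div_lt hε
    refine ⟨k, fun x' hx' => ?_⟩
    by_contra! hcon
    exact h ⟨by rw [Metric.mem_ball, Real.dist_eq]; linarith [hcon.2], hcon.1⟩ hx'
  obtain ⟨x, hx, hxpq⟩ := (dense_iUnion_interior_of_closed hE hcov).exists_mem_open
    isOpen_Ioo (nonempty_Ioo.2 hpq)
  obtain ⟨k, hk⟩ := mem_iUnion.1 hx
  have h1 : ∀ᶠ y in 𝓝 x, y ∈ E k ∧ y ∈ Ioo p q :=
    Filter.Eventually.and (mem_interior_iff_mem_nhds.1 hk) (isOpen_Ioo.mem_nhds hxpq)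
  obtain ⟨ε, hε, h⟩ := Metric.eventually_nhds_iff.1 h1
  have hk0 : (0 : ℝ) < 1 / ((k : ℝ) + 1) := by positivity
  set δ := min ε (1 / ((k : ℝ) + 1)) / 2 with hδ
  have hδ0 : 0 < δ := by have := lt_min hε hk0; positivity
  have hδε : δ < ε := by have := min_le_left ε (1 / ((k : ℝ) + 1)); linarith
  have hδk : 2 * δ ≤ 1 / ((k : ℝ) + 1) := by
    have := min_le_right ε (1 / ((k : ℝ) + 1)); linarith
  have hin : ∀ y ∈ Icc x (x + δ), y ∈ E k ∧ y ∈ Ioo p q := fun y hy =>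
    h (by rw [Real.dist_eq, abs_lt]; constructor <;> linarith [hy.1, hy.2])
  refine ⟨x, x + δ, hxpq.1, by linarith, (hin _ ⟨by linarith, le_rfl⟩).2.2, ?_⟩
  intro y hy z hz hyz
  rcases (hin z hz).1 y hyz with h2 | h2
  · exact h2
  · have : |y - z| ≤ δ := abs_le.2 ⟨by linarith [hy.1, hz.2], by linarith [hz.1, hy.2]⟩
    linarith

/-- If a continuous open curve leaves the image of `[c, T]` immediately after time `T`,
then it is injective just after time `T`. -/
lemma exists_injOn_Icc_of_eventually_notMem [T2Space X] (hc : Continuous φ) (ho : IsOpenMap φ)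
    {c T : ℝ} (hcT : c < T) (h : ∀ᶠ x in 𝓝[>] T, φ x ∉ φ '' Icc c T) :
    ∃ T' > T, InjOn φ (Icc T T') := by
  by_contra! hcon
  obtain ⟨u, hTu, hu⟩ := (mem_nhdsGT_iff_exists_Ioo_subset).1 h
  replace hTu : T < u := hTu
  obtain ⟨e, hTe, heu⟩ := exists_between hTu
  have hout : ∀ x, T < x → x ≤ e → ∀ v, c ≤ v → v ≤ T → φ v ≠ φ x := fun x hx hxe v hv hvT hvx =>
    hu ⟨hx, hxe.trans_lt heu⟩ ⟨v, ⟨hv, hvT⟩, hvx⟩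
  have key : ∀ w, T < w → w ≤ e → ∃ x₁, T < x₁ ∧ x₁ < w ∧ φ x₁ = φ w := by
    intro w hTw hwe
    obtain ⟨p, hp, q, hq, hpq, hlt⟩ :
        ∃ p ∈ Icc T w, ∃ q ∈ Icc T w, φ p = φ q ∧ p < q := by
      have h1 := hcon w hTw
      simp only [InjOn, not_forall] at h1
      obtain ⟨p, hp, q, hq, hpq, hne⟩ := h1
      rcases lt_or_gt_of_ne hne with h2 | h2
      · exact ⟨p, hp, q, hq, hpq, h2⟩
      · exact ⟨q, hq, p, hp, hpq.symm, h2⟩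
    have hK : IsCompact ((Icc T w ×ˢ Icc T w) ∩ {z : ℝ × ℝ | φ z.1 = φ z.2}) :=
      (isCompact_Icc.prod isCompact_Icc).inter_right
        (isClosed_eq (hc.comp continuous_fst) (hc.comp continuous_snd))
    obtain ⟨⟨x₁, x₂⟩, ⟨⟨hx1, hx2⟩, hx12⟩, hmax⟩ := hK.exists_isMaxOn ⟨(p, q), ⟨hp, hq⟩, hpq⟩
      (f := fun z => z.2 - z.1) (by fun_prop)
    replace hmax : ∀ a b, T ≤ a → a ≤ w → T ≤ b → b ≤ w → φ a = φ b → b - a ≤ x₂ - x₁ :=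
      fun a b h1 h2 h3 h4 h5 => hmax (show (a, b) ∈ _ from ⟨⟨⟨h1, h2⟩, ⟨h3, h4⟩⟩, h5⟩)
    simp only [mem_Icc] at hx1 hx2 hp hq
    replace hx12 : φ x₁ = φ x₂ := hx12
    have hlt12 : x₁ < x₂ := by
      have := hmax p q hp.1 hp.2 hq.1 hq.2 hpq
      linarith
    have hTx1 : T < x₁ := by
      refine lt_of_le_of_ne hx1.1 ?_
      rintro rfl
      exact hout x₂ hlt12 (hx2.2.trans hwe) _ hcT.le le_rfl hx12
    by_cases hx2w : x₂ = w
    · exact ⟨x₁, hTx1, hx2w ▸ hlt12, hx2w ▸ hx12⟩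
    exfalso
    replace hx2w : x₂ < w := lt_of_le_of_ne hx2.2 hx2w
    have h1 : ∀ᶠ z in 𝓝[<] x₁, φ z ∈ φ '' Ioo x₁ w :=
      (hc.continuousAt.eventually
        (hx12 ▸ ho.image_mem_nhds (Ioo_mem_nhds hlt12 hx2w))).filter_mono nhdsWithin_le_nhds
    obtain ⟨z, ⟨z', hz', hzz⟩, hz⟩ := (h1.and (Ioo_mem_nhdsLT hTx1)).exists
    have hzy : φ z ≠ φ x₁ := by
      intro hzy
      have := hmax z x₂ hz.1.le (by linarith [hz.2]) (by linarith) hx2.2 (hzy.trans hx12)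
      linarith [hz.2]
    have hz'x2 : z' < x₂ := by
      by_contra! hle
      have := hmax z z' hz.1.le (by linarith [hz.2]) (by linarith) hz'.2.le hzz.symm
      linarith [hz.2]
    obtain ⟨a, b, ha1, haz, hzb, hb2, ha, hb, -⟩ :=
      exists_Ioo_disjoint_fiber hc rfl hx12.symm hz'.1 hz'x2 (hzz ▸ hzy)
    have hnot : φ x₁ ∉ φ '' Ico c x₁ := by
      rintro ⟨v, hv, hvy⟩
      rcases le_or_gt v T with hvT | hvT
      · exact hout x₁ hTx1 (by linarith) v hv.1 hvT hvy
      · have := hmax v x₂ hvT.le (by linarith [hv.2]) (by linarith) hx2.2 (hvy.trans hx12)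
        linarith [hv.2]
    have hsub : φ '' Ico c x₁ ⊆ φ '' Ioo a b :=
      subset_image_Ioo_of_isPreconnected hc ho (isPreconnected_Ico.image _ hc.continuousOn)
        (ha ▸ hnot) (hb ▸ hnot) ⟨φ z, ⟨z, ⟨by linarith [hz.1], hz.2⟩, rfl⟩, z', ⟨haz, hzb⟩, hzz⟩
    obtain ⟨v, hv, hvc⟩ := hsub ⟨c, ⟨le_rfl, by linarith⟩, rfl⟩
    exact hout v (by linarith [hv.1]) (by linarith [hv.2]) c le_rfl hcT.le hvc.symm
  obtain ⟨x, ⟨hx, hxe⟩, hmin⟩ := (isCompact_Icc.inter_right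
    (isClosed_singleton.preimage hc)).exists_isLeast (s := Icc T e ∩ φ ⁻¹' {φ e})
    ⟨e, right_mem_Icc.2 hTe.le, rfl⟩
  replace hxe : φ x = φ e := hxe
  have hTx : T < x := by
    refine lt_of_le_of_ne hx.1 ?_
    rintro rfl
    exact hout e hTe le_rfl _ hcT.le le_rfl hxe
  obtain ⟨x₁, h1, h2, h3⟩ := key x hTx hx.2
  exact absurd (hmin ⟨⟨h1.le, h2.le.trans hx.2⟩, h3.trans hxe⟩) (not_le.2 h2)

/-- The first time `T` at which a continuous open curve stops being injective: either it returns
to its starting point, or it folds back; in both cases it has already covered a neighbourhood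
of its position at time `T`. -/
lemma exists_isMax_injOn [T2Space X] [ConnectedSpace X] [Nontrivial X] (hc : Continuous φ)
    (ho : IsOpenMap φ) {c d s : ℝ} (hcd : c < d) (hinj : InjOn φ (Icc c d))
    (hs : ¬ InjOn φ (Icc c s)) :
    ∃ T, d ≤ T ∧ T ≤ s ∧ InjOn φ (Ico c T) ∧ φ '' Ioc c T ∈ 𝓝 (φ T) ∧
      (φ T = φ c ∨ InjOn φ (Icc c T)) := by
  set S : Set ℝ := {t | InjOn φ (Icc c t)} with hS
  have hbd : s ∈ upperBounds S := fun t ht => by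
    by_contra! hlt
    exact hs (InjOn.mono (Icc_subset_Icc_right hlt.le) ht)
  have hne : S.Nonempty := ⟨d, hinj⟩
  set T := sSup S with hT
  have hdT : d ≤ T := le_csSup ⟨s, hbd⟩ hinj
  have hcT : c < T := hcd.trans_le hdT
  have hTs : T ≤ s := csSup_le hne hbd
  have hgt : ∀ t > T, ¬ InjOn φ (Icc c t) := fun t ht h =>
    absurd (le_csSup ⟨s, hbd⟩ (show t ∈ S from h)) (not_le.2 ht)
  have hIco : InjOn φ (Ico c T) := by
    intro x hx y hy hxy
    obtain ⟨t, ht, hlt⟩ := exists_lt_of_lt_csSup hne (max_lt hx.2 hy.2)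
    exact ht ⟨hx.1, (le_max_left _ _).trans hlt.le⟩ ⟨hy.1, (le_max_right _ _).trans hlt.le⟩ hxy
  have hnotint : ∀ a ∈ Ioo c T, φ a ≠ φ T := by
    intro a ha haT
    obtain ⟨m, ham, hmT⟩ := exists_between ha.2
    have h1 : ∀ᶠ z in 𝓝[<] T, φ z ∈ φ '' Ioo c m :=
      (hc.continuousAt.eventually
        (haT ▸ ho.image_mem_nhds (Ioo_mem_nhds ha.1 ham))).filter_mono nhdsWithin_le_nhds
    obtain ⟨z, ⟨x, hx, hxz⟩, hz⟩ := (h1.and (Ioo_mem_nhdsLT hmT)).exists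
    have := hIco ⟨hx.1.le, hx.2.trans hmT⟩ ⟨by linarith [ha.1, hz.1], hz.2⟩ hxz
    linarith [hx.2, hz.1]
  have hcase : φ T = φ c ∨ InjOn φ (Icc c T) := by
    by_cases h : φ T = φ c
    · exact Or.inl h
    refine Or.inr ?_
    have haux : ∀ x ∈ Icc c T, φ x = φ T → x = T := by
      intro x hx hxT
      by_contra hne
      rcases eq_or_lt_of_le hx.1 with rfl | hlt
      · exact h hxT.symm
      · exact hnotint x ⟨hlt, lt_of_le_of_ne hx.2 hne⟩ hxT
    intro x hx y hy hxy
    rcases eq_or_lt_of_le hx.2 with rfl | hxT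
    · exact (haux y hy hxy.symm).symm
    rcases eq_or_lt_of_le hy.2 with rfl | hyT
    · exact haux x hx hxy
    exact hIco ⟨hx.1, hxT⟩ ⟨hy.1, hyT⟩ hxy
  have hneT := eventually_nhdsGT_ne hc ho T
  have hnec : ∀ᶠ x in 𝓝[>] T, φ x ≠ φ c := by
    by_cases h : φ T = φ c
    · rwa [← h]
    · exact (hc.continuousAt.eventually_ne h).filter_mono nhdsWithin_le_nhds
  have hfr : ∃ᶠ x in 𝓝[>] T, φ x ∈ φ '' Ioo c T := by
    rcases hcase with hTc | hI
    · intro hev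
      obtain ⟨u, hTu, hu⟩ := (mem_nhdsGT_iff_exists_Ioo_subset).1 (hev.and hneT)
      replace hTu : T < u := hTu
      obtain ⟨m, hcm, hmT⟩ := exists_between hcT
      have h1 : ∀ᶠ z in 𝓝[>] c, φ z ∈ φ '' Ioo m u :=
        (hc.continuousAt.eventually
          (hTc ▸ ho.image_mem_nhds (Ioo_mem_nhds hmT hTu))).filter_mono nhdsWithin_le_nhds
      obtain ⟨z, ⟨x, hx, hxz⟩, hz⟩ := (h1.and (Ioo_mem_nhdsGT hcm)).exists
      rcases lt_trichotomy x T with h | rfl | h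
      · have := hIco ⟨by linarith [hx.1], h⟩ ⟨hz.1.le, by linarith [hz.2]⟩ hxz
        linarith [hx.1, hz.2]
      · exact hnotint z ⟨hz.1, by linarith [hz.2]⟩ hxz.symm
      · exact (hu ⟨h, hx.2⟩).1 ⟨z, ⟨hz.1, by linarith [hz.2]⟩, hxz.symm⟩
    · intro hev
      have hev2 : ∀ᶠ x in 𝓝[>] T, φ x ∉ φ '' Icc c T := by
        filter_upwards [hev, hneT, hnec] with x h1 h2 h3
        rintro ⟨v, hv, hvx⟩
        refine h1 ⟨v, ⟨lt_of_le_of_ne hv.1 ?_, lt_of_le_of_ne hv.2 ?_⟩, hvx⟩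
        · rintro rfl; exact h3 hvx.symm
        · intro h; exact h2 (h ▸ hvx.symm)
      obtain ⟨T', hTT', hI'⟩ := exists_injOn_Icc_of_eventually_notMem hc ho hcT hev2
      obtain ⟨u, hTu, hu⟩ := (mem_nhdsGT_iff_exists_Ioo_subset).1 hev2
      replace hTu : T < u := hTu
      obtain ⟨t, hTt, ht⟩ := exists_between (lt_min hTT' hTu)
      have htT' := ht.trans_le (min_le_left _ _)
      have htu := ht.trans_le (min_le_right _ _)
      refine hgt t hTt ?_
      intro x hx y hy hxy
      rcases le_or_gt x T with hxT | hxT <;> rcases le_or_gt y T with hyT | hyT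
      · exact hI ⟨hx.1, hxT⟩ ⟨hy.1, hyT⟩ hxy
      · exact absurd ⟨x, ⟨hx.1, hxT⟩, hxy⟩ (hu ⟨hyT, hy.2.trans_lt htu⟩)
      · exact absurd ⟨y, ⟨hy.1, hyT⟩, hxy.symm⟩ (hu ⟨hxT, hx.2.trans_lt htu⟩)
      · exact hI' ⟨hxT.le, hx.2.trans htT'.le⟩ ⟨hyT.le, hy.2.trans htT'.le⟩ hxy
  refine ⟨T, hdT, hTs, hIco, ?_, hcase⟩
  obtain ⟨u, hTu, hu⟩ := (mem_nhdsGT_iff_exists_Ioo_subset).1 (hneT.and hnec)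
  replace hTu : T < u := hTu
  obtain ⟨x, hx, hxu⟩ := (hfr.and_eventually (Ioo_mem_nhdsGT hTu)).exists
  have hsub : φ '' Ioo T u ⊆ φ '' Ioo c T := by
    refine subset_image_Ioo_of_isPreconnected hc ho (isPreconnected_Ioo.image _ hc.continuousOn)
      ?_ ?_ ⟨φ x, ⟨x, hxu, rfl⟩, hx⟩
    · rintro ⟨v, hv, hvy⟩; exact (hu hv).2 hvy
    · rintro ⟨v, hv, hvy⟩; exact (hu hv).1 hvy
  refine Filter.mem_of_superset (ho.image_mem_nhds (Ioo_mem_nhds hcT hTu)) ?_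
  rintro _ ⟨v, hv, rfl⟩
  rcases le_or_gt v T with h | h
  · exact ⟨v, ⟨hv.1, h⟩, rfl⟩
  · exact image_mono Ioo_subset_Ioc_self (hsub ⟨v, ⟨h, hv.2⟩, rfl⟩)

lemma image_Icc_eq_univ [T2Space X] [ConnectedSpace X] (hc : Continuous φ)
    (ho : IsOpenMap φ) {a b : ℝ} (hab : a ≤ b) (ha : φ '' Icc a b ∈ 𝓝 (φ a))
    (hb : φ '' Icc a b ∈ 𝓝 (φ b)) : φ '' Icc a b = univ := by
  refine IsClopen.eq_univ ⟨(isCompact_Icc.image hc).isClosed, ?_⟩ ⟨φ a, a, left_mem_Icc.2 hab, rfl⟩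
  rw [isOpen_iff_mem_nhds]
  rintro _ ⟨t, ht, rfl⟩
  rcases eq_or_lt_of_le ht.1 with rfl | h1
  · exact ha
  rcases eq_or_lt_of_le ht.2 with rfl | h2
  · exact hb
  exact Filter.mem_of_superset (ho.image_mem_nhds (Ioo_mem_nhds h1 h2))
    (image_mono Ioo_subset_Icc_self)

lemma spaceIsArc_of_injOn [T2Space X] (hc : Continuous φ) {a b : ℝ} (hab : a < b)
    (hinj : InjOn φ (Icc a b)) (himg : φ '' Icc a b = univ) : SpaceIsArc X := by
  have hbij : Function.Bijective ((Icc a b).domRestrict φ) := by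
    refine ⟨injOn_iff_injective.1 hinj, fun x => ?_⟩
    obtain ⟨t, ht, rfl⟩ := himg ▸ mem_univ x
    exact ⟨⟨t, ht⟩, rfl⟩
  have hcont : Continuous (Equiv.ofBijective _ hbij) := hc.comp continuous_subtype_val
  exact ⟨hcont.homeoOfEquivCompactToT2.symm.trans (iccHomeoI a b hab)⟩

lemma spaceIsCircle_of_injOn [T2Space X] (hc : Continuous φ) {a b : ℝ} (hab : a < b)
    (hinj : InjOn φ (Ico a b)) (hends : φ b = φ a) (himg : φ '' Icc a b = univ) :
    SpaceIsCircle X := by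
  obtain ⟨p, rfl⟩ : ∃ p, b = a + p := ⟨b - a, by ring⟩
  have hp : 0 < p := by linarith
  have : Fact (0 < p) := ⟨hp⟩
  have hbij : Function.Bijective (AddCircle.liftIco p a φ) := by
    constructor
    · refine (injOn_iff_injective.1 hinj).comp (AddCircle.equivIco p a).injective
    · intro x
      obtain ⟨t, ht, rfl⟩ := himg ▸ mem_univ x
      rcases eq_or_lt_of_le ht.2 with rfl | h
      · exact ⟨(a : AddCircle p), by
          rw [AddCircle.liftIco_coe_apply ⟨le_rfl, hab⟩, hends]⟩
      · exact ⟨(t : AddCircle p), AddCircle.liftIco_coe_apply ⟨ht.1, h⟩⟩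
  have hcont : Continuous (Equiv.ofBijective _ hbij) :=
    AddCircle.liftIco_continuous hends.symm hc.continuousOn
  exact ⟨hcont.homeoOfEquivCompactToT2.symm.trans (AddCircle.homeomorphCircle hp.ne')⟩

/-- A space that carries a continuous open curve with two consecutive self-coincidences is an arc
or a circle. -/
lemma spaceIsArc_or_spaceIsCircle_of_coincidences [T2Space X] [ConnectedSpace X] [Nontrivial X]
    (hc : Continuous φ) (ho : IsOpenMap φ) {s₁ s₂ s₃ s₄ : ℝ} (h12 : s₁ < s₂) (h23 : s₂ < s₃)
    (h34 : s₃ < s₄) (h₁ : φ s₁ = φ s₂) (h₂ : φ s₃ = φ s₄) : SpaceIsArc X ∨ SpaceIsCircle X := by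
  obtain ⟨c, d, hc2, hcd, hd3, hinj⟩ := exists_injOn_Icc hc ho h23
  obtain ⟨T, hdT, -, hIco, hT, hcase⟩ := exists_isMax_injOn hc ho hcd hinj (s := s₄) (fun h =>
    absurd (h ⟨by linarith, h34.le⟩ ⟨by linarith, le_rfl⟩ h₂) h34.ne)
  have hcT : c < T := hcd.trans_le hdT
  have hT' : φ '' Icc c T ∈ 𝓝 (φ T) := Filter.mem_of_superset hT (image_mono Ioc_subset_Icc_self)
  rcases hcase with hTc | hI
  · exact Or.inr (spaceIsCircle_of_injOn hc hcT hIco hTc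
      (image_Icc_eq_univ hc ho hcT.le (hTc ▸ hT') hT'))
  have hc' : Continuous fun x => φ (-x) := hc.comp continuous_neg
  have ho' := isOpenMap_comp_neg ho
  obtain ⟨S, hcS, -, hIco', hS, hcase'⟩ := exists_isMax_injOn hc' ho' (c := -T) (d := -c)
    (s := -s₁) (by linarith)
    (fun x hx y hy hxy => neg_injective
      (hI ⟨by linarith [hx.2], by linarith [hx.1]⟩ ⟨by linarith [hy.2], by linarith [hy.1]⟩ hxy))
    (fun h => by
      have := @h (-s₁) ⟨by linarith, le_rfl⟩ (-s₂) ⟨by linarith, by linarith⟩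
        (by simpa using h₁)
      linarith)
  have hTS : -T < S := by linarith
  have hS' : (fun x => φ (-x)) '' Icc (-T) S ∈ 𝓝 (φ (-S)) :=
    Filter.mem_of_superset hS (image_mono Ioc_subset_Icc_self)
  have hT'' : (fun x => φ (-x)) '' Icc (-T) S ∈ 𝓝 (φ (- -T)) := by
    rw [neg_neg]
    refine Filter.mem_of_superset hT' ?_
    rintro _ ⟨t, ht, rfl⟩
    exact ⟨-t, ⟨by linarith [ht.2], by linarith [ht.1]⟩, by simp⟩
  have himg := image_Icc_eq_univ hc' ho' hTS.le hT'' hS'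
  rcases hcase' with h | h
  · exact Or.inr (spaceIsCircle_of_injOn hc' hTS hIco' h himg)
  · exact Or.inl (spaceIsArc_of_injOn hc' hTS h himg)

/-- A space that carries a continuous open curve with a fibre of at least four points is an arc
or a circle. -/
lemma spaceIsArc_or_spaceIsCircle_of_fiber [T2Space X] [ConnectedSpace X] [Nontrivial X]
    (hc : Continuous φ) (ho : IsOpenMap φ) {v : X} (s : Finset ℝ) (hs : s.card = 4)
    (hv : ∀ t ∈ s, φ t = v) : SpaceIsArc X ∨ SpaceIsCircle X := by
  have hmem : ∀ i, φ (s.orderEmbOfFin hs i) = v := fun i => hv _ (s.orderEmbOfFin_mem hs i)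
  have hlt := (s.orderEmbOfFin hs).strictMono
  exact spaceIsArc_or_spaceIsCircle_of_coincidences hc ho
    (hlt (show (0 : Fin 4) < 1 by decide)) (hlt (show (1 : Fin 4) < 2 by decide))
    (hlt (show (2 : Fin 4) < 3 by decide)) ((hmem _).trans (hmem _).symm)
    ((hmem _).trans (hmem _).symm)

end OpenCurves

/-- In a compact locally connected metric space, finitely many nonempty open sets suffice so that
every open curve of diameter larger than `c` covers one of them. -/
lemma exists_finite_family_subset_image {X : Type*} [MetricSpace X] [CompactSpace X]
    [LocallyConnectedSpace X] {c : ℝ} (hc0 : 0 < c) :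
    ∃ 𝒩 : Set (Set X), 𝒩.Finite ∧ (∀ N ∈ 𝒩, IsOpen N ∧ N.Nonempty) ∧
      ∀ φ : ℝ → X, Continuous φ → IsOpenMap φ → ∀ s t, s < t → c < dist (φ s) (φ t) →
        ∃ N ∈ 𝒩, N ⊆ φ '' Ioo s t := by
  have hN : ∀ x : X, ∃ N : Set X, N ⊆ ball x (c / 4) ∧ IsOpen N ∧ x ∈ N ∧ IsConnected N :=
    fun x => locallyConnectedSpace_iff_subsets_isOpen_isConnected.1 inferInstance x _
      (ball_mem_nhds x (by positivity))
  choose N hNb hNo hxN hNc using hN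
  obtain ⟨S, hS⟩ := isCompact_univ.elim_finite_subcover N hNo
    (fun x _ => mem_iUnion.2 ⟨x, hxN x⟩)
  refine ⟨N '' S, S.finite_toSet.image N, ?_, ?_⟩
  · rintro _ ⟨x, -, rfl⟩
    exact ⟨hNo x, x, hxN x⟩
  · intro φ hc ho s t hst hd
    have hivt := intermediate_value_Icc hst.le
      (f := fun u => dist (φ s) (φ u)) (by fun_prop)
    obtain ⟨u, hu, hud⟩ :=
      hivt ⟨by simp only [dist_self]; positivity, (half_lt_self hc0).le.trans hd.le⟩
    replace hud : dist (φ s) (φ u) = c / 2 := hud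
    obtain ⟨x, hxS, hux⟩ := mem_iUnion₂.1 (hS (mem_univ (φ u)))
    have hfar : ∀ z ∈ N x, dist z (φ u) < c / 2 := fun z hz => by
      have h1 := mem_ball.1 (hNb x hz)
      have h2 := mem_ball.1 (hNb x hux)
      have := dist_triangle_right z (φ u) x
      linarith
    refine ⟨N x, ⟨x, hxS, rfl⟩, ?_⟩
    have hut : c / 2 < dist (φ u) (φ t) := by
      have := dist_triangle (φ s) (φ u) (φ t)
      linarith
    refine subset_image_Ioo_of_isPreconnected hc ho (hNc x).isPreconnected ?_ ?_
      ⟨φ u, hux, u, ⟨lt_of_le_of_ne hu.1 ?_, lt_of_le_of_ne hu.2 ?_⟩, rfl⟩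
    · intro h; exact absurd (hfar _ h) (by rw [hud]; exact lt_irrefl _)
    · intro h
      have := hfar _ h
      rw [dist_comm] at this
      linarith
    · rintro rfl; rw [dist_self] at hud; linarith
    · rintro rfl; rw [dist_self] at hut; linarith

/-- A sensitive semigroup of continuous open maps of a compact locally connected space with an open
curve has a nonempty open set `N`, contained in an open curve, such that every nonempty open subset
of `N` is mapped over `N` by some element of the semigroup. -/
lemma exists_open_recurrent {X : Type*} [MetricSpace X] [CompactSpace X]
    [LocallyConnectedSpace X] {ψ₀ : ℝ → X} (hψ₀ : Continuous ψ₀) (hψ₀' : IsOpenMap ψ₀)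
    (F : Set (X → X)) (hcont : ∀ f ∈ F, Continuous f) (hopen : ∀ f ∈ F, IsOpenMap f)
    (hsemi : ∀ f ∈ F, ∀ g ∈ F, f ∘ g ∈ F)
    (hsens : ∃ c > (0:ℝ), ∀ U : Set X, IsOpen U → U.Nonempty →
      ∃ f ∈ F, c < Metric.diam (f '' U)) :
    ∃ N : Set X, IsOpen N ∧ N.Nonempty ∧
      (∃ ψ : ℝ → X, Continuous ψ ∧ IsOpenMap ψ ∧ N ⊆ range ψ) ∧
      ∀ A ⊆ N, IsOpen A → A.Nonempty → ∃ f ∈ F, N ⊆ f '' A := by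
  obtain ⟨c, hc0, hsens⟩ := hsens
  obtain ⟨𝒩, hfin, hne, hcov⟩ := exists_finite_family_subset_image (X := X) hc0
  let good : Set (Set X) := {N ∈ 𝒩 | ∃ ψ : ℝ → X, Continuous ψ ∧ IsOpenMap ψ ∧ N ⊆ range ψ}
  have step : ∀ ψ : ℝ → X, Continuous ψ → IsOpenMap ψ → ∀ A : Set X, IsOpen A →
      (A ∩ range ψ).Nonempty → ∃ f ∈ F, ∃ N ∈ good, N ⊆ f '' A := by
    rintro ψ hψ hψ' A hA ⟨_, hxA, x, rfl⟩
    obtain ⟨ε, hε, hball⟩ := Metric.isOpen_iff.1 (hA.preimage hψ) x hxA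
    rw [Real.ball_eq_Ioo] at hball
    obtain ⟨f, hf, hdiam⟩ := hsens (ψ '' Ioo (x - ε) (x + ε)) (hψ' _ isOpen_Ioo)
      ⟨ψ x, x, ⟨by linarith, by linarith⟩, rfl⟩
    have hcomp : Continuous (f ∘ ψ) := (hcont f hf).comp hψ
    have hcomp' : IsOpenMap (f ∘ ψ) := (hopen f hf).comp hψ'
    obtain ⟨s, hs, t, ht, hst, hd⟩ : ∃ s ∈ Ioo (x - ε) (x + ε), ∃ t ∈ Ioo (x - ε) (x + ε),
        s < t ∧ c < dist ((f ∘ ψ) s) ((f ∘ ψ) t) := by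
      by_contra! hcon
      refine absurd hdiam (not_lt.2 (Metric.diam_le_of_forall_dist_le hc0.le ?_))
      rintro _ ⟨_, ⟨s, hs, rfl⟩, rfl⟩ _ ⟨_, ⟨t, ht, rfl⟩, rfl⟩
      rcases lt_trichotomy s t with h | rfl | h
      · exact hcon s hs t ht h
      · rw [dist_self]; exact hc0.le
      · rw [dist_comm]; exact hcon t ht s hs h
    obtain ⟨N, hN, hsub⟩ := hcov _ hcomp hcomp' s t hst hd
    refine ⟨f, hf, N, ⟨hN, _, hcomp, hcomp', hsub.trans (image_subset_range _ _)⟩,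
      hsub.trans ?_⟩
    rw [image_comp]
    refine image_mono ?_
    rintro _ ⟨v, hv, rfl⟩
    exact hball ⟨hs.1.trans hv.1, hv.2.trans ht.2⟩
  have step' : ∀ M ∈ good, ∀ A ⊆ M, IsOpen A → A.Nonempty →
      ∃ f ∈ F, ∃ N ∈ good, N ⊆ f '' A := by
    rintro M ⟨-, ψ, hψ, hψ', hM⟩ A hAM hA ⟨x, hx⟩
    exact step ψ hψ hψ' A hA ⟨x, hx, hM (hAM hx)⟩
  let reach : Set X → Set (Set X) := fun M => {N ∈ good | ∃ f ∈ F, N ⊆ f '' M}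
  have hreach : ∀ M, ∀ N ∈ reach M, reach N ⊆ reach M := by
    rintro M N ⟨-, f, hf, hN⟩ K ⟨hK, g, hg, hK'⟩
    refine ⟨hK, g ∘ f, hsemi g hg f hf, hK'.trans ?_⟩
    rw [image_comp]
    exact image_mono hN
  have hgfin : good.Finite := hfin.subset fun N hN => hN.1
  obtain ⟨-, -, N₀, hN₀, -⟩ := step ψ₀ hψ₀ hψ₀' univ isOpen_univ ⟨ψ₀ 0, mem_univ _, 0, rfl⟩
  obtain ⟨M, hM, hmin⟩ := hgfin.exists_minimalFor reach good ⟨N₀, hN₀⟩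
  have hmin' : ∀ N ∈ reach M, reach N = reach M := fun N hN =>
    (hreach M N hN).antisymm (hmin hN.1 (hreach M N hN))
  obtain ⟨f, hf, N, hN, hNM⟩ := step' M hM M subset_rfl (hne M hM.1).1 (hne M hM.1).2
  have hNr : N ∈ reach M := ⟨hN, f, hf, hNM⟩
  refine ⟨N, (hne N hN.1).1, (hne N hN.1).2, hN.2, fun A hAN hA hAne => ?_⟩
  obtain ⟨a, ha, K, hK, hKA⟩ := step' N hN A hAN hA hAne
  have hKr : K ∈ reach N := ⟨hK, a, ha, hKA.trans (image_mono hAN)⟩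
  have hNK : N ∈ reach K := by
    rwa [hmin' K (hmin' N hNr ▸ hKr)]
  obtain ⟨-, g, hg, hNg⟩ := hNK
  refine ⟨g ∘ a, hsemi g hg a ha, hNg.trans ?_⟩
  rw [image_comp]
  exact image_mono hKA

/-- A free open interval carries an injective continuous open curve. -/
lemma IsFreeOpenInterval.exists_curve {X : Type*} [TopologicalSpace X] {J : Set X}
    (hJ : IsFreeOpenInterval J) :
    ∃ ψ : ℝ → X, Continuous ψ ∧ IsOpenMap ψ ∧ Function.Injective ψ := by
  obtain ⟨hJo, ⟨e⟩⟩ := hJ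
  let e₁ : ℝ ≃ₜ Ioo (0:ℝ) 1 := (StrictMono.orderIsoOfSurjective
    (fun x : ℝ => (⟨x.sigmoid, x.sigmoid_pos, x.sigmoid_lt_one⟩ : Ioo (0:ℝ) 1))
    (fun _ _ h => Real.sigmoid_strictMono h) (fun ⟨y, hy⟩ => by
      obtain ⟨x, rfl⟩ := Real.range_sigmoid ▸ hy
      exact ⟨x, rfl⟩)).toHomeomorph
  let e₂ : ℝ ≃ₜ J := e₁.trans e.symm
  exact ⟨fun x => e₂ x, continuous_subtype_val.comp e₂.continuous,
    hJo.isOpenMap_subtype_val.comp e₂.isOpenMap, Subtype.val_injective.comp e₂.injective⟩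

/-- A Peano continuum having a free arc which admits a sensitive
commutative subsemigroup of `C⁰(X)` consisting of continuous open maps is
either an arc or a circle. -/
theorem stmt_0 (X : Type*) [MetricSpace X] [CompactSpace X] [ConnectedSpace X]
    [LocallyConnectedSpace X]
    (hfree : ∃ A : Set X, IsFreeArc A)
    (F : Set (X → X))
    (hcont : ∀ f ∈ F, Continuous f)
    (hopen : ∀ f ∈ F, IsOpenMap f)
    (hsemi : ∀ f ∈ F, ∀ g ∈ F, f ∘ g ∈ F)
    (hcomm : ∀ f ∈ F, ∀ g ∈ F, f ∘ g = g ∘ f)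
    (hsens : ∃ c > (0:ℝ), ∀ U : Set X, IsOpen U → U.Nonempty →
      ∃ f ∈ F, c < Metric.diam (f '' U)) :
    SpaceIsArc X ∨ SpaceIsCircle X := by
  obtain ⟨-, J, hJ, -, -⟩ := hfree
  obtain ⟨ψ₀, hψ₀, hψ₀', hψ₀i⟩ := hJ.exists_curve
  have : Nontrivial X := ⟨ψ₀ 0, ψ₀ 1, hψ₀i.ne zero_ne_one⟩
  obtain ⟨N, hNo, hNe, ⟨ψ, hψ, hψ', hNψ⟩, hrec⟩ :=
    exists_open_recurrent hψ₀ hψ₀' F hcont hopen hsemi hsens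
  obtain ⟨x, hx, y, hy, hxy⟩ : N.Nontrivial := by
    by_contra h
    have hN : N.Subsingleton := not_nontrivial_iff.1 h
    have := IsClopen.eq_univ ⟨hN.isClosed, hNo⟩ hNe
    exact not_subsingleton X (subsingleton_univ_iff.1 (this ▸ hN))
  obtain ⟨U, V, hU, hV, hxU, hyV, hUV⟩ := t2_separation hxy
  obtain ⟨f, hf, hfA⟩ := hrec (N ∩ U) inter_subset_left (hNo.inter hU) ⟨x, hx, hxU⟩
  obtain ⟨g, hg, hgB⟩ := hrec (N ∩ V) inter_subset_left (hNo.inter hV) ⟨y, hy, hyV⟩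
  have hfg : ∀ z, f (g z) = g (f z) := congrFun (hcomm f hf g hg)
  have hhU : ∀ v ∈ N, ∃ z ∈ N ∩ U, f (g z) = v := fun v hv => by
    obtain ⟨b, hb, rfl⟩ := hgB hv
    obtain ⟨a, ha, rfl⟩ := hfA hb.1
    exact ⟨a, ha, hfg a⟩
  have hhV : ∀ v ∈ N, ∃ z ∈ N ∩ V, f (g z) = v := fun v hv => by
    obtain ⟨a, ha, rfl⟩ := hfA hv
    obtain ⟨b, hb, rfl⟩ := hgB ha.1
    exact ⟨b, hb, rfl⟩
  have hne : ∀ {p q : X}, p ∈ N ∩ U → q ∈ N ∩ V → p ≠ q := fun hp hq =>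
    hUV.ne_of_mem hp.2 hq.2
  have hc : Continuous (f ∘ g) := (hcont f hf).comp (hcont g hg)
  have ho : IsOpenMap (f ∘ g) := (hopen f hf).comp (hopen g hg)
  obtain ⟨z, hz, hzx⟩ := hhU x hx
  obtain ⟨w, hw, hwx⟩ := hhV x hx
  obtain ⟨p₁, hp₁, h₁⟩ := hhU z hz.1
  obtain ⟨p₂, hp₂, h₂⟩ := hhV z hz.1
  obtain ⟨p₃, hp₃, h₃⟩ := hhU w hw.1
  obtain ⟨p₄, hp₄, h₄⟩ := hhV w hw.1
  obtain ⟨t₁, rfl⟩ := hNψ hp₁.1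
  obtain ⟨t₂, rfl⟩ := hNψ hp₂.1
  obtain ⟨t₃, rfl⟩ := hNψ hp₃.1
  obtain ⟨t₄, rfl⟩ := hNψ hp₄.1
  have hzw := hne hz hw
  have h12 : t₁ ≠ t₂ := ne_of_apply_ne ψ (hne hp₁ hp₂)
  have h34 : t₃ ≠ t₄ := ne_of_apply_ne ψ (hne hp₃ hp₄)
  have h13 : t₁ ≠ t₃ := by rintro rfl; exact hzw (h₁.symm.trans h₃)
  have h14 : t₁ ≠ t₄ := by rintro rfl; exact hzw (h₁.symm.trans h₄)
  have h23 : t₂ ≠ t₃ := by rintro rfl; exact hzw (h₂.symm.trans h₃)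
  have h24 : t₂ ≠ t₄ := by rintro rfl; exact hzw (h₂.symm.trans h₄)
  refine spaceIsArc_or_spaceIsCircle_of_fiber (φ := (f ∘ g) ∘ (f ∘ g) ∘ ψ) (v := x)
    (hc.comp (hc.comp hψ)) (ho.comp (ho.comp hψ')) {t₁, t₂, t₃, t₄} ?_ ?_
  · simp [h12, h13, h14, h23, h24, h34]
  · simp [h₁, h₂, h₃, h₄, hzx, hwx]
end

section
/- Let X be a nondegenerate Peano continuum, and let a ∈ X be such that some neighborhood U of a contains no simple triod. Then: (i) if a is an endpoint of X, there exists a connected open neighborhood V of a homeomorphic to the half-open interval [0,1); (ii) if a is not an endpoint of X, there exists a connected open neighborhood V of a homeomorphic to the open interval (0,1). -/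
open Set Metric Topology

/-- `f` is a step function on `[s, t]`, constant on half-open pieces, with all jumps less
than `δ`. -/
inductive StepPath {X : Type*} [MetricSpace X] (δ : ℝ) : ℝ → ℝ → (ℝ → X) → Prop
  | single {s t : ℝ} {f : ℝ → X} (hst : s < t) (hd : dist (f s) (f t) < δ)
      (hc : ∀ u ∈ Ico s t, f u = f s) : StepPath δ s t f
  | concat {s m t : ℝ} {f : ℝ → X} (h₁ : StepPath δ s m f) (h₂ : StepPath δ m t f) :
      StepPath δ s t f

namespace StepPath

variable {X : Type*} [MetricSpace X] {δ s m t : ℝ} {f g : ℝ → X}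

lemma lt (h : StepPath δ s t f) : s < t := by
  induction h with
  | single hst _ _ => exact hst
  | concat _ _ h₁ h₂ => exact h₁.trans h₂

lemma congr (h : StepPath δ s t f) (hfg : EqOn f g (Icc s t)) : StepPath δ s t g := by
  induction h with
  | single hst hd hc =>
    have hs := hfg (left_mem_Icc.2 hst.le)
    refine single hst ?_ fun u hu => ?_
    · rwa [← hs, ← hfg (right_mem_Icc.2 hst.le)]
    · rw [← hfg ⟨hu.1, hu.2.le⟩, hc u hu, hs]
  | concat h₁ h₂ ih₁ ih₂ =>
    exact concat (ih₁ (hfg.mono (Icc_subset_Icc_right h₂.lt.le)))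
      (ih₂ (hfg.mono (Icc_subset_Icc_left h₁.lt.le)))

lemma glue (hf : StepPath δ s m f) (hg : StepPath δ m t g) (hm : f m = g m) :
    ∃ k, StepPath δ s t k ∧ EqOn f k (Icc s m) ∧ EqOn g k (Icc m t) := by
  have h₁ : EqOn f (fun u => if u ≤ m then f u else g u) (Icc s m) := fun u hu => by
    simp [hu.2]
  have h₂ : EqOn g (fun u => if u ≤ m then f u else g u) (Icc m t) := fun u hu => by
    rcases hu.1.eq_or_lt with rfl | h
    · simp [hm]
    · simp [h.not_ge]
  exact ⟨_, concat (hf.congr h₁) (hg.congr h₂), h₁, h₂⟩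

lemma eventually_dist_lt (h : StepPath δ s t f) :
    ∀ u ∈ Icc s t, ∀ᶠ v in 𝓝[Icc s t] u, dist (f v) (f u) < δ := by
  induction h with
  | @single s t f hst hd hc =>
    have hδ : 0 < δ := dist_nonneg.trans_lt hd
    intro u hu
    rcases hu.2.eq_or_lt with rfl | hut
    · filter_upwards [self_mem_nhdsWithin] with v hv
      rcases hv.2.eq_or_lt with rfl | hvu
      · simpa using hδ
      · rwa [hc v ⟨hv.1, hvu⟩]
    · filter_upwards [self_mem_nhdsWithin, mem_nhdsWithin_of_mem_nhds (Iio_mem_nhds hut)]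
        with v hv hvt
      rw [hc v ⟨hv.1, hvt⟩, hc u ⟨hu.1, hut⟩]
      simpa using hδ
  | @concat s m t f h₁ h₂ ih₁ ih₂ =>
    intro u _
    rw [← Icc_union_Icc_eq_Icc h₁.lt.le h₂.lt.le, nhdsWithin_union, Filter.eventually_sup]
    constructor
    · by_cases hu : u ∈ Icc s m
      · exact ih₁ u hu
      · rw [notMem_closure_iff_nhdsWithin_eq_bot.1 (by rwa [isClosed_Icc.closure_eq])]
        exact Filter.eventually_bot
    · by_cases hu : u ∈ Icc m t
      · exact ih₂ u hu
      · rw [notMem_closure_iff_nhdsWithin_eq_bot.1 (by rwa [isClosed_Icc.closure_eq])]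
        exact Filter.eventually_bot

end StepPath

section LocallyPathConnected

variable {X : Type*} [MetricSpace X]

lemma IsPreconnected.exists_stepPath {C : Set X} (hC : IsPreconnected C) {δ : ℝ} (hδ : 0 < δ)
    {x y : X} (hx : x ∈ C) (hy : y ∈ C) :
    ∀ s t : ℝ, s < t → ∃ g, StepPath δ s t g ∧ g s = x ∧ g t = y ∧ ∀ u ∈ Icc s t, g u ∈ C := by
  refine hC.induction₂' (P := fun x y => ∀ s t : ℝ, s < t → ∃ g, StepPath δ s t g ∧ g s = x ∧
    g t = y ∧ ∀ u ∈ Icc s t, g u ∈ C) (fun x hx => ?_) (fun x y z _ _ _ hxy hyz s t hst => ?_) hx hy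
  · have key : ∀ x ∈ C, ∀ y ∈ C, dist x y < δ → ∀ s t : ℝ, s < t →
        ∃ g, StepPath δ s t g ∧ g s = x ∧ g t = y ∧ ∀ u ∈ Icc s t, g u ∈ C := by
      intro x hx y hy hxy s t hst
      refine ⟨fun u => if u < t then x else y, .single hst ?_ fun u hu => ?_, ?_, ?_, fun u _ => ?_⟩
      · simpa [hst]
      · simp [hu.2, hst]
      · simp [hst]
      · simp
      · dsimp only
        split_ifs <;> assumption
    filter_upwards [self_mem_nhdsWithin, mem_nhdsWithin_of_mem_nhds (ball_mem_nhds x hδ)]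
      with y hy hyx
    exact ⟨key x hx y hy (by rwa [dist_comm]), key y hy x hx hyx⟩
  · obtain ⟨f, hf, hfs, hft, hfC⟩ := hxy s ((s + t) / 2) (by linarith)
    obtain ⟨g, hg, hgs, hgt, hgC⟩ := hyz ((s + t) / 2) t (by linarith)
    obtain ⟨k, hk, hfk, hgk⟩ := hf.glue hg (hft.trans hgs.symm)
    refine ⟨k, hk, ?_, ?_, fun u hu => ?_⟩
    · rw [← hfk (left_mem_Icc.2 hf.lt.le), hfs]
    · rw [← hgk (right_mem_Icc.2 hg.lt.le), hgt]
    · rcases le_total u ((s + t) / 2) with h | h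
      · rw [← hfk ⟨hu.1, h⟩]
        exact hfC u ⟨hu.1, h⟩
      · rw [← hgk ⟨h, hu.2⟩]
        exact hgC u ⟨h, hu.2⟩

lemma StepPath.refine {δ δ' ε s t : ℝ} {f : ℝ → X} (hδ' : 0 < δ')
    (hC : ∀ x y : X, dist x y < δ → ∃ C ⊆ ball x ε, IsPreconnected C ∧ x ∈ C ∧ y ∈ C)
    (hf : StepPath δ s t f) :
    ∃ g, StepPath δ' s t g ∧ g s = f s ∧ g t = f t ∧
      ∀ u ∈ Icc s t, dist (f u) (g u) ≤ ε := by
  induction hf with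
  | @single s t f hst hd hc =>
    obtain ⟨C, hCε, hCc, hx, hy⟩ := hC _ _ hd
    obtain ⟨g, hg, hgs, hgt, hgC⟩ := hCc.exists_stepPath hδ' hx hy s t hst
    refine ⟨g, hg, hgs, hgt, fun u hu => ?_⟩
    rcases hu.2.eq_or_lt with rfl | hut
    · rw [hgt, dist_self]
      exact dist_nonneg.trans (mem_ball.1 (hCε hy)).le
    · rw [hc u ⟨hu.1, hut⟩, dist_comm]
      exact (mem_ball.1 (hCε (hgC u hu))).le
  | @concat s m t f h₁ h₂ ih₁ ih₂ =>
    obtain ⟨g, hg, hgs, hgm, hgd⟩ := ih₁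
    obtain ⟨k, hk, hks, hkt, hkd⟩ := ih₂
    obtain ⟨l, hl, hgl, hkl⟩ := hg.glue hk (hgm.trans hks.symm)
    refine ⟨l, hl, ?_, ?_, fun u hu => ?_⟩
    · rw [← hgl (left_mem_Icc.2 hg.lt.le), hgs]
    · rw [← hkl (right_mem_Icc.2 hk.lt.le), hkt]
    · rcases le_total u m with h | h
      · rw [← hgl ⟨hu.1, h⟩]
        exact hgd u ⟨hu.1, h⟩
      · rw [← hkl ⟨h, hu.2⟩]
        exact hkd u ⟨h, hu.2⟩

variable [CompactSpace X] [LocallyConnectedSpace X]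

lemma exists_preconnected_subset_ball {ε : ℝ} (hε : 0 < ε) :
    ∃ δ > 0, ∀ x y : X, dist x y < δ → ∃ C ⊆ ball x ε, IsPreconnected C ∧ x ∈ C ∧ y ∈ C := by
  have h : ∀ z : X, ∃ V ⊆ ball z (ε / 2), IsOpen V ∧ z ∈ V ∧ IsConnected V := fun z =>
    locallyConnectedSpace_iff_subsets_isOpen_isConnected.1 ‹_› z _ (ball_mem_nhds z (half_pos hε))
  choose V hV hVo hzV hVc using h
  obtain ⟨δ, hδ, H⟩ := lebesgue_number_lemma_of_metric isCompact_univ hVo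
    (fun z _ => mem_iUnion.2 ⟨z, hzV z⟩)
  refine ⟨δ, hδ, fun x y hxy => ?_⟩
  obtain ⟨z, hz⟩ := H x trivial
  have hx := hz (mem_ball_self hδ)
  refine ⟨V z, fun w hw => ?_, (hVc z).isPreconnected, hx, hz (by rwa [mem_ball, dist_comm])⟩
  have h₁ := mem_ball.1 (hV z hw)
  have h₂ := mem_ball'.1 (hV z hx)
  have := dist_triangle w z x
  rw [mem_ball]
  linarith

lemma exists_joinedIn_ball {ε : ℝ} (hε : 0 < ε) :
    ∃ δ > 0, ∀ x y : X, dist x y < δ → JoinedIn (ball x ε) x y := by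
  have hE : ∀ n : ℕ, 0 < ε / 4 / 2 / 2 ^ n := fun n => by positivity
  choose d hd hC using fun n => exists_preconnected_subset_ball (X := X) (hE n)
  let δ : ℕ → ℝ := fun n => min (d n) (ε / 4 / 2 ^ n)
  have hδ : ∀ n, 0 < δ n := fun n => lt_min (hd n) (by positivity)
  refine ⟨δ 0, hδ 0, fun x y hxy => ?_⟩
  let P : ℕ → (ℝ → X) → Prop := fun n f => StepPath (δ n) 0 1 f ∧ f 0 = x ∧ f 1 = y
  have h0 : P 0 (fun u => if u < 1 then x else y) := by
    refine ⟨.single one_pos (by simpa using hxy) fun u hu => ?_, by simp, by simp⟩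
    simp [hu.2]
  have hs : ∀ n (f : {f // P n f}), ∃ g : {g // P (n + 1) g},
      ∀ u ∈ Icc (0 : ℝ) 1, dist (f.1 u) (g.1 u) ≤ ε / 4 / 2 / 2 ^ n := by
    rintro n ⟨f, hf, hfx, hfy⟩
    obtain ⟨g, hg, hg0, hg1, hgd⟩ := hf.refine (hδ (n + 1))
      fun x y h => hC n x y (h.trans_le (min_le_left _ _))
    exact ⟨⟨g, hg, hg0.trans hfx, hg1.trans hfy⟩, hgd⟩
  choose next hnext using hs
  let F : ∀ n, {f // P n f} := fun n => Nat.rec ⟨_, h0⟩ next n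
  have hF : ∀ n, ∀ u ∈ Icc (0 : ℝ) 1,
      dist ((F n).1 u) ((F (n + 1)).1 u) ≤ ε / 4 / 2 / 2 ^ n := fun n => hnext n (F n)
  have hlim : ∀ u : unitInterval, ∃ z, Filter.Tendsto (fun n => (F n).1 u) Filter.atTop (𝓝 z) :=
    fun u => cauchySeq_tendsto_of_complete (cauchySeq_of_le_geometric_two fun n => hF n u u.2)
  choose γ hγ using hlim
  have hγd : ∀ n (u : unitInterval), dist ((F n).1 u) (γ u) ≤ ε / 4 / 2 ^ n := fun n u =>
    dist_le_of_le_geometric_two_of_tendsto (fun n => hF n u u.2) (hγ u) n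
  have hcont : Continuous γ := by
    rw [continuous_iff_continuousAt]
    intro u
    rw [ContinuousAt, Metric.tendsto_nhds]
    intro η hη
    obtain ⟨n, hn⟩ : ∃ n : ℕ, ε / 4 / 2 ^ n < η / 3 := by
      have := tendsto_pow_atTop_nhds_zero_of_lt_one (r := (1 / 2 : ℝ)) (by norm_num) (by norm_num)
      have := (this.const_mul (ε / 4)).eventually_lt_const (u := η / 3) (by simpa using hη)
      obtain ⟨n, hn⟩ := this.exists
      exact ⟨n, by simpa [div_eq_mul_inv] using hn⟩
    have h₁ := (F n).2.1.eventually_dist_lt u u.2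
    have h₂ : Filter.Tendsto (Subtype.val : unitInterval → ℝ) (𝓝 u) (𝓝[Icc 0 1] (u : ℝ)) :=
      tendsto_nhdsWithin_iff.2 ⟨continuous_subtype_val.continuousAt, .of_forall fun v => v.2⟩
    filter_upwards [h₂.eventually h₁] with v hv
    have h₃ := hγd n u
    have h₄ := hγd n v
    have h₅ : δ n ≤ ε / 4 / 2 ^ n := min_le_right _ _
    have h₆ := dist_triangle4 (γ v) ((F n).1 v) ((F n).1 u) (γ u)
    rw [dist_comm (γ v) ((F n).1 v)] at h₆
    linarith
  have hend : ∀ u : unitInterval, ∀ z, (∀ n, (F n).1 u = z) → γ u = z := fun u z h =>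
    tendsto_nhds_unique (hγ u) (by simp [h])
  refine ⟨⟨⟨γ, hcont⟩, hend 0 x fun n => (F n).2.2.1, hend 1 y fun n => (F n).2.2.2⟩, fun u => ?_⟩
  have h₁ := hγd 0 u
  have h₂ : dist x ((F 0).1 u) < ε / 4 + ε / 4 := by
    change dist x (if (u : ℝ) < 1 then x else y) < _
    have : δ 0 ≤ ε / 4 / 2 ^ 0 := min_le_right _ _
    norm_num at this
    split_ifs
    · simpa using hε
    · linarith
  have h₃ := dist_triangle x ((F 0).1 u) (γ u)
  norm_num at h₁
  change γ u ∈ ball x ε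
  rw [mem_ball']
  linarith

lemma locallyPathConnectedSpace_of_locallyConnectedSpace : LocallyPathConnectedSpace X := by
  rw [locallyPathConnectedSpace_iff_pathComponentIn_mem_nhds]
  intro x u hu hx
  obtain ⟨ε, hε, hεu⟩ := Metric.isOpen_iff.1 hu x hx
  obtain ⟨δ, hδ, H⟩ := exists_joinedIn_ball (X := X) hε
  filter_upwards [ball_mem_nhds x hδ] with y hy
  exact (H x y (mem_ball'.1 hy)).mono hεu

end LocallyPathConnected

section PathToArc

variable {X : Type*}

/-- `K` is obtained from `[0, 1]` by removing disjoint open intervals along which `γ` is a loop. -/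
structure IsLoopReduction (γ : ℝ → X) (K : Set ℝ) : Prop where
  isClosed : IsClosed K
  subset_Icc : K ⊆ Icc 0 1
  zero_mem : 0 ∈ K
  one_mem : 1 ∈ K
  eq_of_gap : ∀ s ∈ K, ∀ t ∈ K, s < t → (∀ u ∈ K, u ∉ Ioo s t) → γ s = γ t

namespace IsLoopReduction

variable {γ : ℝ → X} {K : Set ℝ}

lemma exists_prev (hK : IsLoopReduction γ K) {u : ℝ} (hu : 0 ≤ u) :
    ∃ p ∈ K, p ≤ u ∧ ∀ k ∈ K, k ≤ u → k ≤ p := by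
  have hc : IsCompact (K ∩ Iic u) :=
    (isCompact_Icc.of_isClosed_subset hK.isClosed hK.subset_Icc).inter_right isClosed_Iic
  obtain ⟨p, hp, hmax⟩ := hc.exists_isGreatest ⟨0, hK.zero_mem, hu⟩
  exact ⟨p, hp.1, hp.2, fun k hk hku => hmax ⟨hk, hku⟩⟩

lemma exists_next (hK : IsLoopReduction γ K) {u : ℝ} (hu : u ≤ 1) :
    ∃ q ∈ K, u ≤ q ∧ ∀ k ∈ K, u ≤ k → q ≤ k := by
  have hc : IsCompact (K ∩ Ici u) :=
    (isCompact_Icc.of_isClosed_subset hK.isClosed hK.subset_Icc).inter_right isClosed_Ici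
  obtain ⟨p, hp, hmin⟩ := hc.exists_isLeast ⟨1, hK.one_mem, hu⟩
  exact ⟨p, hp.1, hp.2, fun k hk hku => hmin ⟨hk, hku⟩⟩

lemma eq_prev_next (hK : IsLoopReduction γ K) {u p q : ℝ} (hp : p ∈ K) (hpu : p ≤ u)
    (hpmax : ∀ k ∈ K, k ≤ u → k ≤ p) (hq : q ∈ K) (huq : u ≤ q) (hqmin : ∀ k ∈ K, u ≤ k → q ≤ k) :
    γ p = γ q := by
  rcases (hpu.trans huq).eq_or_lt with rfl | h
  · rfl
  · refine hK.eq_of_gap p hp q hq h fun k hk hkpq => ?_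
    rcases le_total k u with hku | hku
    · exact (hpmax k hk hku).not_gt hkpq.1
    · exact (hqmin k hk hku).not_gt hkpq.2

lemma diff_Ioo (hK : IsLoopReduction γ K) {s t : ℝ} (hs : s ∈ K) (ht : t ∈ K)
    (hst : γ s = γ t) : IsLoopReduction γ (K \ Ioo s t) := by
  refine ⟨hK.isClosed.sdiff isOpen_Ioo, sdiff_subset.trans hK.subset_Icc,
    ⟨hK.zero_mem, fun h => (hK.subset_Icc hs).1.not_gt h.1⟩,
    ⟨hK.one_mem, fun h => (hK.subset_Icc ht).2.not_gt h.2⟩, fun c hc d hd hcd hgap => ?_⟩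
  by_cases hex : ∃ e ∈ K, e ∈ Ioo c d
  · obtain ⟨e, he, hce, hed⟩ := hex
    have hest : e ∈ Ioo s t := by
      by_contra h
      exact hgap e ⟨he, h⟩ ⟨hce, hed⟩
    have hcs : c ≤ s := by
      by_contra! h
      exact hc.2 ⟨h, hce.trans hest.2⟩
    have htd : t ≤ d := by
      by_contra! h
      exact hd.2 ⟨hest.1.trans hed, h⟩
    have h₁ : ¬ c < s := fun h => hgap s ⟨hs, fun h' => h'.1.false⟩ ⟨h, hest.1.trans hed⟩
    have h₂ : ¬ t < d := fun h => hgap t ⟨ht, fun h' => h'.2.false⟩ ⟨hce.trans hest.2, h⟩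
    rw [show c = s by linarith, show d = t by linarith, hst]
  · push Not at hex
    exact hK.eq_of_gap c hc.1 d hd.1 hcd hex

variable [MetricSpace X]

lemma sInter (hγ : Continuous γ) {c : Set (Set ℝ)} (hne : c.Nonempty)
    (hc : ∀ K ∈ c, IsLoopReduction γ K) (hchain : IsChain (· ⊆ ·) c) :
    IsLoopReduction γ (⋂₀ c) := by
  refine ⟨isClosed_sInter fun K hK => (hc K hK).isClosed, ?_, fun K hK => (hc K hK).zero_mem,
    fun K hK => (hc K hK).one_mem, fun s hs t ht hst hgap => ?_⟩
  · obtain ⟨K, hK⟩ := hne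
    exact (sInter_subset_of_mem hK).trans (hc K hK).subset_Icc
  by_contra hne'
  obtain ⟨A, B, hA, hB, hsA, htB, hAB⟩ := t2_separation hne'
  obtain ⟨δ₁, hδ₁, h₁⟩ := Metric.isOpen_iff.1 (hA.preimage hγ) s hsA
  obtain ⟨δ₂, hδ₂, h₂⟩ := Metric.isOpen_iff.1 (hB.preimage hγ) t htB
  obtain ⟨δ, hδ, hδ'⟩ := exists_between (lt_min (lt_min hδ₁ hδ₂) (half_pos (sub_pos.2 hst)))
  simp only [lt_min_iff] at hδ'
  have : Nonempty c := hne.to_subtype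
  obtain ⟨⟨K, hKc⟩, hK⟩ := (isCompact_Icc (a := s + δ) (b := t - δ)).elim_directed_family_closed
    (fun K : c => (K : Set ℝ)) (fun K => (hc K K.2).isClosed) (by
      rw [← sInter_eq_iInter, eq_empty_iff_forall_notMem]
      exact fun u hu => hgap u hu.2 ⟨by linarith [hu.1.1], by linarith [hu.1.2]⟩)
    (fun K L => by
      rcases hchain.total K.2 L.2 with h | h
      · exact ⟨K, subset_rfl, h⟩
      · exact ⟨L, h, subset_rfl⟩)
  have hKr := hc K hKc
  have hs' := hKr.subset_Icc (hs K hKc)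
  have ht' := hKr.subset_Icc (ht K hKc)
  obtain ⟨p, hp, hpu, hpm⟩ := hKr.exists_prev (u := (s + t) / 2) (by linarith [hs'.1])
  obtain ⟨q, hq, huq, hqm⟩ := hKr.exists_next (u := (s + t) / 2) (by linarith [ht'.2])
  have hsp := hpm s (hs K hKc) (by linarith)
  have hqt := hqm t (ht K hKc) (by linarith)
  have hout : ∀ k ∈ K, ¬ (s + δ ≤ k ∧ k ≤ t - δ) := fun k hk h =>
    (eq_empty_iff_forall_notMem.1 hK) k ⟨h, hk⟩
  have hps : p < s + δ := by
    by_contra! h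
    exact hout p hp ⟨h, by linarith⟩
  have htq : t - δ < q := by
    by_contra! h
    exact hout q hq ⟨by linarith, h⟩
  have hpA : γ p ∈ A := h₁ (by rw [mem_ball, Real.dist_eq, abs_lt]; constructor <;> linarith)
  have hqB : γ q ∈ B := h₂ (by rw [mem_ball, Real.dist_eq, abs_lt]; constructor <;> linarith)
  rw [hKr.eq_prev_next hp hpu hpm hq huq hqm] at hpA
  exact disjoint_left.1 hAB hpA hqB

lemma exists_minimal (hγ : Continuous γ) : ∃ K, Minimal (IsLoopReduction γ) K := by
  have h := zorn_superset_nonempty {K | IsLoopReduction γ K}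
    (fun c hc hchain hne => ⟨⋂₀ c, sInter hγ hne hc hchain, fun K hK => sInter_subset_of_mem hK⟩)
    (Icc 0 1) ⟨isClosed_Icc, subset_rfl, by simp, by simp, fun s hs t ht hst hgap =>
      (hgap ((s + t) / 2) ⟨by linarith [hs.1, ht.1], by linarith [hs.2, ht.2]⟩
        ⟨by linarith, by linarith⟩).elim⟩
  obtain ⟨K, -, hK⟩ := h
  exact ⟨K, hK⟩

end IsLoopReduction

variable [MetricSpace X]

/-- Erasing the loops of a path yields a path whose fibers are intervals. -/
lemma exists_ordConnected_fibers {γ : ℝ → X} (hγ : Continuous γ) :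
    ∃ g : unitInterval → X, Continuous g ∧ g 0 = γ 0 ∧ g 1 = γ 1 ∧
      (∀ u, g u ∈ γ '' Icc 0 1) ∧ ∀ s u t, s ≤ u → u ≤ t → g s = g t → g u = g s := by
  obtain ⟨K, hKmin⟩ := IsLoopReduction.exists_minimal hγ
  have hK := hKmin.prop
  have hgap : ∀ s ∈ K, ∀ t ∈ K, γ s = γ t → ∀ u ∈ K, u ∉ Ioo s t := fun s hs t ht hst u hu hust =>
    (hKmin.le_of_le (hK.diff_Ioo hs ht hst) sdiff_subset hu).2 hust
  choose p hp hpu hpm using fun u : unitInterval => hK.exists_prev u.2.1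
  choose q hq huq hqm using fun u : unitInterval => hK.exists_next u.2.2
  have hpq : ∀ u, γ (p u) = γ (q u) := fun u =>
    hK.eq_prev_next (hp u) (hpu u) (hpm u) (hq u) (huq u) (hqm u)
  have hpK : ∀ u : unitInterval, (u : ℝ) ∈ K → p u = u := fun u hu =>
    (hpu u).antisymm (hpm u u hu le_rfl)
  have hmono : ∀ u v : unitInterval, u ≤ v → p u ≤ p v := fun u v huv =>
    hpm v _ (hp u) ((hpu u).trans huv)
  refine ⟨fun u => γ (p u), ?_, ?_, ?_, fun u => ⟨p u, hK.subset_Icc (hp u), rfl⟩, ?_⟩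
  · rw [continuous_iff_continuousAt]
    intro t
    by_cases ht : (t : ℝ) ∈ K
    · rw [ContinuousAt, Metric.tendsto_nhds]
      intro ε hε
      obtain ⟨δ, hδ, hδε⟩ := Metric.continuousAt_iff.1 (hγ.continuousAt (x := (t : ℝ))) ε hε
      filter_upwards [ball_mem_nhds t hδ] with u hu
      rw [hpK t ht]
      rw [mem_ball, Subtype.dist_eq, Real.dist_eq, abs_lt] at hu
      rcases le_total (t : ℝ) u with h | h
      · have := hpm u t ht h
        have := hpu u
        exact hδε (by rw [Real.dist_eq, abs_lt]; constructor <;> linarith)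
      · have := hqm u t ht h
        have := huq u
        rw [hpq]
        exact hδε (by rw [Real.dist_eq, abs_lt]; constructor <;> linarith)
    · have h₁ : p t < t := (hpu t).lt_of_ne fun h => ht (h ▸ hp t)
      have h₂ : t < q t := (huq t).lt_of_ne fun h => ht (h ▸ hq t)
      have : (fun u => γ (p u)) =ᶠ[𝓝 t] fun _ => γ (p t) := by
        filter_upwards [continuous_subtype_val.continuousAt.preimage_mem_nhds
          (Ioo_mem_nhds h₁ h₂)] with u hu
        have hu' : p t < u ∧ (u : ℝ) < q t := hu
        congr 1
        refine le_antisymm ?_ (hpm u _ (hp t) hu'.1.le)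
        by_contra! h
        exact hgap _ (hp t) _ (hq t) (hpq t) _ (hp u) ⟨h, (hpu u).trans_lt hu'.2⟩
      exact continuousAt_const.congr this.symm
  · simp [hpK 0 (by simpa using hK.zero_mem)]
  · simp [hpK 1 (by simpa using hK.one_mem)]
  · intro s u t hsu hut hst
    have h₁ := hmono s u hsu
    have h₂ := hmono u t hut
    rcases h₁.eq_or_lt with h | h
    · simp only [h]
    rcases h₂.eq_or_lt with h' | h'
    · simp only [hst, h']
    · exact (hgap _ (hp s) _ (hp t) hst _ (hp u) ⟨h, h'⟩).elim

lemma exists_monotone_param [CompactSpace X] {g : unitInterval → X} (hg : Continuous g)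
    (hfib : ∀ s u t, s ≤ u → u ≤ t → g s = g t → g u = g s) (hne : g 0 ≠ g 1) :
    ∃ φ : unitInterval → unitInterval, Continuous φ ∧ φ 0 = 0 ∧ φ 1 = 1 ∧
      ∀ s t, φ s = φ t ↔ g s = g t := by
  have : Nonempty X := ⟨g 0⟩
  let d : ℕ → X := TopologicalSpace.denseSeq X
  let m : ℕ → unitInterval → ℝ := fun n t =>
    sInf ((fun v => dist (d n) (g (min t v))) '' univ)
  have hmc : ∀ n, Continuous (m n) := fun n =>
    isCompact_univ.continuous_sInf (by dsimp [Function.HasUncurry.uncurry]; fun_prop)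
  have hbdd : ∀ n t, BddBelow ((fun v => dist (d n) (g (min t v))) '' univ) := fun n t =>
    ⟨0, by rintro _ ⟨v, -, rfl⟩; exact dist_nonneg⟩
  have hm0 : ∀ n t, 0 ≤ m n t := fun n t =>
    Real.sInf_nonneg (by rintro _ ⟨v, -, rfl⟩; exact dist_nonneg)
  have hle : ∀ n t, m n t ≤ dist (d n) (g t) := fun n t =>
    csInf_le (hbdd n t) ⟨1, trivial, by simp [min_eq_left (unitInterval.le_one' (t := t))]⟩
  have hmD : ∀ n t, m n t ≤ Metric.diam (univ : Set X) := fun n t =>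
    (hle n t).trans (dist_le_diam_of_mem isCompact_univ.isBounded trivial trivial)
  have hanti : ∀ n s t, s ≤ t → m n t ≤ m n s := by
    intro n s t hst
    refine csInf_le_csInf (hbdd n t) ⟨_, mem_image_of_mem _ (mem_univ 0)⟩ ?_
    rintro _ ⟨v, -, rfl⟩
    exact ⟨min s v, trivial, by simp [hst]⟩
  have heq : ∀ n s t, s ≤ t → g s = g t → m n s = m n t := by
    intro n s t hst h
    have : (fun v => dist (d n) (g (min s v))) = fun v => dist (d n) (g (min t v)) := by
      funext v
      rcases le_total v s with hv | hv
      · simp [hv, hv.trans hst]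
      · rw [min_eq_left hv, hfib s (min t v) t (le_min hst hv) (min_le_left _ _) h]
    simp only [m, this]
  have hlt : ∀ s t, s ≤ t → g s ≠ g t → ∃ n, m n t < m n s := by
    intro s t hst h
    obtain ⟨v₀, -, hv₀⟩ := isCompact_univ.exists_isMinOn (univ_nonempty (α := unitInterval))
      (f := fun v => dist (g t) (g (min s v))) (by fun_prop)
    have hr : 0 < dist (g t) (g (min s v₀)) := dist_pos.2 fun h' => h <| by
      rw [hfib (min s v₀) s t (min_le_left _ _) hst h'.symm, h']
    obtain ⟨n, hn⟩ := (TopologicalSpace.denseRange_denseSeq X).exists_dist_lt (g t) (half_pos hr)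
    refine ⟨n, (hle n t).trans_lt ?_⟩
    have h₁ : dist (g t) (g (min s v₀)) / 2 ≤ m n s := by
      refine le_csInf ⟨_, mem_image_of_mem _ (mem_univ 0)⟩ ?_
      rintro _ ⟨v, -, rfl⟩
      have h₂ : dist (g t) (g (min s v₀)) ≤ dist (g t) (g (min s v)) := hv₀ (mem_univ v)
      have h₃ := dist_triangle (g t) (d n) (g (min s v))
      change dist (g t) (d n) < _ at hn
      change _ ≤ dist (d n) (g (min s v))
      linarith
    rw [dist_comm]
    exact hn.trans_le h₁
  have hsum : ∀ t, Summable fun n => (1 / 2 : ℝ) ^ n * m n t := fun t =>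
    Summable.of_nonneg_of_le (fun n => mul_nonneg (by positivity) (hm0 n t))
      (fun n => mul_le_mul_of_nonneg_left (hmD n t) (by positivity))
      (summable_geometric_two.mul_right _)
  let H : unitInterval → ℝ := fun t => ∑' n, (1 / 2 : ℝ) ^ n * m n t
  have hH : Continuous H := by
    refine continuous_tsum (fun n => continuous_const.mul (hmc n))
      (summable_geometric_two.mul_right (Metric.diam (univ : Set X))) fun n t => ?_
    rw [Real.norm_of_nonneg (mul_nonneg (by positivity) (hm0 n t))]
    exact mul_le_mul_of_nonneg_left (hmD n t) (by positivity)
  have hHanti : ∀ s t, s ≤ t → H t ≤ H s := fun s t hst =>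
    (hsum t).tsum_le_tsum (fun n => mul_le_mul_of_nonneg_left (hanti n s t hst) (by positivity))
      (hsum s)
  have hHlt : ∀ s t, s ≤ t → g s ≠ g t → H t < H s := by
    intro s t hst h
    obtain ⟨n, hn⟩ := hlt s t hst h
    exact (hsum t).tsum_lt_tsum
      (fun n => mul_le_mul_of_nonneg_left (hanti n s t hst) (by positivity))
      (mul_lt_mul_of_pos_left hn (by positivity)) (hsum s)
  have hHle : ∀ s t, s ≤ t → (H s = H t ↔ g s = g t) := fun s t hst =>
    ⟨fun h => by_contra fun h' => (hHlt s t hst h').ne' h, fun h => by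
      simp only [H, heq _ s t hst h]⟩
  have hHiff : ∀ s t, H s = H t ↔ g s = g t := fun s t => by
    rcases le_total s t with h | h
    · exact hHle s t h
    · rw [eq_comm, hHle t s h, eq_comm]
  have hpos : 0 < H 0 - H 1 := sub_pos.2 (hHlt 0 1 zero_le_one hne)
  have hmem : ∀ t, (H 0 - H t) / (H 0 - H 1) ∈ Icc (0 : ℝ) 1 := fun t =>
    ⟨div_nonneg (sub_nonneg.2 (hHanti 0 t unitInterval.nonneg')) hpos.le,
      (div_le_one hpos).2 (sub_le_sub_left (hHanti t 1 unitInterval.le_one') _)⟩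
  refine ⟨fun t => ⟨_, hmem t⟩, by fun_prop, ?_, ?_, fun s t => ?_⟩
  · ext; simp
  · ext; simp [hpos.ne']
  · rw [← hHiff, Subtype.mk.injEq, div_left_inj' hpos.ne', sub_right_inj]

/-- Two distinct points joined by a path are joined by an arc inside that path. -/
lemma exists_injOn_of_continuous [CompactSpace X] {γ : ℝ → X} (hγ : Continuous γ)
    (hne : γ 0 ≠ γ 1) :
    ∃ η : ℝ → X, Continuous η ∧ InjOn η (Icc 0 1) ∧ η 0 = γ 0 ∧ η 1 = γ 1 ∧
      η '' Icc 0 1 ⊆ γ '' Icc 0 1 := by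
  obtain ⟨g, hg, hg0, hg1, hgr, hfib⟩ := exists_ordConnected_fibers hγ
  obtain ⟨φ, hφ, hφ0, hφ1, hφg⟩ := exists_monotone_param hg hfib (by rwa [hg0, hg1])
  have hsurj : Function.Surjective φ := fun y =>
    intermediate_value_univ 0 1 hφ (by rw [hφ0, hφ1]; exact ⟨y.2.1, y.2.2⟩)
  have hq : IsQuotientMap φ := .of_surjective_continuous hsurj hφ
  obtain ⟨ψ, hψ⟩ := hsurj.hasRightInverse
  have hfac : ∀ t, g (ψ (φ t)) = g t := fun t => (hφg _ _).1 (hψ _)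
  have hcont : Continuous (g ∘ ψ) := hq.continuous_iff.2 (by
    convert hg using 1
    exact funext hfac)
  have hinj : Function.Injective (g ∘ ψ) := fun x y hxy => by
    have := (hφg _ _).2 hxy
    rwa [hψ, hψ] at this
  refine ⟨IccExtend zero_le_one (g ∘ ψ), hcont.Icc_extend', ?_, ?_, ?_, ?_⟩
  · intro x hx y hy hxy
    rw [IccExtend_of_mem _ _ hx, IccExtend_of_mem _ _ hy] at hxy
    exact congrArg Subtype.val (hinj hxy)
  · rw [IccExtend_of_mem _ _ (by simp), ← hg0, ← hfac 0, hφ0]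
    rfl
  · rw [IccExtend_of_mem _ _ (by simp), ← hg1, ← hfac 1, hφ1]
    rfl
  · rintro _ ⟨x, hx, rfl⟩
    rw [IccExtend_of_mem _ _ hx]
    exact hgr _

end PathToArc

section SimpleTriod

/-- Maps from a compact space with the same fibers have homeomorphic ranges. -/
lemma nonempty_homeomorph_range {Q Y Z : Type*} [TopologicalSpace Q] [CompactSpace Q]
    [TopologicalSpace Y] [T2Space Y] [TopologicalSpace Z] [T2Space Z] {f : Q → Y} {g : Q → Z}
    (hf : Continuous f) (hg : Continuous g) (h : ∀ x y, f x = f y ↔ g x = g y) :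
    Nonempty (range f ≃ₜ range g) := by
  have hf' : IsQuotientMap (⟨rangeFactorization f, hf.rangeFactorization⟩ : C(Q, range f)) :=
    .of_surjective_continuous rangeFactorization_surjective hf.rangeFactorization
  have hg' : IsQuotientMap (⟨rangeFactorization g, hg.rangeFactorization⟩ : C(Q, range g)) :=
    .of_surjective_continuous rangeFactorization_surjective hg.rangeFactorization
  have hker : Setoid.ker (⟨rangeFactorization f, hf.rangeFactorization⟩ : C(Q, range f)) =
      Setoid.ker (⟨rangeFactorization g, hg.rangeFactorization⟩ : C(Q, range g)) := by
    ext x y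
    simpa [Setoid.ker_def, rangeFactorization, Subtype.ext_iff] using h x y
  obtain ⟨e⟩ := Nonempty.intro hf'.homeomorph
  rw [hker] at e
  exact ⟨e.symm.trans hg'.homeomorph⟩

/-- The angles of the legs of the model triod. -/
noncomputable def triodAngle : Fin 3 → ℝ := ![Real.pi / 3, Real.pi, 5 * Real.pi / 3]

lemma exp_triodAngle_injective :
    Function.Injective fun i => Complex.exp (triodAngle i * Complex.I) := by
  have h5 : Real.sin (5 * Real.pi / 3) = -(√3 / 2) := by
    rw [show 5 * Real.pi / 3 = 2 * Real.pi - Real.pi / 3 by ring, Real.sin_two_pi_sub,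
      Real.sin_pi_div_three]
  have hinj : Function.Injective fun i => Real.sin (triodAngle i) := by
    have h3 : (0 : ℝ) < √3 := by positivity
    intro i j h
    fin_cases i <;> fin_cases j <;> simp [triodAngle, h5] at h ⊢ <;> linarith
  intro i j h
  apply hinj
  simpa [Complex.exp_ofReal_mul_I_im] using congrArg Complex.im h

lemma triodModel_eq_range :
    triodModel = range fun p : Fin 3 × unitInterval =>
      ((p.2 : ℝ) : ℂ) * Complex.exp (triodAngle p.1 * Complex.I) := by
  ext z
  simp [triodModel, triodAngle, Prod.exists, Fin.exists_fin_succ]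

/-- Three arcs issuing from a common point and otherwise disjoint form a simple triod. -/
lemma isSimpleTriod_iUnion {X : Type*} [TopologicalSpace X] [T2Space X] {γ : Fin 3 → ℝ → X} {z : X}
    (hc : ∀ i, Continuous (γ i)) (hz : ∀ i, γ i 0 = z) (hinj : ∀ i, InjOn (γ i) (Icc 0 1))
    (hdisj : ∀ i j, i ≠ j → ∀ r ∈ Icc (0 : ℝ) 1, ∀ s ∈ Icc (0 : ℝ) 1, γ i r = γ j s →
      r = 0 ∧ s = 0) :
    IsSimpleTriod (⋃ i, γ i '' Icc 0 1) := by
  have hrange : ⋃ i, γ i '' Icc 0 1 = range fun p : Fin 3 × unitInterval => γ p.1 p.2 := by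
    ext x
    simp
  rw [IsSimpleTriod, hrange, triodModel_eq_range]
  refine nonempty_homeomorph_range ?_ ?_ ?_
  · exact continuous_prod_of_discrete_left.2 fun i => (hc i).comp continuous_subtype_val
  · exact continuous_prod_of_discrete_left.2 fun i => by fun_prop
  · rintro ⟨i, r, hr⟩ ⟨j, s, hs⟩
    dsimp only
    constructor
    · intro h
      rcases eq_or_ne i j with rfl | hij
      · rw [hinj i hr hs h]
      · obtain ⟨rfl, rfl⟩ := hdisj i j hij r hr s hs h
        simp
    · intro h
      have hrs : r = s := by
        have := congrArg norm h
        simpa [Complex.norm_exp_ofReal_mul_I, abs_of_nonneg hr.1, abs_of_nonneg hs.1] using this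
      subst hrs
      rcases eq_or_ne r 0 with rfl | h0
      · rw [hz, hz]
      · rw [exp_triodAngle_injective (mul_left_cancel₀ (by exact_mod_cast h0) h)]

end SimpleTriod

section Arcs

variable {X : Type*} [MetricSpace X]

/-- An arc meeting another one for the first time at an interior point forms a triod with it. -/
lemma ContainsNoTriod.eq_zero_or_one {U : Set X} (hU : ContainsNoTriod U) {L M : ℝ → X}
    (hL : Continuous L) (hLi : InjOn L (Icc 0 1)) (hLU : ∀ t ∈ Icc (0 : ℝ) 1, L t ∈ U)
    (hM : Continuous M) (hMi : InjOn M (Icc 0 1)) (hMU : ∀ t ∈ Icc (0 : ℝ) 1, M t ∈ U)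
    {σ τ : ℝ} (hσ : σ ∈ Ioc (0 : ℝ) 1) (hτ : τ ∈ Icc (0 : ℝ) 1) (h : M σ = L τ)
    (hfirst : ∀ s ∈ Ico 0 σ, M s ∉ L '' Icc 0 1) : τ = 0 ∨ τ = 1 := by
  by_contra! hτ'
  have hτ0 : 0 < τ := lt_of_le_of_ne hτ.1 hτ'.1.symm
  have hτ1 : τ < 1 := lt_of_le_of_ne hτ.2 hτ'.2
  let a : ℝ → X := fun r => L (τ * (1 - r))
  let b : ℝ → X := fun r => L (τ + (1 - τ) * r)
  let c : ℝ → X := fun r => M (σ * (1 - r))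
  have ha : ∀ r ∈ Icc (0 : ℝ) 1, τ * (1 - r) ∈ Icc (0 : ℝ) 1 := fun r hr =>
    ⟨by nlinarith [hr.1, hr.2], by nlinarith [hr.1, hr.2]⟩
  have hb : ∀ r ∈ Icc (0 : ℝ) 1, τ + (1 - τ) * r ∈ Icc (0 : ℝ) 1 := fun r hr =>
    ⟨by nlinarith [hr.1, hr.2], by nlinarith [hr.1, hr.2]⟩
  have hc : ∀ r ∈ Icc (0 : ℝ) 1, σ * (1 - r) ∈ Icc (0 : ℝ) 1 := fun r hr =>
    ⟨by nlinarith [hr.1, hr.2, hσ.1, hσ.2], by nlinarith [hr.1, hr.2, hσ.1, hσ.2]⟩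
  have hab : ∀ r ∈ Icc (0 : ℝ) 1, ∀ s ∈ Icc (0 : ℝ) 1, a r = b s → r = 0 ∧ s = 0 := by
    intro r hr s hs h
    have := hLi (ha r hr) (hb s hs) h
    have h₁ := mul_nonneg hτ0.le hr.1
    have h₂ := mul_nonneg (sub_pos.2 hτ1).le hs.1
    exact ⟨(mul_eq_zero.1 (show τ * r = 0 by linarith)).resolve_left hτ0.ne',
      (mul_eq_zero.1 (show (1 - τ) * s = 0 by linarith)).resolve_left (sub_pos.2 hτ1).ne'⟩
  have hLc : ∀ u ∈ Icc (0 : ℝ) 1, ∀ s ∈ Icc (0 : ℝ) 1, L u = c s → u = τ ∧ s = 0 := by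
    intro u hu s hs hus
    have hs0 : s = 0 := by
      by_contra hs0
      have hs0 : 0 < s := lt_of_le_of_ne hs.1 (Ne.symm hs0)
      exact hfirst _ ⟨(hc s hs).1, by nlinarith [hσ.1]⟩ ⟨u, hu, hus⟩
    subst hs0
    refine ⟨hLi hu hτ ?_, rfl⟩
    rw [hus, ← h]
    simp [c]
  have hac : ∀ r ∈ Icc (0 : ℝ) 1, ∀ s ∈ Icc (0 : ℝ) 1, a r = c s → r = 0 ∧ s = 0 := by
    intro r hr s hs h
    obtain ⟨h₁, h₂⟩ := hLc _ (ha r hr) s hs h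
    exact ⟨(mul_eq_zero.1 (show τ * r = 0 by linarith)).resolve_left hτ0.ne', h₂⟩
  have hbc : ∀ r ∈ Icc (0 : ℝ) 1, ∀ s ∈ Icc (0 : ℝ) 1, b r = c s → r = 0 ∧ s = 0 := by
    intro r hr s hs h
    obtain ⟨h₁, h₂⟩ := hLc _ (hb r hr) s hs h
    exact ⟨(mul_eq_zero.1 (show (1 - τ) * r = 0 by linarith)).resolve_left (sub_pos.2 hτ1).ne', h₂⟩
  refine hU (⋃ i, ![a, b, c] i '' Icc 0 1) ?_ (isSimpleTriod_iUnion (z := L τ) ?_ ?_ ?_ ?_)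
  · refine iUnion_subset fun i => ?_
    rintro _ ⟨r, hr, rfl⟩
    fin_cases i
    · exact hLU _ (ha r hr)
    · exact hLU _ (hb r hr)
    · exact hMU _ (hc r hr)
  · intro i
    fin_cases i
    · change Continuous fun r => L (τ * (1 - r))
      fun_prop
    · change Continuous fun r => L (τ + (1 - τ) * r)
      fun_prop
    · change Continuous fun r => M (σ * (1 - r))
      fun_prop
  · intro i
    fin_cases i <;> simp [a, b, c, h]
  · intro i r hr s hs hrs
    fin_cases i
    · have := mul_left_cancel₀ hτ0.ne' (hLi (ha r hr) (ha s hs) hrs)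
      linarith
    · have := hLi (hb r hr) (hb s hs) hrs
      exact mul_left_cancel₀ (sub_pos.2 hτ1).ne' (add_left_cancel this)
    · have := mul_left_cancel₀ hσ.1.ne' (hMi (hc r hr) (hc s hs) hrs)
      linarith
  · intro i j hij r hr s hs hrs
    fin_cases i <;> fin_cases j
    · exact (hij rfl).elim
    · exact hab r hr s hs hrs
    · exact hac r hr s hs hrs
    · exact (hab s hs r hr hrs.symm).symm
    · exact (hij rfl).elim
    · exact hbc r hr s hs hrs
    · exact (hac s hs r hr hrs.symm).symm
    · exact (hbc s hs r hr hrs.symm).symm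
    · exact (hij rfl).elim

/-- A relatively open piece of an arc is open if the arc contains a neighbourhood of it. -/
lemma isOpen_image_of_subset_arc {L : ℝ → X} (hL : Continuous L) (hLi : InjOn L (Icc 0 1))
    {N : Set X} (hN : IsOpen N) (hNL : N ⊆ L '' Icc 0 1) {S : Set ℝ} (hS : S ⊆ Icc 0 1)
    (hSc : IsClosed (Icc 0 1 \ S)) (hSN : L '' S ⊆ N) : IsOpen (L '' S) := by
  have : L '' S = N \ L '' (Icc 0 1 \ S) := by
    ext x
    constructor
    · rintro ⟨s, hs, rfl⟩
      refine ⟨hSN ⟨s, hs, rfl⟩, ?_⟩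
      rintro ⟨t, ht, hts⟩
      exact ht.2 (hLi ht.1 (hS hs) hts ▸ hs)
    · rintro ⟨hxN, hx⟩
      obtain ⟨t, ht, rfl⟩ := hNL hxN
      by_contra h
      exact hx ⟨t, ⟨ht, fun hts => h ⟨t, hts, rfl⟩⟩, rfl⟩
  rw [this]
  exact hN.sdiff ((isCompact_Icc.of_isClosed_subset hSc sdiff_subset).image hL).isClosed

lemma nonempty_homeomorph_image_arc {L : ℝ → X} (hL : Continuous L) (hLi : InjOn L (Icc 0 1))
    {S : Set ℝ} (hS : S ⊆ Icc 0 1) : Nonempty (L '' S ≃ₜ S) := by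
  have h₁ : IsClosedEmbedding fun t : Icc (0 : ℝ) 1 => L t :=
    Continuous.isClosedEmbedding (by fun_prop) fun s t h => Subtype.ext (hLi s.2 t.2 h)
  have h₂ := h₁.isEmbedding.comp (IsEmbedding.inclusion hS)
  have h₃ : range ((fun t : Icc (0 : ℝ) 1 => L t) ∘ inclusion hS) = L '' S := by
    ext x
    simp
  exact ⟨(Homeomorph.setCongr h₃.symm).trans h₂.toHomeomorph.symm⟩

lemma nonempty_homeomorph_Ioo {α β : ℝ} (h : α < β) : Nonempty (Ioo α β ≃ₜ Ioo (0 : ℝ) 1) := by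
  have := affineHomeomorph_image_Ioo (β - α) α 0 1 (sub_pos.2 h)
  refine ⟨(Homeomorph.setCongr ?_).trans
    ((affineHomeomorph (β - α) α (sub_pos.2 h).ne').image (Ioo 0 1)).symm⟩
  rw [this]
  congr 1 <;> ring

lemma nonempty_homeomorph_Ico {α β : ℝ} (h : α < β) : Nonempty (Ico α β ≃ₜ Ico (0 : ℝ) 1) := by
  have := affineHomeomorph_image_Ico (β - α) α 0 1 (sub_pos.2 h)
  refine ⟨(Homeomorph.setCongr ?_).trans
    ((affineHomeomorph (β - α) α (sub_pos.2 h).ne').image (Ico 0 1)).symm⟩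
  rw [this]
  congr 1 <;> ring

lemma IsPreconnected.inter_frontier_nonempty {Y : Type*} [TopologicalSpace Y] {S V : Set Y}
    (hS : IsPreconnected S) (hV : IsOpen V) (h₁ : (S ∩ V).Nonempty) (h₂ : ¬ S ⊆ V) :
    (S ∩ frontier V).Nonempty := by
  by_contra h
  rw [not_nonempty_iff_eq_empty, eq_empty_iff_forall_notMem] at h
  refine h₂ (hS.subset_left_of_subset_union hV isClosed_closure.isOpen_compl
    (disjoint_left.2 fun x hx hx' => hx' (subset_closure hx)) (fun x hx => ?_) h₁)
  by_cases hxc : x ∈ closure V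
  · refine .inl (by_contra fun hxV => h x ⟨hx, ?_⟩)
    rw [hV.frontier_eq]
    exact ⟨hxc, hxV⟩
  · exact .inr hxc

lemma not_isEndpointOf_of_isOpen_image_Ioo {L : ℝ → X} (hL : Continuous L)
    (hLi : InjOn L (Icc 0 1)) {α τ β : ℝ} (hα : 0 ≤ α) (hατ : α < τ) (hτβ : τ < β) (hβ : β ≤ 1)
    (hV : IsOpen (L '' Ioo α β)) : ¬ IsEndpointOf X (L τ) := by
  intro h
  obtain ⟨V, hVo, hτV, hVL, y, hy⟩ := h _ hV ⟨τ, ⟨hατ, hτβ⟩, rfl⟩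
  have hαV : L α ∉ V := fun h => by
    obtain ⟨s, hs, hsα⟩ := hVL h
    have := hLi ⟨by linarith [hs.1], by linarith [hs.2]⟩ ⟨hα, by linarith⟩ hsα
    exact hs.1.ne' this
  have hβV : L β ∉ V := fun h => by
    obtain ⟨s, hs, hsβ⟩ := hVL h
    have := hLi ⟨by linarith [hs.1], by linarith [hs.2]⟩ ⟨by linarith, hβ⟩ hsβ
    exact hs.2.ne this
  obtain ⟨_, ⟨s, hs, rfl⟩, hsy⟩ := (isPreconnected_Icc.image L hL.continuousOn
    : IsPreconnected (L '' Icc α τ)).inter_frontier_nonempty hVo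
    ⟨L τ, ⟨τ, right_mem_Icc.2 hατ.le, rfl⟩, hτV⟩
    fun h => hαV (h ⟨α, left_mem_Icc.2 hατ.le, rfl⟩)
  obtain ⟨_, ⟨t, ht, rfl⟩, hty⟩ := (isPreconnected_Icc.image L hL.continuousOn
    : IsPreconnected (L '' Icc τ β)).inter_frontier_nonempty hVo
    ⟨L τ, ⟨τ, left_mem_Icc.2 hτβ.le, rfl⟩, hτV⟩
    fun h => hβV (h ⟨β, right_mem_Icc.2 hτβ.le, rfl⟩)
  have hτy : L τ ∈ frontier V := by
    have hsV := hsy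
    rw [hy, mem_singleton_iff] at hsy hty
    have hst := hLi ⟨by linarith [hs.1], by linarith [hs.2]⟩ ⟨by linarith [ht.1], by linarith [ht.2]⟩
      (hsy.trans hty.symm)
    rwa [show τ = s by linarith [hs.2, ht.1]]
  rw [hVo.frontier_eq] at hτy
  exact hτy.2 hτV

lemma isEndpointOf_of_isOpen_image_Ico {L : ℝ → X} (hL : Continuous L)
    (hLi : InjOn L (Icc 0 1)) {β : ℝ} (hβ : 0 < β) (hβ1 : β ≤ 1)
    (hV : ∀ η ∈ Ioo 0 β, IsOpen (L '' Ico 0 η)) : IsEndpointOf X (L 0) := by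
  intro U hU h0
  obtain ⟨δ, hδ, hδU⟩ := Metric.isOpen_iff.1 (hU.preimage hL) 0 h0
  obtain ⟨η, hη0, hη⟩ := exists_between (lt_min hδ hβ)
  obtain ⟨hηδ, hηβ⟩ := lt_min_iff.1 hη
  refine ⟨L '' Ico 0 η, hV η ⟨hη0, hηβ⟩, ⟨0, by simpa, rfl⟩, ?_, L η, ?_⟩
  · rintro _ ⟨s, hs, rfl⟩
    refine hδU ?_
    rw [mem_ball, Real.dist_eq, abs_lt]
    constructor <;> linarith [hs.1, hs.2]
  · have hcl : closure (L '' Ico 0 η) = L '' Icc 0 η := by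
      refine (closure_minimal (image_mono Ico_subset_Icc_self)
        (isCompact_Icc.image hL).isClosed).antisymm ?_
      rw [← closure_Ico hη0.ne]
      exact image_closure_subset_closure_image hL
    rw [(hV η ⟨hη0, hηβ⟩).frontier_eq, hcl]
    ext x
    constructor
    · rintro ⟨⟨s, hs, rfl⟩, hx⟩
      rcases hs.2.eq_or_lt with rfl | h
      · rfl
      · exact (hx ⟨s, ⟨hs.1, h⟩, rfl⟩).elim
    · rintro rfl
      refine ⟨⟨η, ⟨hη0.le, le_rfl⟩, rfl⟩, ?_⟩
      rintro ⟨s, hs, hsη⟩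
      exact hs.2.ne (hLi ⟨hs.1, by linarith [hs.2]⟩ ⟨hη0.le, by linarith⟩ hsη)

lemma exists_isOpen_isConnected_subset [LocallyConnectedSpace X] {U : Set X} {a : X}
    (hU : U ∈ 𝓝 a) :
    ∃ N ⊆ U, IsOpen N ∧ a ∈ N ∧ IsConnected N :=
  locallyConnectedSpace_iff_subsets_isOpen_isConnected.1 ‹_› a U hU

variable [CompactSpace X] [LocallyConnectedSpace X]

lemma IsOpen.exists_arc {N : Set X} (hN : IsOpen N) (hNc : IsConnected N) {x y : X}
    (hx : x ∈ N) (hy : y ∈ N) (hxy : x ≠ y) :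
    ∃ M : ℝ → X, Continuous M ∧ InjOn M (Icc 0 1) ∧ M 0 = x ∧ M 1 = y ∧
      ∀ s ∈ Icc (0 : ℝ) 1, M s ∈ N := by
  have := locallyPathConnectedSpace_of_locallyConnectedSpace (X := X)
  obtain ⟨p, hp⟩ := (hN.isConnected_iff_isPathConnected.1 hNc).joinedIn x hx y hy
  obtain ⟨M, hM, hMi, hM0, hM1, hMr⟩ := exists_injOn_of_continuous p.continuous_extend
    (by simpa using hxy)
  refine ⟨M, hM, hMi, by simpa using hM0, by simpa using hM1, fun s hs => ?_⟩
  obtain ⟨t, ht, hts⟩ := hMr ⟨s, hs, rfl⟩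
  rw [← hts, p.extend_apply ht]
  exact hp _

/-- Any arc reaching an arc `L` inside a triod-free set meets it first at an end of `L`. -/
lemma ContainsNoTriod.exists_arc_to_end {U : Set X} (hU : ContainsNoTriod U) {L : ℝ → X}
    (hL : Continuous L) (hLi : InjOn L (Icc 0 1)) (hLU : ∀ t ∈ Icc (0 : ℝ) 1, L t ∈ U)
    {N : Set X} (hN : IsOpen N) (hNc : IsConnected N) (hNU : N ⊆ U) {x a : X} (hx : x ∈ N)
    (hxL : x ∉ L '' Icc 0 1) (ha : a ∈ N) (haL : a ∈ L '' Icc 0 1) :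
    ∃ M : ℝ → X, Continuous M ∧ InjOn M (Icc 0 1) ∧ M 1 = a ∧ (∀ s ∈ Icc (0 : ℝ) 1, M s ∈ N) ∧
      ∃ σ ∈ Ioc (0 : ℝ) 1, (∀ s ∈ Ico 0 σ, M s ∉ L '' Icc 0 1) ∧ (M σ = L 0 ∨ M σ = L 1) := by
  obtain ⟨M, hM, hMi, hM0, hM1, hMN⟩ := hN.exists_arc hNc hx ha fun h => hxL (h ▸ haL)
  have hc : IsCompact (Icc 0 1 ∩ M ⁻¹' (L '' Icc 0 1)) :=
    isCompact_Icc.inter_right ((isCompact_Icc.image hL).isClosed.preimage hM)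
  obtain ⟨σ, ⟨hσ, hσL⟩, hmin⟩ := hc.exists_isLeast ⟨1, by simp, by rwa [mem_preimage, hM1]⟩
  have hσ0 : 0 < σ := lt_of_le_of_ne hσ.1 <| by
    rintro rfl
    rw [mem_preimage, hM0] at hσL
    exact hxL hσL
  have hfirst : ∀ s ∈ Ico 0 σ, M s ∉ L '' Icc 0 1 := fun s hs hsL =>
    (hmin ⟨⟨hs.1, hs.2.le.trans hσ.2⟩, hsL⟩).not_gt hs.2
  refine ⟨M, hM, hMi, hM1, hMN, σ, ⟨hσ0, hσ.2⟩, hfirst, ?_⟩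
  obtain ⟨τ, hτ, hτσ⟩ := hσL
  rcases hU.eq_zero_or_one hL hLi hLU hM hMi (fun t ht => hNU (hMN t ht)) ⟨hσ0, hσ.2⟩ hτ hτσ.symm
    hfirst with rfl | rfl
  · exact .inl hτσ.symm
  · exact .inr hτσ.symm

/-- An interior point of an arc in a triod-free set has an open interval as neighbourhood. -/
lemma ContainsNoTriod.exists_Ioo_nhd {U : Set X} (hT : ContainsNoTriod U) {L : ℝ → X}
    (hL : Continuous L) (hLi : InjOn L (Icc 0 1)) (hLU : ∀ t ∈ Icc (0 : ℝ) 1, L t ∈ U)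
    {τ : ℝ} (hτ : τ ∈ Ioo (0 : ℝ) 1) (hU : U ∈ 𝓝 (L τ)) :
    ¬ IsEndpointOf X (L τ) ∧ ∃ V : Set X, IsOpen V ∧ IsConnected V ∧ L τ ∈ V ∧
      Nonempty (V ≃ₜ Ioo (0 : ℝ) 1) := by
  have hτ' := Ioo_subset_Icc_self hτ
  have h0 : L τ ≠ L 0 := fun h => hτ.1.ne' (hLi hτ' (by simp) h)
  have h1 : L τ ≠ L 1 := fun h => hτ.2.ne (hLi hτ' (by simp) h)
  obtain ⟨N, hNU, hN, haN, hNc⟩ := exists_isOpen_isConnected_subset (a := L τ)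
    (U := U ∩ ({L 0}ᶜ ∩ {L 1}ᶜ)) (Filter.inter_mem hU (Filter.inter_mem
      (isOpen_compl_singleton.mem_nhds h0) (isOpen_compl_singleton.mem_nhds h1)))
  have hNL : N ⊆ L '' Icc 0 1 := by
    intro x hx
    by_contra hxL
    obtain ⟨M, -, -, -, hMN, σ, hσ, -, hend⟩ := hT.exists_arc_to_end hL hLi hLU hN hNc
      (fun y hy => (hNU hy).1) hx hxL haN ⟨τ, hτ', rfl⟩
    have := hNU (hMN σ (Ioc_subset_Icc_self hσ))
    rcases hend with h | h
    · exact this.2.1 h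
    · exact this.2.2 h
  obtain ⟨δ, hδ, hδN⟩ := Metric.isOpen_iff.1
    ((hN.preimage hL).inter isOpen_Ioo) τ ⟨haN, hτ⟩
  rw [Real.ball_eq_Ioo] at hδN
  have hI : Ioo (τ - δ) (τ + δ) ⊆ Ioo 0 1 := fun s hs => (hδN hs).2
  have hle := (Ioo_subset_Ioo_iff (by linarith)).1 hI
  have hV : IsOpen (L '' Ioo (τ - δ) (τ + δ)) :=
    isOpen_image_of_subset_arc hL hLi hN hNL (hI.trans Ioo_subset_Icc_self)
      (isClosed_Icc.sdiff isOpen_Ioo) (by rintro _ ⟨s, hs, rfl⟩; exact (hδN hs).1)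
  refine ⟨not_isEndpointOf_of_isOpen_image_Ioo hL hLi hle.1 (by linarith) (by linarith) hle.2 hV,
    _, hV, (isConnected_Ioo (by linarith)).image L hL.continuousOn,
    ⟨τ, ⟨by linarith, by linarith⟩, rfl⟩, ?_⟩
  obtain ⟨e⟩ := nonempty_homeomorph_image_arc hL hLi (hI.trans Ioo_subset_Icc_self)
  obtain ⟨e'⟩ := nonempty_homeomorph_Ioo (show τ - δ < τ + δ by linarith)
  exact ⟨e.trans e'⟩

/-- A point of a triod-free set that is interior to no arc, but starts one, has a half-open
interval as neighbourhood. -/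
lemma ContainsNoTriod.exists_Ico_nhd {U : Set X} (hT : ContainsNoTriod U) {L : ℝ → X}
    (hL : Continuous L) (hLi : InjOn L (Icc 0 1)) (hLU : ∀ t ∈ Icc (0 : ℝ) 1, L t ∈ U)
    (hU : U ∈ 𝓝 (L 0))
    (hint : ∀ P : ℝ → X, Continuous P → InjOn P (Icc 0 1) → (∀ t ∈ Icc (0 : ℝ) 1, P t ∈ U) →
      ∀ t ∈ Ioo (0 : ℝ) 1, P t ≠ L 0) :
    IsEndpointOf X (L 0) ∧ ∃ V : Set X, IsOpen V ∧ IsConnected V ∧ L 0 ∈ V ∧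
      Nonempty (V ≃ₜ Ico (0 : ℝ) 1) := by
  have h1 : L 0 ≠ L 1 := fun h => zero_ne_one (hLi (by simp) (by simp) h)
  obtain ⟨N, hNU, hN, haN, hNc⟩ := exists_isOpen_isConnected_subset (a := L 0)
    (U := U ∩ {L 1}ᶜ) (Filter.inter_mem hU (isOpen_compl_singleton.mem_nhds h1))
  have hNL : N ⊆ L '' Icc 0 1 := by
    intro x hx
    by_contra hxL
    obtain ⟨M, hM, hMi, hM1, hMN, σ, hσ, hfirst, hend⟩ := hT.exists_arc_to_end hL hLi hLU hN hNc
      (fun y hy => (hNU hy).1) hx hxL haN ⟨0, by simp, rfl⟩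
    have hσ0 : M σ = L 0 := hend.resolve_right (hNU (hMN σ (Ioc_subset_Icc_self hσ))).2
    obtain rfl : σ = 1 := hMi (Ioc_subset_Icc_self hσ) (by simp) (hσ0.trans hM1.symm)
    have hglue : ∀ s, s = 1 / 2 → M (2 * s) = L (2 * s - 1) := by
      rintro s rfl
      norm_num [hM1]
    refine hint (fun s => if s ≤ 1 / 2 then M (2 * s) else L (2 * s - 1))
      (Continuous.if_le (by fun_prop) (by fun_prop) continuous_id continuous_const hglue)
      ?_ ?_ (1 / 2) (by norm_num) (by norm_num [hM1])
    · have hlt : ∀ s t : ℝ, 0 ≤ s → s ≤ 1 / 2 → 1 / 2 < t → t ≤ 1 →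
          M (2 * s) ≠ L (2 * t - 1) := by
        intro s t hs0 hs ht ht1 h
        rcases hs.eq_or_lt with rfl | hs
        · rw [hglue _ rfl] at h
          have := hLi ⟨by norm_num, by norm_num⟩ ⟨by linarith, by linarith⟩ h
          linarith
        · exact hfirst (2 * s) ⟨by linarith, by linarith⟩ ⟨_, ⟨by linarith, by linarith⟩, h.symm⟩
      intro s hs t ht hst
      dsimp only at hst
      split_ifs at hst with h₁ h₂ h₂
      · have := hMi ⟨by linarith [hs.1], by linarith⟩ ⟨by linarith [ht.1], by linarith⟩ hst
        linarith
      · exact (hlt s t hs.1 h₁ (not_le.1 h₂) ht.2 hst).elim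
      · exact (hlt t s ht.1 h₂ (not_le.1 h₁) hs.2 hst.symm).elim
      · have := hLi ⟨by linarith, by linarith [hs.2]⟩ ⟨by linarith, by linarith [ht.2]⟩ hst
        linarith
    · intro t ht
      split_ifs with h
      · exact (hNU (hMN _ ⟨by linarith [ht.1], by linarith⟩)).1
      · exact hLU _ ⟨by linarith, by linarith [ht.2]⟩
  obtain ⟨δ, hδ, hδN⟩ := Metric.isOpen_iff.1 (hN.preimage hL) 0 haN
  obtain ⟨β, hβ0, hβ⟩ := exists_between (lt_min hδ one_pos)
  obtain ⟨hβδ, hβ1⟩ := lt_min_iff.1 hβ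
  have hsub : ∀ η ≤ β, Ico 0 η ⊆ Icc (0 : ℝ) 1 := fun η hη s hs =>
    ⟨hs.1, by linarith [hs.2]⟩
  have hV : ∀ η ≤ β, IsOpen (L '' Ico 0 η) := by
    intro η hη
    refine isOpen_image_of_subset_arc hL hLi hN hNL (hsub η hη) ?_ ?_
    · have : Icc (0 : ℝ) 1 \ Ico 0 η = Icc 0 1 ∩ Ici η := by
        ext s
        simp +contextual
      rw [this]
      exact isClosed_Icc.inter isClosed_Ici
    · rintro _ ⟨s, hs, rfl⟩
      refine hδN ?_
      rw [mem_ball, Real.dist_eq, abs_lt]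
      constructor <;> linarith [hs.1, hs.2]
  refine ⟨isEndpointOf_of_isOpen_image_Ico hL hLi hβ0 hβ1.le fun η hη => hV η hη.2.le,
    _, hV β le_rfl, (isConnected_Ico hβ0).image L hL.continuousOn,
    ⟨0, by simpa, rfl⟩, ?_⟩
  obtain ⟨e⟩ := nonempty_homeomorph_image_arc hL hLi (hsub β le_rfl)
  obtain ⟨e'⟩ := nonempty_homeomorph_Ico hβ0
  exact ⟨e.trans e'⟩

end Arcs

/-- In a nondegenerate Peano continuum, if a point `a` has a
neighborhood containing no simple triod, then: (i) if `a` is an endpoint of `X`,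
it has a connected open neighborhood homeomorphic to `[0,1)`; (ii) if `a` is not
an endpoint of `X`, it has a connected open neighborhood homeomorphic to `(0,1)`. -/
theorem stmt_3 (X : Type*) [MetricSpace X] [CompactSpace X] [ConnectedSpace X]
    [LocallyConnectedSpace X] (hnd : Nontrivial X)
    (a : X) (U : Set X) (hU : U ∈ nhds a) (hT : ContainsNoTriod U) :
    (IsEndpointOf X a →
      ∃ V : Set X, IsOpen V ∧ IsConnected V ∧ a ∈ V ∧
        Nonempty (V ≃ₜ Set.Ico (0:ℝ) 1)) ∧
    (¬ IsEndpointOf X a →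
      ∃ V : Set X, IsOpen V ∧ IsConnected V ∧ a ∈ V ∧
        Nonempty (V ≃ₜ Set.Ioo (0:ℝ) 1)) := by
  by_cases hex : ∃ L : ℝ → X, Continuous L ∧ InjOn L (Icc 0 1) ∧
      (∀ t ∈ Icc (0 : ℝ) 1, L t ∈ U) ∧ ∃ τ ∈ Ioo (0 : ℝ) 1, L τ = a
  · obtain ⟨L, hL, hLi, hLU, τ, hτ, rfl⟩ := hex
    obtain ⟨hend, hV⟩ := hT.exists_Ioo_nhd hL hLi hLU hτ hU
    exact ⟨fun h => (hend h).elim, fun _ => hV⟩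
  · push Not at hex
    obtain ⟨W, hWU, hW, haW, hWc⟩ := exists_isOpen_isConnected_subset hU
    obtain ⟨b, hbW, hba⟩ : ∃ b ∈ W, b ≠ a :=
      ((Filter.eventually_mem_set.2 (mem_nhdsWithin_of_mem_nhds (hW.mem_nhds haW))).and
        (self_mem_nhdsWithin (s := {a}ᶜ))).exists
    obtain ⟨L, hL, hLi, rfl, -, hLW⟩ := hW.exists_arc hWc haW hbW hba.symm
    obtain ⟨hend, hV⟩ := hT.exists_Ico_nhd hL hLi (fun t ht => hWU (hLW t ht)) hU hex
    exact ⟨fun _ => hV, fun h => (h hend).elim⟩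
end

section
/- Let X be a nondegenerate Peano continuum which is neither an arc nor a circle, and let I be an open connected subset of X which contains no simple triod. Then either I is homeomorphic to the open interval (0,1), or I is homeomorphic to the half-open interval [0,1). -/
open Set Metric Topology

/-- In a complete metric space, points which are related by successively finer chains, with a
bounded number of links at each scale, are joined by a path. -/
theorem exists_path_of_chains {X : Type*} [MetricSpace X] [CompleteSpace X] (C : ℝ)
    (R : ℕ → X → X → Prop) (N : ℕ → ℕ) (hN : ∀ n, 0 < N n)
    (hR : ∀ n x y, R n x y → ∃ c : ℕ → X, c 0 = x ∧ c (N n) = y ∧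
      (∀ r < N n, R (n + 1) (c r) (c (r + 1))) ∧ ∀ r ≤ N n, dist x (c r) ≤ C / 2 / 2 ^ n)
    {x y : X} (hxy : R 0 x y) :
    ∃ γ : ℝ → X, ContinuousOn γ (Icc 0 1) ∧ γ 0 = x ∧ γ 1 = y ∧
      ∀ t ∈ Icc (0:ℝ) 1, dist (γ t) x ≤ 2 * C := by
  classical
  choose! c hc0 hcN hcR hcd using hR
  obtain ⟨M, hM0, hMs⟩ : ∃ M : ℕ → ℕ, M 0 = 1 ∧ ∀ n, M (n + 1) = M n * N n :=
    ⟨fun n => Nat.rec 1 (fun n m => m * N n) n, rfl, fun n => rfl⟩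
  have hMpos : ∀ n, 0 < M n := by
    intro n
    induction n with
    | zero => simp [hM0]
    | succ n ih => rw [hMs]; exact Nat.mul_pos ih (hN n)
  obtain ⟨f, hf0, hfs⟩ : ∃ f : ℕ → ℕ → X, (∀ k, f 0 k = if k = 0 then x else y) ∧
      ∀ n k, f (n + 1) k = if k % N n = 0 then f n (k / N n) else
        c n (f n (k / N n)) (f n (k / N n + 1)) (k % N n) :=
    ⟨fun n => Nat.rec (fun k => if k = 0 then x else y)
      (fun n g k => if k % N n = 0 then g (k / N n) else
        c n (g (k / N n)) (g (k / N n + 1)) (k % N n)) n, fun k => rfl, fun n k => rfl⟩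
  have hdiv : ∀ n k, k < M (n + 1) → k / N n < M n := by
    intro n k hk
    rw [hMs] at hk
    exact Nat.div_lt_of_lt_mul (by rwa [mul_comm])
  have hRf : ∀ n k, k < M n → R n (f n k) (f n (k + 1)) := by
    intro n
    induction n with
    | zero =>
      intro k hk
      have : k = 0 := by omega
      subst this
      simpa [hf0] using hxy
    | succ n ih =>
      intro k hk
      have hq := ih _ (hdiv n k hk)
      have hr : k % N n < N n := Nat.mod_lt _ (hN n)
      have h1 : f (n + 1) k = c n (f n (k / N n)) (f n (k / N n + 1)) (k % N n) := by
        rw [hfs]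
        split_ifs with h
        · rw [h, hc0 _ _ _ hq]
        · rfl
      have h2 : f (n + 1) (k + 1) =
          c n (f n (k / N n)) (f n (k / N n + 1)) (k % N n + 1) := by
        have hk' := Nat.div_add_mod k (N n)
        by_cases h : k % N n + 1 = N n
        · have e : k + 1 = N n * (k / N n + 1) := by rw [mul_add, mul_one]; omega
          rw [hfs, h, hcN _ _ _ hq, e, Nat.mul_mod_right, if_pos rfl,
            Nat.mul_div_cancel_left _ (hN n)]
        · have hlt : k % N n + 1 < N n := by omega
          have e : k + 1 = (k % N n + 1) + N n * (k / N n) := by omega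
          have e1 : (k + 1) / N n = k / N n := by
            conv_lhs => rw [e]
            rw [Nat.add_mul_div_left _ _ (hN n), Nat.div_eq_of_lt hlt, zero_add]
          have e2 : (k + 1) % N n = k % N n + 1 := by
            conv_lhs => rw [e]
            rw [Nat.add_mul_mod_self_left, Nat.mod_eq_of_lt hlt]
          rw [hfs, e1, e2, if_neg (by omega)]
      rw [h1, h2]
      exact hcR _ _ _ hq _ hr
  have hstep : ∀ n k, k ≤ M (n + 1) → dist (f n (k / N n)) (f (n + 1) k) ≤ C / 2 / 2 ^ n := by
    intro n k hk
    have hnn : 0 ≤ C / 2 / 2 ^ n :=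
      dist_nonneg.trans (hcd n _ _ (hRf n 0 (hMpos n)) 0 (Nat.zero_le _))
    rw [hfs]
    split_ifs with h
    · simpa using hnn
    · have hlt : k < M (n + 1) := by
        rcases hk.lt_or_eq with h' | h'
        · exact h'
        · rw [h', hMs] at h
          simp at h
      exact hcd _ _ _ (hRf n _ (hdiv n k hlt)) _ (Nat.mod_lt _ (hN n)).le
  have hlink : ∀ n k, k < M n → dist (f n k) (f n (k + 1)) ≤ C / 2 / 2 ^ n := by
    intro n k hk
    have := hcd _ _ _ (hRf n _ hk) _ le_rfl
    rwa [hcN _ _ _ (hRf n _ hk)] at this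
  have hC : 0 ≤ C := by
    have := dist_nonneg.trans (hlink 0 0 (hMpos 0))
    simp only [pow_zero, div_one] at this
    linarith
  let g : ℕ → ℝ → X := fun n t => f n ⌊t * M n⌋₊
  have hfl : ∀ n, ∀ t ∈ Icc (0:ℝ) 1, ⌊t * M n⌋₊ ≤ M n := by
    intro n t ht
    apply Nat.floor_le_of_le
    have : (0:ℝ) ≤ M n := Nat.cast_nonneg _
    nlinarith [ht.2]
  have hg : ∀ t ∈ Icc (0:ℝ) 1, ∀ n, dist (g n t) (g (n + 1) t) ≤ C / 2 / 2 ^ n := by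
    intro t ht n
    have := hstep n _ (hfl (n + 1) t ht)
    rw [← Nat.floor_div_natCast] at this
    have e : t * (M (n + 1) : ℝ) / N n = t * M n := by
      have : (N n : ℝ) ≠ 0 := by exact_mod_cast (hN n).ne'
      rw [hMs]
      push_cast
      field_simp
    rw [e] at this
    exact this
  have hlim : ∀ t ∈ Icc (0:ℝ) 1, ∃ z, Filter.Tendsto (fun n => g n t) Filter.atTop (𝓝 z) :=
    fun t ht => cauchySeq_tendsto_of_complete (cauchySeq_of_le_geometric_two (hg t ht))
  have : Nonempty X := ⟨x⟩
  choose! γ hγ using hlim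
  have hγd : ∀ t ∈ Icc (0:ℝ) 1, ∀ n, dist (g n t) (γ t) ≤ C / 2 ^ n := fun t ht n =>
    dist_le_of_le_geometric_two_of_tendsto (hg t ht) (hγ t ht) n
  have hx : ∀ n, f n 0 = x := by
    intro n
    induction n with
    | zero => simp [hf0]
    | succ n ih => rw [hfs]; simpa using ih
  have hy : ∀ n, f n (M n) = y := by
    intro n
    induction n with
    | zero => simp [hf0, hM0]
    | succ n ih =>
      rw [hfs, hMs, Nat.mul_mod_left, if_pos rfl, Nat.mul_div_cancel _ (hN n), ih]
  refine ⟨γ, ?_, ?_, ?_, ?_⟩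
  · have close : ∀ n, ∀ s ∈ Icc (0:ℝ) 1, ∀ t ∈ Icc (0:ℝ) 1, s ≤ t → t < s + 1 / M n →
        dist (γ s) (γ t) ≤ 3 * (C / 2 ^ n) := by
      intro n s hs t ht hst hts
      have hMp : (0:ℝ) < M n := by exact_mod_cast hMpos n
      have h1 : dist (g n s) (g n t) ≤ C / 2 ^ n := by
        have hle : ⌊s * M n⌋₊ ≤ ⌊t * M n⌋₊ := Nat.floor_le_floor (by gcongr)
        have hle' : ⌊t * M n⌋₊ ≤ ⌊s * M n⌋₊ + 1 := by
          rw [← Nat.floor_add_one (mul_nonneg hs.1 hMp.le)]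
          apply Nat.floor_le_floor
          have : t * M n < (s + 1 / M n) * M n := by gcongr
          rw [add_mul, one_div_mul_cancel hMp.ne'] at this
          exact this.le
        have hpos : 0 ≤ C / 2 ^ n := by positivity
        rcases Nat.eq_or_lt_of_le hle with h | h
        · simp only [g, h, dist_self]; exact hpos
        · have e : ⌊t * M n⌋₊ = ⌊s * M n⌋₊ + 1 := by omega
          have := hlink n ⌊s * M n⌋₊ (by have := hfl n t ht; omega)
          rw [← e] at this
          refine this.trans ?_
          gcongr
          linarith
      have h2 := hγd s hs n
      have h3 := hγd t ht n
      have := dist_triangle4 (γ s) (g n s) (g n t) (γ t)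
      rw [dist_comm (γ s) (g n s)] at this
      linarith
    apply UniformContinuousOn.continuousOn
    rw [Metric.uniformContinuousOn_iff]
    intro ε hε
    obtain ⟨n, hn⟩ : ∃ n : ℕ, 3 * (C / 2 ^ n) < ε := by
      have : Filter.Tendsto (fun n : ℕ => 3 * (C * (1 / 2 : ℝ) ^ n)) Filter.atTop
          (𝓝 (3 * (C * 0))) :=
        ((tendsto_pow_atTop_nhds_zero_of_lt_one (by norm_num) (by norm_num)).const_mul C).const_mul 3
      rw [mul_zero, mul_zero] at this
      obtain ⟨n, hn⟩ := (this.eventually (gt_mem_nhds hε)).exists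
      refine ⟨n, ?_⟩
      simpa [div_eq_mul_inv] using hn
    have hMp : (0:ℝ) < M n := by exact_mod_cast hMpos n
    refine ⟨1 / M n, by positivity, fun s hs t ht hst => ?_⟩
    rw [Real.dist_eq, abs_lt] at hst
    rcases le_total s t with h | h
    · exact (close n s hs t ht h (by linarith)).trans_lt hn
    · rw [dist_comm]
      exact (close n t ht s hs h (by linarith)).trans_lt hn
  · have h0 : (0:ℝ) ∈ Icc (0:ℝ) 1 := by simp
    have := hγ 0 h0
    simp only [g, zero_mul, Nat.floor_zero, hx] at this
    exact tendsto_nhds_unique this tendsto_const_nhds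
  · have h0 : (1:ℝ) ∈ Icc (0:ℝ) 1 := by simp
    have := hγ 1 h0
    simp only [g, one_mul, Nat.floor_natCast, hy] at this
    exact tendsto_nhds_unique this tendsto_const_nhds
  · intro t ht
    have h1 := hγd t ht 0
    have h2 : dist x (g 0 t) ≤ C := by
      have hle := hfl 0 t ht
      have : ⌊t * M 0⌋₊ = 0 ∨ ⌊t * M 0⌋₊ = 1 := by omega
      rcases this with h | h
      · simp only [g, h, hx, dist_self]; exact hC
      · have := hlink 0 0 (hMpos 0)
        simp only [hx, zero_add, pow_zero, div_one] at this
        simp only [g, h]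
        exact this.trans (by linarith)
    rw [dist_comm]
    have := dist_triangle x (g 0 t) (γ t)
    simp only [pow_zero, div_one] at h1
    linarith

theorem exists_uniform_chain (X : Type*) [MetricSpace X] [CompactSpace X]
    [LocallyConnectedSpace X] {ε : ℝ} (hε : 0 < ε) :
    ∃ N : ℕ, 0 < N ∧ ∀ C : Set X, IsPreconnected C → ∀ x ∈ C, ∀ y ∈ C,
      ∃ c : ℕ → X, c 0 = x ∧ c N = y ∧ (∀ r, c r ∈ C) ∧
        ∀ r, ∃ D : Set X, IsPreconnected D ∧ c r ∈ D ∧ c (r + 1) ∈ D ∧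
          ∀ u ∈ D, ∀ v ∈ D, dist u v ≤ ε := by
  classical
  have hU : ∀ x : X, ∃ U : Set X, IsOpen U ∧ x ∈ U ∧ IsPreconnected U ∧
      ∀ u ∈ U, ∀ v ∈ U, dist u v ≤ ε := by
    intro x
    obtain ⟨U, hUb, hUo, hxU, hUc⟩ := (locallyConnectedSpace_iff_subsets_isOpen_isConnected.1
      ‹_› x (ball x (ε / 2)) (ball_mem_nhds x (half_pos hε)))
    refine ⟨U, hUo, hxU, hUc.isPreconnected, fun u hu v hv => ?_⟩
    have h1 := mem_ball.1 (hUb hu)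
    have h2 := mem_ball'.1 (hUb hv)
    linarith [dist_triangle u x v]
  choose U hUo hxU hUc hUd using hU
  obtain ⟨t, ht⟩ := isCompact_univ.elim_finite_subcover U hUo
    (fun x _ => mem_iUnion.2 ⟨x, hxU x⟩)
  have hcov : ∀ x : X, ∃ i : t, x ∈ U i := by
    intro x
    have := ht (mem_univ x)
    simp only [mem_iUnion] at this
    obtain ⟨i, hi, hx⟩ := this
    exact ⟨⟨i, hi⟩, hx⟩
  refine ⟨Fintype.card t + 1, Nat.succ_pos _, fun C hC x hx y hy => ?_⟩
  let G : SimpleGraph t := SimpleGraph.fromRel fun i j => (C ∩ (U i ∩ U j)).Nonempty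
  have hG : ∀ i j, G.Adj i j → (C ∩ (U i ∩ U j)).Nonempty := by
    intro i j h
    rcases (SimpleGraph.fromRel_adj _ _ _).1 h with ⟨-, h | h⟩
    · exact h
    · rwa [inter_comm (U i)]
  have walk : ∀ (i j : t) (p : G.Walk i j) (x : X), x ∈ U i → x ∈ C → y ∈ U j →
      ∃ c : ℕ → X, c 0 = x ∧ (∀ r, p.length + 1 ≤ r → c r = y) ∧ (∀ r, c r ∈ C) ∧
        ∀ r, ∃ i : t, c r ∈ U i ∧ c (r + 1) ∈ U i := by
    intro i j p
    induction p with
    | @nil i =>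
      intro x hx hxC hyi
      refine ⟨fun r => if r = 0 then x else y, by simp, ?_, ?_, ?_⟩
      · intro r hr
        have : r ≠ 0 := by rintro rfl; simp at hr
        simp [this]
      · intro r
        dsimp only
        split_ifs <;> assumption
      · intro r
        refine ⟨i, ?_, by simpa using hyi⟩
        dsimp only
        split_ifs <;> assumption
    | @cons i j k h p ih =>
      intro x hx hxC hyk
      obtain ⟨z, hzC, hzi, hzj⟩ := hG _ _ h
      obtain ⟨c, hc0, hcy, hcC, hcU⟩ := ih z hzj hzC hyk
      refine ⟨fun r => Nat.casesOn r x c, rfl, ?_, ?_, ?_⟩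
      · rintro (_ | r) hr
        · simp at hr
        · apply hcy
          simpa using hr
      · rintro (_ | r)
        · exact hxC
        · exact hcC r
      · rintro (_ | r)
        · exact ⟨i, hx, by simpa [hc0] using hzi⟩
        · exact hcU r
  obtain ⟨i, hi⟩ := hcov x
  obtain ⟨j, hj⟩ := hcov y
  have hreach : G.Reachable i j := by
    by_contra hcon
    let W : Set X := ⋃ k : {k : t // G.Reachable i k}, U k.1
    let W' : Set X := ⋃ k : {k : t // ¬ G.Reachable i k}, U k.1
    obtain ⟨z, hzC, hzW, hzW'⟩ := hC W W' (isOpen_iUnion fun k => hUo _)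
      (isOpen_iUnion fun k => hUo _)
      (by
        intro z _
        obtain ⟨k, hk⟩ := hcov z
        by_cases h : G.Reachable i k
        · exact Or.inl (mem_iUnion.2 ⟨⟨k, h⟩, hk⟩)
        · exact Or.inr (mem_iUnion.2 ⟨⟨k, h⟩, hk⟩))
      ⟨x, hx, mem_iUnion.2 ⟨⟨i, SimpleGraph.Reachable.refl _⟩, hi⟩⟩
      ⟨y, hy, mem_iUnion.2 ⟨⟨j, hcon⟩, hj⟩⟩
    obtain ⟨⟨k, hk⟩, hzk⟩ := mem_iUnion.1 hzW
    obtain ⟨⟨l, hl⟩, hzl⟩ := mem_iUnion.1 hzW'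
    apply hl
    refine hk.trans (SimpleGraph.Adj.reachable ((SimpleGraph.fromRel_adj _ _ _).2 ⟨?_, ?_⟩))
    · rintro rfl
      exact hl hk
    · exact Or.inl ⟨z, hzC, hzk, hzl⟩
  obtain ⟨p, hp⟩ := hreach.exists_isPath
  obtain ⟨c, hc0, hcy, hcC, hcU⟩ := walk i j p x hi hx hj
  refine ⟨c, hc0, hcy _ ?_, hcC, fun r => ?_⟩
  · have := hp.length_lt
    omega
  · obtain ⟨k, h1, h2⟩ := hcU r
    exact ⟨U k, hUc k, h1, h2, hUd k⟩

/-- A compact locally connected metric space is locally path connected. -/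
theorem locallyPathConnectedSpace_of_compact (X : Type*) [MetricSpace X] [CompactSpace X]
    [LocallyConnectedSpace X] : LocallyPathConnectedSpace X := by
  rw [locallyPathConnectedSpace_iff_pathComponentIn_mem_nhds]
  intro x F hF hxF
  obtain ⟨ε, hε, hεF⟩ := Metric.isOpen_iff.1 hF x hxF
  set C : ℝ := ε / 4 with hCdef
  have hC : 0 < C := by positivity
  have he : ∀ n : ℕ, 0 < C / 2 / 2 ^ n := fun n => by positivity
  choose N hN hchain using fun n : ℕ => exists_uniform_chain X (he (n + 1))
  obtain ⟨V, hVb, hVo, hxV, hVc⟩ := (locallyConnectedSpace_iff_subsets_isOpen_isConnected.1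
      ‹_› x (ball x (C / 4)) (ball_mem_nhds x (by positivity)))
  refine Filter.mem_of_superset (hVo.mem_nhds hxV) fun y hy => ?_
  obtain ⟨γ, hγ, hγ0, hγ1, hγd⟩ := exists_path_of_chains C
    (fun n x y => ∃ D : Set X, IsPreconnected D ∧ x ∈ D ∧ y ∈ D ∧
      ∀ u ∈ D, ∀ v ∈ D, dist u v ≤ C / 2 / 2 ^ n) N hN
    (by
      rintro n x y ⟨D, hD, hx, hy, hd⟩
      obtain ⟨c, h0, h1, h2, h3⟩ := hchain n D hD x hx y hy
      exact ⟨c, h0, h1, fun r _ => h3 r, fun r _ => hd _ hx _ (h2 r)⟩)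
    (x := x) (y := y)
    (by
      refine ⟨V, hVc.isPreconnected, hxV, hy, fun u hu v hv => ?_⟩
      have h1 := mem_ball.1 (hVb hu)
      have h2 := mem_ball'.1 (hVb hv)
      have := dist_triangle u x v
      simp only [pow_zero, div_one]
      linarith)
  refine JoinedIn.ofLine hγ hγ0 hγ1 ?_
  rintro _ ⟨t, ht, rfl⟩
  apply hεF
  have := hγd t ht
  rw [mem_ball]
  linarith

/-- For a continuous `f`, there is an irreducible closed subset of `[0,1]` containing `0` and `1`
such that `f` identifies the two ends of every gap. -/
theorem exists_irreducible_gap_set {Y : Type*} [MetricSpace Y] {f : ℝ → Y} (hf : Continuous f) :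
    ∃ C ⊆ Icc (0:ℝ) 1, IsClosed C ∧ 0 ∈ C ∧ 1 ∈ C ∧
      (∀ u ∈ C, ∀ v ∈ C, u < v → Ioo u v ∩ C = ∅ → f u = f v) ∧
      ∀ u ∈ C, ∀ v ∈ C, u < v → f u = f v → Ioo u v ∩ C = ∅ := by
  let S : Set (Set ℝ) := {C | C ⊆ Icc (0:ℝ) 1 ∧ IsClosed C ∧ 0 ∈ C ∧ 1 ∈ C ∧
      ∀ u ∈ C, ∀ v ∈ C, u < v → Ioo u v ∩ C = ∅ → f u = f v}
  obtain ⟨C, hC⟩ : ∃ C, Minimal (· ∈ S) C := by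
    apply zorn_superset
    intro c hcS hc
    rcases c.eq_empty_or_nonempty with rfl | hne
    · refine ⟨Icc 0 1, ⟨subset_rfl, isClosed_Icc, by simp, by simp, ?_⟩, by simp⟩
      intro u hu v hv huv h
      exfalso
      have : (u + v) / 2 ∈ Ioo u v ∩ Icc (0:ℝ) 1 :=
        ⟨⟨by linarith, by linarith⟩, by linarith [hu.1, hv.1], by linarith [hu.2, hv.2]⟩
      rw [h] at this
      exact this
    · refine ⟨⋂₀ c, ⟨?_, ?_, ?_, ?_, ?_⟩, fun s hs => sInter_subset_of_mem hs⟩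
      · obtain ⟨s, hs⟩ := hne
        exact (sInter_subset_of_mem hs).trans (hcS hs).1
      · exact isClosed_sInter fun s hs => (hcS hs).2.1
      · exact fun s hs => (hcS hs).2.2.1
      · exact fun s hs => (hcS hs).2.2.2.1
      · intro u hu v hv huv hgap
        refine eq_of_forall_dist_le fun ε hε => ?_
        obtain ⟨δ₁, hδ₁, h₁⟩ := Metric.continuous_iff.1 hf u (ε / 2) (half_pos hε)
        obtain ⟨δ₂, hδ₂, h₂⟩ := Metric.continuous_iff.1 hf v (ε / 2) (half_pos hε)
        obtain ⟨δ, hδ, hlt⟩ : ∃ δ, 0 < δ ∧ δ < min (min δ₁ δ₂) ((v - u) / 2) :=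
          exists_between (by simp only [lt_min_iff, hδ₁, hδ₂]; simpa using huv)
        simp only [lt_min_iff] at hlt
        obtain ⟨⟨hd₁, hd₂⟩, hd₃⟩ := hlt
        have : Nonempty c := hne.to_subtype
        obtain ⟨⟨D, hDc⟩, hD⟩ :=
          (isCompact_Icc (a := u + δ) (b := v - δ)).elim_directed_family_closed
          (fun s : c => (s : Set ℝ)) (fun s => (hcS s.2).2.1)
          (by
            rw [← sInter_eq_iInter, ← subset_empty_iff, ← hgap]
            exact inter_subset_inter_left _ (Icc_subset_Ioo (by linarith) (by linarith)))
          (fun a b => (hc.total a.2 b.2).elim (fun h => ⟨a, subset_rfl, h⟩)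
            (fun h => ⟨b, h, subset_rfl⟩))
        have huD : u ∈ D := hu D hDc
        have hvD : v ∈ D := hv D hDc
        have hDS := hcS hDc
        obtain ⟨u', ⟨hu'D, hu'⟩, hu'max⟩ :=
          ((isCompact_Icc (a := u) (b := u + δ)).inter_left hDS.2.1).exists_isGreatest
            ⟨u, huD, by simp [hδ.le]⟩
        obtain ⟨v', ⟨hv'D, hv'⟩, hv'min⟩ :=
          ((isCompact_Icc (a := v - δ) (b := v)).inter_left hDS.2.1).exists_isLeast
            ⟨v, hvD, by simp [hδ.le]⟩
        have huv' : u' < v' := by linarith [hu'.2, hv'.1]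
        have heq : f u' = f v' := by
          refine hDS.2.2.2.2 u' hu'D v' hv'D huv' ?_
          rw [← subset_empty_iff]
          rintro w ⟨hw, hwD⟩
          by_cases h1 : w ≤ u + δ
          · exact absurd (hu'max ⟨hwD, hu'.1.trans hw.1.le, h1⟩) (not_le.2 hw.1)
          · by_cases h2 : v - δ ≤ w
            · exact absurd (hv'min ⟨hwD, h2, hw.2.le.trans hv'.2⟩) (not_le.2 hw.2)
            · rw [← hD]
              exact ⟨⟨(not_le.1 h1).le, (not_le.1 h2).le⟩, hwD⟩
        have e1 := h₁ u' (by rw [Real.dist_eq, abs_lt]; constructor <;> linarith [hu'.1, hu'.2])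
        have e2 := h₂ v' (by rw [Real.dist_eq, abs_lt]; constructor <;> linarith [hv'.1, hv'.2])
        rw [heq, dist_comm] at e1
        linarith [dist_triangle (f u) (f v') (f v)]
  refine ⟨C, hC.1.1, hC.1.2.1, hC.1.2.2.1, hC.1.2.2.2.1, hC.1.2.2.2.2, ?_⟩
  intro s hs t ht hst hfst
  have hmem : C \ Ioo s t ∈ S := by
    refine ⟨sdiff_subset.trans hC.1.1, hC.1.2.1.sdiff isOpen_Ioo, ⟨hC.1.2.2.1, ?_⟩,
      ⟨hC.1.2.2.2.1, ?_⟩, ?_⟩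
    · exact fun h => absurd h.1 (not_lt.2 (hC.1.1 hs).1)
    · exact fun h => absurd h.2 (not_lt.2 (hC.1.1 ht).2)
    · intro u hu v hv huv hgap
      by_cases he : Ioo u v ∩ C = ∅
      · exact hC.1.2.2.2.2 u hu.1 v hv.1 huv he
      · obtain ⟨w, hw, hwC⟩ := nonempty_iff_ne_empty.2 he
        have hwst : w ∈ Ioo s t := by
          by_contra hcon
          have : w ∈ Ioo u v ∩ (C \ Ioo s t) := ⟨hw, hwC, hcon⟩
          rw [hgap] at this
          exact this
        have hgap' : ∀ z ∈ C, z ∈ Ioo u v → z ∉ Ioo s t → False := by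
          intro z hz h1 h2
          have : z ∈ Ioo u v ∩ (C \ Ioo s t) := ⟨h1, hz, h2⟩
          rw [hgap] at this
          exact this
        have hus : u = s := by
          by_contra hne
          have hle : u ≤ s := by
            by_contra hcon
            exact hu.2 ⟨not_le.1 hcon, hw.1.trans hwst.2⟩
          exact hgap' s hs ⟨lt_of_le_of_ne hle hne, hwst.1.trans hw.2⟩ (by simp)
        have hvt : v = t := by
          by_contra hne
          have hle : t ≤ v := by
            by_contra hcon
            exact hv.2 ⟨hwst.1.trans hw.2, not_le.1 hcon⟩
          exact hgap' t ht ⟨hw.1.trans hwst.2, lt_of_le_of_ne hle (Ne.symm hne)⟩ (by simp)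
        rw [hus, hvt, hfst]
  have := hC.2 hmem sdiff_subset
  ext w
  simp only [mem_inter_iff, mem_empty_iff_false, iff_false, not_and]
  exact fun h1 h2 => (this h2).2 h1

/-- A path can be replaced by one with the same end points all of whose fibres are intervals. -/
theorem exists_path_with_connected_fibres {Y : Type*} [MetricSpace Y] {f : ℝ → Y}
    (hf : Continuous f) :
    ∃ g : ℝ → Y, Continuous g ∧ g 0 = f 0 ∧ g 1 = f 1 ∧ (∀ t, g t ∈ f '' Icc 0 1) ∧
      ∀ s t, s ≤ t → g s = g t → ∀ w ∈ Icc s t, g w = g s := by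
  obtain ⟨C, hC01, hCc, h0C, h1C, hgap, hirr⟩ := exists_irreducible_gap_set hf
  have hbdd : ∀ t, BddAbove (C ∩ Iic t) := fun t => ⟨t, fun x hx => hx.2⟩
  let r : ℝ → ℝ := fun t => sSup (C ∩ Iic t)
  have hrneg : ∀ t < 0, r t = 0 := by
    intro t ht
    have : C ∩ Iic t = ∅ := by
      rw [← subset_empty_iff]
      rintro x ⟨hx, hxt⟩
      exact absurd ((hC01 hx).1.trans hxt) (not_le.2 ht)
    simp only [r, this, Real.sSup_empty]
  have hrmem : ∀ t, 0 ≤ t → r t ∈ C ∩ Iic t := fun t ht =>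
    (hCc.inter isClosed_Iic).csSup_mem ⟨0, h0C, ht⟩ (hbdd t)
  have hrC : ∀ t, r t ∈ C := by
    intro t
    rcases lt_or_ge t 0 with h | h
    · rw [hrneg t h]; exact h0C
    · exact (hrmem t h).1
  have hrge : ∀ t, ∀ x ∈ C, x ≤ t → x ≤ r t := fun t x hx hxt => le_csSup (hbdd t) ⟨hx, hxt⟩
  have hrmono : Monotone r := by
    intro s t hst
    rcases lt_or_ge s 0 with h | h
    · rw [hrneg s h]; exact (hC01 (hrC t)).1
    · exact hrge t _ (hrC s) ((hrmem s h).2.trans hst)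
  have hrC' : ∀ t ∈ C, r t = t := fun t ht =>
    le_antisymm (hrmem t (hC01 ht).1).2 (hrge t t ht le_rfl)
  have key : ∀ s t, s ≤ t → f (r s) = f (r t) ∨
      ∃ p ∈ Icc s t ∩ Icc (0:ℝ) 1, ∃ q ∈ Icc s t ∩ Icc (0:ℝ) 1, f (r s) = f p ∧ f (r t) = f q := by
    intro s t hst
    rcases (C ∩ Icc s t).eq_empty_or_nonempty with h | ⟨w, hwC, hw⟩
    · left
      have : C ∩ Iic s = C ∩ Iic t := by
        apply Subset.antisymm (inter_subset_inter_right _ (Iic_subset_Iic.2 hst))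
        rintro x ⟨hx, hxt⟩
        refine ⟨hx, ?_⟩
        by_contra hcon
        have : x ∈ C ∩ Icc s t := ⟨hx, (not_le.1 hcon).le, hxt⟩
        rw [h] at this
        exact this
      simp only [r, this]
    · right
      have ht0 : 0 ≤ t := (hC01 hwC).1.trans hw.2
      obtain ⟨p, ⟨hpC, hp⟩, hpmin⟩ :=
        ((isCompact_Icc (a := s) (b := t)).inter_left hCc).exists_isLeast ⟨w, hwC, hw⟩
      refine ⟨p, ⟨hp, hC01 hpC⟩, r t, ⟨⟨hw.1.trans (hrge t w hwC hw.2), (hrmem t ht0).2⟩,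
        hC01 (hrC t)⟩, ?_, rfl⟩
      have hle : r s ≤ p := by
        have := hrmono hp.1
        rwa [hrC' p hpC] at this
      rcases hle.eq_or_lt with h | h
      · rw [h]
      · refine hgap _ (hrC s) _ hpC h ?_
        rw [← subset_empty_iff]
        rintro x ⟨hx, hxC⟩
        rcases le_total x s with h' | h'
        · exact absurd (hrge s x hxC h') (not_le.2 hx.1)
        · exact absurd (hpmin ⟨hxC, h', hx.2.le.trans hp.2⟩) (not_le.2 hx.2)
  refine ⟨fun t => f (r t), ?_, ?_, ?_, fun t => ⟨r t, hC01 (hrC t), rfl⟩, ?_⟩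
  · have huc := (isCompact_Icc (a := (0:ℝ)) (b := 1)).uniformContinuousOn_of_continuous
      hf.continuousOn
    rw [Metric.uniformContinuousOn_iff] at huc
    apply UniformContinuous.continuous
    rw [Metric.uniformContinuous_iff]
    intro ε hε
    obtain ⟨δ, hδ, h⟩ := huc ε hε
    have main : ∀ s t, s ≤ t → dist s t < δ → dist (f (r s)) (f (r t)) < ε := by
      intro s t hst hd
      rcases key s t hst with h' | ⟨p, hp, q, hq, hfp, hfq⟩
      · rw [h', dist_self]; exact hε
      · rw [hfp, hfq]
        exact h p hp.2 q hq.2 ((Real.dist_le_of_mem_Icc hp.1 hq.1).trans_lt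
          (by rwa [dist_comm, Real.dist_eq, abs_of_nonneg (by linarith)] at hd))
    refine ⟨δ, hδ, fun s t hd => ?_⟩
    rcases le_total s t with h' | h'
    · exact main s t h' hd
    · rw [dist_comm]
      exact main t s h' (by rwa [dist_comm])
  · simp only [hrC' 0 h0C]
  · simp only [hrC' 1 h1C]
  · intro s t hst hfst w hw
    have h1 := hrmono hw.1
    have h2 := hrmono hw.2
    rcases h1.eq_or_lt with h | h
    · simp only [h]
    · rcases h2.eq_or_lt with h' | h'
      · simp only [h', hfst]
      · have := hirr _ (hrC s) _ (hrC t) (h.trans h') hfst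
        have hm : r w ∈ Ioo (r s) (r t) ∩ C := ⟨⟨h, h'⟩, hrC w⟩
        rw [this] at hm
        exact absurd hm (notMem_empty _)

/-- A path all of whose fibres are intervals factors through a monotone real function. -/
theorem exists_monotone_of_connected_fibres {Y : Type*} [MetricSpace Y] {g : ℝ → Y}
    (hg : Continuous g) (hfib : ∀ s t, s ≤ t → g s = g t → ∀ w ∈ Icc s t, g w = g s) :
    ∃ m : ℝ → ℝ, Continuous m ∧ Monotone m ∧ ∀ s t, m s = m t ↔ g s = g t := by
  let F : ℝ → ℝ → ℝ := fun q u => min 1 (dist (g q) (g u))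
  have hF : ∀ q, Continuous (F q) := fun q => continuous_const.min (continuous_const.dist hg)
  have hF0 : ∀ q u, 0 ≤ F q u := fun q u => le_min zero_le_one dist_nonneg
  have hF1 : ∀ q u, F q u ≤ 1 := fun q u => min_le_left _ _
  let M : ℝ → ℝ → ℝ := fun q t => sSup (F q '' Icc q (max q t))
  have hbdd : ∀ q t, BddAbove (F q '' Icc q (max q t)) := by
    rintro q t
    exact ⟨1, by rintro _ ⟨u, _, rfl⟩; exact hF1 q u⟩
  have hne : ∀ q t, (F q '' Icc q (max q t)).Nonempty := fun q t =>
    ⟨_, q, ⟨le_rfl, le_max_left _ _⟩, rfl⟩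
  have hM0 : ∀ q t, 0 ≤ M q t := fun q t =>
    Real.sSup_nonneg (by rintro _ ⟨u, _, rfl⟩; exact hF0 q u)
  have hM1 : ∀ q t, M q t ≤ 1 := fun q t =>
    csSup_le (hne q t) (by rintro _ ⟨u, _, rfl⟩; exact hF1 q u)
  have hMc : ∀ q, Continuous (M q) := by
    intro q
    have : M q = fun t => sSup ((fun u => F q (q + u * (max q t - q))) '' Icc 0 1) := by
      funext t
      have e := (segment_eq_image' ℝ q (max q t)).symm.trans (segment_eq_Icc (le_max_left q t))
      simp only [M, ← e, image_image, smul_eq_mul]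
    rw [this]
    refine isCompact_Icc.continuous_sSup ?_
    have := hF q
    fun_prop
  have hMmono : ∀ q, Monotone (M q) := fun q s t hst =>
    csSup_le_csSup (hbdd q t) (hne q s)
      (image_mono (Icc_subset_Icc_right (max_le_max_left q hst)))
  have hMeq : ∀ q s t, s ≤ t → g s = g t → M q s = M q t := by
    intro q s t hst hgst
    refine le_antisymm (hMmono q hst) (csSup_le (hne q t) ?_)
    rintro _ ⟨u, hu, rfl⟩
    apply le_csSup (hbdd q s)
    rcases le_total u (max q s) with h | h
    · exact ⟨u, ⟨hu.1, h⟩, rfl⟩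
    · refine ⟨max q s, ⟨le_max_left _ _, le_rfl⟩, ?_⟩
      rcases le_total t q with h' | h'
      · have : u = max q s := le_antisymm (by
          have := hu.2; rw [max_eq_left h'] at this; exact this.trans (le_max_left _ _)) h
        rw [this]
      · have hut : u ≤ t := by have := hu.2; rwa [max_eq_right h'] at this
        have e1 := hfib s t hst hgst u ⟨(le_max_right q s).trans h, hut⟩
        have e2 := hfib s t hst hgst (max q s) ⟨le_max_right q s, h.trans hut⟩
        simp only [F, e1, e2]
  let q := TopologicalSpace.denseSeq ℝ
  have hterm : ∀ n t, ‖(1 / 2 : ℝ) ^ n * M (q n) t‖ ≤ (1 / 2 : ℝ) ^ n := by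
    intro n t
    rw [Real.norm_eq_abs, abs_of_nonneg (mul_nonneg (by positivity) (hM0 _ _))]
    exact mul_le_of_le_one_right (by positivity) (hM1 _ _)
  have hsummable : ∀ t, Summable fun n => (1 / 2 : ℝ) ^ n * M (q n) t := fun t =>
    Summable.of_norm_bounded summable_geometric_two (fun n => hterm n t)
  let m : ℝ → ℝ := fun t => ∑' n, (1 / 2 : ℝ) ^ n * M (q n) t
  have hlt : ∀ s t, s < t → g s ≠ g t → m s < m t := by
    intro s t hst hne'
    have hopen : IsOpen {u | g u ≠ g t} := isOpen_ne_fun hg continuous_const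
    obtain ⟨ε, hε, hball⟩ := Metric.isOpen_iff.1 hopen s hne'
    obtain ⟨n, hn⟩ := (TopologicalSpace.denseRange_denseSeq ℝ).exists_mem_open
      (isOpen_Ioo (a := s) (b := min t (s + ε)))
      (nonempty_Ioo.2 (lt_min hst (lt_add_of_pos_right s hε)))
    obtain ⟨hsq, hqt⟩ := hn
    have hqt' : q n < t := hqt.trans_le (min_le_left _ _)
    have hgq : g (q n) ≠ g t := by
      apply hball
      rw [mem_ball, Real.dist_eq, abs_of_pos (sub_pos.2 hsq)]
      linarith [hqt.trans_le (min_le_right _ _)]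
    refine Summable.tsum_lt_tsum (i := n)
      (fun k => mul_le_mul_of_nonneg_left (hMmono _ hst.le) (by positivity)) ?_
      (hsummable s) (hsummable t)
    refine mul_lt_mul_of_pos_left ?_ (by positivity)
    have h1 : M (q n) s = 0 := by
      have : max (q n) s = q n := max_eq_left hsq.le
      simp [M, this, F]
    rw [h1]
    refine lt_of_lt_of_le (lt_min zero_lt_one (dist_pos.2 hgq))
      (le_csSup (hbdd (q n) t) ⟨t, ⟨hqt'.le, le_max_right _ _⟩, rfl⟩)
  have hmono : Monotone m := fun s t hst => (hsummable s).tsum_le_tsum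
    (fun n => mul_le_mul_of_nonneg_left (hMmono _ hst) (by positivity)) (hsummable t)
  have hmeq : ∀ s t, s ≤ t → g s = g t → m s = m t := by
    intro s t hst h
    simp only [m, hMeq _ s t hst h]
  refine ⟨m, continuous_tsum (fun n => continuous_const.mul (hMc _)) summable_geometric_two hterm,
    hmono, fun s t => ⟨fun h => ?_, fun h => ?_⟩⟩
  · by_contra hcon
    rcases lt_trichotomy s t with h' | h' | h'
    · exact (hlt s t h' hcon).ne h
    · exact hcon (by rw [h'])
    · exact (hlt t s h' (Ne.symm hcon)).ne h.symm
  · rcases le_total s t with h' | h'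
    · exact hmeq s t h' h
    · exact (hmeq t s h' h.symm).symm

/-- A set `A` together with a real-valued function `φ` exhibiting it as an arc or a point. -/
structure IsArcChart {Y : Type*} [TopologicalSpace Y] (A : Set Y) (φ : Y → ℝ) : Prop where
  isCompact : IsCompact A
  isPreconnected : IsPreconnected A
  continuousOn : ContinuousOn φ A
  injOn : InjOn φ A

/-- The image of a path contains an arc with the same end points. -/
theorem exists_arc_of_path {Y : Type*} [MetricSpace Y] {f : ℝ → Y} (hf : Continuous f) :
    ∃ (A : Set Y) (φ : Y → ℝ), IsArcChart A φ ∧ A ⊆ f '' Icc 0 1 ∧ f 0 ∈ A ∧ f 1 ∈ A ∧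
      ∀ x ∈ A, φ (f 0) ≤ φ x ∧ φ x ≤ φ (f 1) := by
  classical
  obtain ⟨g, hg, hg0, hg1, hgf, hfib⟩ := exists_path_with_connected_fibres hf
  obtain ⟨m, hm, hmono, hmg⟩ := exists_monotone_of_connected_fibres hg hfib
  let φ : Y → ℝ := fun x => if h : ∃ t, g t = x then m h.choose else 0
  have hφ : ∀ t, φ (g t) = m t := by
    intro t
    have h : ∃ s, g s = g t := ⟨t, rfl⟩
    simp only [φ, dif_pos h]
    exact (hmg _ _).2 h.choose_spec
  have hI0 : (0:ℝ) ∈ Icc (0:ℝ) 1 := by simp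
  have hI1 : (1:ℝ) ∈ Icc (0:ℝ) 1 := by simp
  refine ⟨g '' Icc 0 1, φ, ⟨isCompact_Icc.image hg, isPreconnected_Icc.image g hg.continuousOn,
    ?_, ?_⟩, ?_, hg0 ▸ mem_image_of_mem g hI0, hg1 ▸ mem_image_of_mem g hI1, ?_⟩
  · rw [continuousOn_iff_continuous_domRestrict]
    let G : Icc (0:ℝ) 1 → g '' Icc 0 1 := fun t => ⟨g t, mem_image_of_mem g t.2⟩
    have hG : Continuous G := by fun_prop
    have hGs : Function.Surjective G := by
      rintro ⟨_, t, ht, rfl⟩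
      exact ⟨⟨t, ht⟩, rfl⟩
    have hq : IsQuotientMap G := hG.isClosedMap.isQuotientMap hG hGs
    rw [hq.continuous_iff]
    have : (g '' Icc 0 1).domRestrict φ ∘ G = fun t : Icc (0:ℝ) 1 => m t := by
      funext t
      exact hφ t
    rw [this]
    fun_prop
  · rintro _ ⟨s, _, rfl⟩ _ ⟨t, _, rfl⟩ h
    rw [hφ, hφ] at h
    exact (hmg s t).1 h
  · rintro _ ⟨t, _, rfl⟩
    exact hgf t
  · rintro _ ⟨t, ht, rfl⟩
    rw [← hg0, ← hg1, hφ, hφ, hφ]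
    exact ⟨hmono ht.1, hmono ht.2⟩

theorem exists_arc {Y : Type*} [MetricSpace Y] [LocallyPathConnectedSpace Y] {U : Set Y}
    (hU : IsOpen U) (hUc : IsPreconnected U) {x y : Y} (hx : x ∈ U) (hy : y ∈ U) :
    ∃ (A : Set Y) (φ : Y → ℝ), IsArcChart A φ ∧ A ⊆ U ∧ x ∈ A ∧ y ∈ A ∧
      ∀ z ∈ A, φ x ≤ φ z ∧ φ z ≤ φ y := by
  have hp := hU.isConnected_iff_isPathConnected.1 ⟨⟨x, hx⟩, hUc⟩
  obtain ⟨γ, hγ⟩ := hp.joinedIn x hx y hy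
  obtain ⟨A, φ, hA, hAf, h0, h1, h⟩ := exists_arc_of_path γ.continuous_extend
  simp only [γ.extend_zero, γ.extend_one] at h0 h1 h
  refine ⟨A, φ, hA, hAf.trans ?_, h0, h1, h⟩
  rintro _ ⟨t, ht, rfl⟩
  rw [γ.extend_apply ht]
  exact hγ _

theorem nonempty_homeomorph_of_injOn {Y Z : Type*} [TopologicalSpace Y] [TopologicalSpace Z]
    [T2Space Z] {T : Set Y} (hT : IsCompact T) {F : Y → Z} (hF : ContinuousOn F T)
    (hinj : InjOn F T) {S : Set Z} (hS : F '' T = S) : Nonempty (T ≃ₜ S) := by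
  subst hS
  have : CompactSpace T := isCompact_iff_compactSpace.1 hT
  have hc : Continuous (hinj.bijOn_image.equiv F) :=
    (continuousOn_iff_continuous_domRestrict.1 hF).subtype_mk _
  exact ⟨hc.homeoOfEquivCompactToT2⟩

namespace IsArcChart

variable {Y : Type*} [TopologicalSpace Y] {A B : Set Y} {φ ψ : Y → ℝ}

theorem isClosed [T2Space Y] (hA : IsArcChart A φ) : IsClosed A := hA.isCompact.isClosed

theorem isPreconnected_inter [T2Space Y] (hA : IsArcChart A φ) {S : Set ℝ} (hS : S.OrdConnected) :
    IsPreconnected (A ∩ φ ⁻¹' S) := by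
  have : CompactSpace A := isCompact_iff_compactSpace.1 hA.isCompact
  have : PreconnectedSpace A := isPreconnected_iff_preconnectedSpace.1 hA.isPreconnected
  have hc : Continuous (A.domRestrict φ) :=
    continuousOn_iff_continuous_domRestrict.1 hA.continuousOn
  have hr : IsPreconnected (range (A.domRestrict φ) ∩ S) :=
    ((isPreconnected_range hc).ordConnected.inter hS).isPreconnected
  have := (hr.preimage_of_isClosedMap (injOn_iff_injective.1 hA.injOn) hc.isClosedMap
    inter_subset_left).image Subtype.val continuous_subtype_val.continuousOn
  convert this using 1
  ext x
  simp only [mem_inter_iff, mem_preimage, mem_image, mem_range, Subtype.exists, domRestrict]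
  constructor
  · exact fun h => ⟨x, h.1, ⟨⟨x, h.1, rfl⟩, h.2⟩, rfl⟩
  · rintro ⟨_, h, ⟨-, h'⟩, rfl⟩
    exact ⟨h, h'⟩

theorem inter_preimage [T2Space Y] (hA : IsArcChart A φ) {S : Set ℝ} (hS : S.OrdConnected)
    (hSc : IsClosed S) : IsArcChart (A ∩ φ ⁻¹' S) φ where
  isCompact := hA.isCompact.of_isClosed_subset
    (hA.continuousOn.preimage_isClosed_of_isClosed hA.isClosed hSc) inter_subset_left
  isPreconnected := hA.isPreconnected_inter hS
  continuousOn := hA.continuousOn.mono inter_subset_left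
  injOn := hA.injOn.mono inter_subset_left

theorem neg (hA : IsArcChart A φ) : IsArcChart A (fun x => -φ x) where
  isCompact := hA.isCompact
  isPreconnected := hA.isPreconnected
  continuousOn := hA.continuousOn.neg
  injOn := fun _ hx _ hy h => hA.injOn hx hy (neg_injective h)

/-- Concatenation of two arcs meeting at a common end point. -/
theorem union [T2Space Y] (hA : IsArcChart A φ) (hB : IsArcChart B ψ) {p : Y} (hpA : p ∈ A) (hpB : p ∈ B)
    (hAB : A ∩ B ⊆ {p}) (hφ : ∀ x ∈ A, φ x ≤ φ p) (hψ : ∀ x ∈ B, ψ p ≤ ψ x) :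
    ∃ χ : Y → ℝ, IsArcChart (A ∪ B) χ ∧ EqOn χ φ A ∧ ∀ x ∈ B, χ x = ψ x - ψ p + φ p := by
  classical
  let χ : Y → ℝ := fun x => if x ∈ A then φ x else ψ x - ψ p + φ p
  have h1 : EqOn χ φ A := fun x hx => if_pos hx
  have h2 : ∀ x ∈ B, χ x = ψ x - ψ p + φ p := by
    intro x hx
    by_cases hxA : x ∈ A
    · have : x = p := hAB ⟨hxA, hx⟩
      simp [χ, this, hpA]
    · exact if_neg hxA
  have h3 : ∀ x ∈ A, ∀ y ∈ B, χ x = χ y → x = y := by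
    intro x hx y hy h
    rw [h1 hx, h2 y hy] at h
    have e1 := hφ x hx
    have e2 := hψ y hy
    rw [hA.injOn hx hpA (by linarith), hB.injOn hy hpB (by linarith)]
  refine ⟨χ, ⟨hA.isCompact.union hB.isCompact,
    hA.isPreconnected.union p hpA hpB hB.isPreconnected, ?_, ?_⟩, h1, h2⟩
  · refine ContinuousOn.union_of_isClosed (hA.continuousOn.congr h1) ?_ hA.isClosed hB.isClosed
    exact ((hB.continuousOn.sub continuousOn_const).add continuousOn_const).congr h2
  · rintro x (hx | hx) y (hy | hy) h
    · rw [h1 hx, h1 hy] at h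
      exact hA.injOn hx hy h
    · exact h3 x hx y hy h
    · exact (h3 y hy x hx h.symm).symm
    · rw [h2 x hx, h2 y hy] at h
      exact hB.injOn hx hy (by linarith)

theorem exists_min (hA : IsArcChart A φ) (hne : A.Nonempty) : ∃ a ∈ A, ∀ x ∈ A, φ a ≤ φ x :=
  hA.isCompact.exists_isMinOn hne hA.continuousOn

theorem exists_max (hA : IsArcChart A φ) (hne : A.Nonempty) : ∃ a ∈ A, ∀ x ∈ A, φ x ≤ φ a :=
  hA.isCompact.exists_isMaxOn hne hA.continuousOn

/-- An arc has a chart onto `[0,1]`. -/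
theorem exists_normalized (hA : IsArcChart A φ) {a b : Y} (ha : a ∈ A) (hb : b ∈ A) (hab : a ≠ b)
    (hmin : ∀ x ∈ A, φ a ≤ φ x) (hmax : ∀ x ∈ A, φ x ≤ φ b) :
    ∃ ψ : Y → ℝ, IsArcChart A ψ ∧ ψ a = 0 ∧ ψ b = 1 ∧ ψ '' A = Icc 0 1 := by
  have hlt : 0 < φ b - φ a := sub_pos.2
    (lt_of_le_of_ne (hmin b hb) fun h => hab (hA.injOn ha hb h))
  have hψa : (φ a - φ a) / (φ b - φ a) = 0 := by simp
  have hψb : (φ b - φ a) / (φ b - φ a) = 1 := div_self hlt.ne'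
  have hcont : ContinuousOn (fun x => (φ x - φ a) / (φ b - φ a)) A :=
    (hA.continuousOn.sub continuousOn_const).div_const _
  refine ⟨fun x => (φ x - φ a) / (φ b - φ a), ⟨hA.isCompact, hA.isPreconnected, hcont, ?_⟩,
    hψa, hψb, Subset.antisymm ?_ ?_⟩
  · intro x hx y hy h
    have h' : (φ x - φ a) / (φ b - φ a) = (φ y - φ a) / (φ b - φ a) := h
    rw [div_left_inj' hlt.ne'] at h'
    exact hA.injOn hx hy (by linarith)
  · rintro _ ⟨x, hx, rfl⟩
    refine ⟨div_nonneg (sub_nonneg.2 (hmin x hx)) hlt.le, (div_le_one hlt).2 ?_⟩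
    linarith [hmax x hx]
  · have := hA.isPreconnected.intermediate_value ha hb hcont
    simpa only [hψa, hψb] using this

end IsArcChart

/-- The three directions of the model simple triod. -/
noncomputable def triodDirection (i : Fin 3) : ℂ :=
  Complex.exp ((![Real.pi / 3, Real.pi, 5 * Real.pi / 3] i : ℝ) * Complex.I)

theorem norm_triodDirection (i : Fin 3) : ‖triodDirection i‖ = 1 :=
  Complex.norm_exp_ofReal_mul_I _

theorem triodDirection_injective : Function.Injective triodDirection := by
  have him : ∀ i, (triodDirection i).im = ![√3 / 2, 0, -(√3 / 2)] i := by
    intro i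
    have h5 : Real.sin (5 * Real.pi / 3) = -(√3 / 2) := by
      have : 5 * Real.pi / 3 = 2 * Real.pi - Real.pi / 3 := by ring
      rw [this, Real.sin_two_pi_sub, Real.sin_pi_div_three]
    rw [triodDirection, Complex.exp_ofReal_mul_I_im]
    fin_cases i
    · simp
    · simp
    · simpa using h5
  have h3 : 0 < √3 := Real.sqrt_pos.2 (by norm_num)
  intro i j h
  have h' := congrArg Complex.im h
  rw [him, him] at h'
  fin_cases i <;> fin_cases j <;> simp at h' ⊢ <;> linarith

theorem triodModel_eq : triodModel =
    ⋃ i : Fin 3, (fun r : ℝ => (r : ℂ) * triodDirection i) '' Icc (0:ℝ) 1 := by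
  ext z
  simp only [triodModel, triodDirection, mem_iUnion, Fin.exists_fin_succ, mem_insert_iff,
    mem_singleton_iff, exists_prop]
  simp

/-- Three arcs with a common end point and otherwise disjoint form a simple triod. -/
theorem isSimpleTriod_iUnion_s4 {Y : Type*} [TopologicalSpace Y] [T2Space Y] {A : Fin 3 → Set Y}
    {φ : Fin 3 → Y → ℝ} (hA : ∀ i, IsArcChart (A i) (φ i)) {p : Y} (hp : ∀ i, p ∈ A i)
    (hmin : ∀ i, ∀ x ∈ A i, φ i p ≤ φ i x) (hne : ∀ i, ∃ x ∈ A i, x ≠ p)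
    (hdisj : ∀ i j, i ≠ j → A i ∩ A j ⊆ {p}) : IsSimpleTriod (⋃ i, A i) := by
  classical
  have hnorm : ∀ i, ∃ ψ : Y → ℝ, IsArcChart (A i) ψ ∧ ψ p = 0 ∧ ψ '' A i = Icc 0 1 := by
    intro i
    obtain ⟨q, hq, hmax⟩ := (hA i).exists_max ⟨p, hp i⟩
    obtain ⟨x, hx, hxp⟩ := hne i
    have hpq : p ≠ q := by
      rintro rfl
      exact hxp ((hA i).injOn hx (hp i) (le_antisymm (hmax x hx) (hmin i x hx)))
    obtain ⟨ψ, h1, h2, -, h3⟩ := (hA i).exists_normalized (hp i) hq hpq (hmin i) hmax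
    exact ⟨ψ, h1, h2, h3⟩
  choose ψ hψ hψp hψi using hnorm
  let F : Y → ℂ := fun x => ∑ i, (((A i).indicator (ψ i) x : ℝ) : ℂ) * triodDirection i
  have hF : ∀ i, ∀ x ∈ A i, F x = (ψ i x : ℂ) * triodDirection i := by
    intro i x hx
    simp only [F]
    rw [Finset.sum_eq_single i]
    · rw [indicator_of_mem hx]
    · intro j _ hji
      have : (A j).indicator (ψ j) x = 0 := by
        by_cases hxj : x ∈ A j
        · have : x = p := hdisj j i hji ⟨hxj, hx⟩
          rw [indicator_of_mem hxj, this, hψp]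
        · exact indicator_of_notMem hxj _
      simp [this]
    · simp
  have hψ0 : ∀ i, ∀ x ∈ A i, 0 ≤ ψ i x := by
    intro i x hx
    have := mem_image_of_mem (ψ i) hx
    rw [hψi] at this
    exact this.1
  refine nonempty_homeomorph_of_injOn (F := F) (isCompact_iUnion fun i => (hA i).isCompact)
    ?_ ?_ ?_
  · refine (locallyFinite_of_finite A).continuousOn_iUnion (fun i => (hA i).isClosed) fun i => ?_
    refine ContinuousOn.congr ?_ (hF i)
    exact (Complex.continuous_ofReal.comp_continuousOn (hψ i).continuousOn).mul continuousOn_const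
  · intro x hx y hy h
    obtain ⟨i, hxi⟩ := mem_iUnion.1 hx
    obtain ⟨j, hyj⟩ := mem_iUnion.1 hy
    rw [hF i x hxi, hF j y hyj] at h
    have hn : ψ i x = ψ j y := by
      have := congrArg norm h
      simpa [norm_triodDirection, abs_of_nonneg (hψ0 i x hxi), abs_of_nonneg (hψ0 j y hyj)]
        using this
    by_cases h0 : ψ i x = 0
    · have e1 : x = p := (hψ i).injOn hxi (hp i) (by rw [h0, hψp])
      have e2 : y = p := (hψ j).injOn hyj (hp j) (by rw [← hn, h0, hψp])
      rw [e1, e2]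
    · rw [hn] at h h0
      have hij : i = j := triodDirection_injective
        (mul_left_cancel₀ (Complex.ofReal_ne_zero.2 h0) h)
      subst hij
      exact (hψ i).injOn hxi hyj hn
  · rw [triodModel_eq, image_iUnion]
    refine iUnion_congr fun i => ?_
    rw [← hψi i, image_image]
    exact image_congr (hF i)

/-- The part of an arc from its initial point to its first point in a closed set. -/
theorem IsArcChart.exists_first_hit {Y : Type*} [TopologicalSpace Y] [T2Space Y] {A B : Set Y}
    {ψ : Y → ℝ} (hB : IsArcChart B ψ) (hA : IsClosed A) {q p : Y} (hq : q ∈ B) (hpB : p ∈ B)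
    (hpA : p ∈ A) (hmin : ∀ x ∈ B, ψ q ≤ ψ x) :
    ∃ h ∈ A, ∃ B' ⊆ B, IsArcChart B' ψ ∧ q ∈ B' ∧ h ∈ B' ∧
      (∀ x ∈ B', ψ q ≤ ψ x ∧ ψ x ≤ ψ h) ∧ A ∩ B' ⊆ {h} := by
  obtain ⟨h, hh, hhmin⟩ := (hB.isCompact.inter_right hA).exists_isMinOn ⟨p, hpB, hpA⟩
    (hB.continuousOn.mono inter_subset_left)
  refine ⟨h, hh.2, B ∩ ψ ⁻¹' Iic (ψ h), inter_subset_left,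
    hB.inter_preimage ordConnected_Iic isClosed_Iic, ⟨hq, hmin h hh.1⟩, ⟨hh.1, le_refl (ψ h)⟩,
    fun x hx => ⟨hmin x hx.1, hx.2⟩, ?_⟩
  rintro x ⟨hxA, hxB, hx⟩
  exact hB.injOn hxB hh.1 (le_antisymm hx (hhmin ⟨hxB, hxA⟩))

/-- In the absence of simple triods, an arc can meet another one in a common point only at
an end point of the latter. -/
theorem IsArcChart.isExtreme_of_no_triod {Y : Type*} [TopologicalSpace Y] [T2Space Y]
    (hT : ∀ T : Set Y, ¬ IsSimpleTriod T) {A B : Set Y} {φ ψ : Y → ℝ}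
    (hA : IsArcChart A φ) (hB : IsArcChart B ψ) {h q : Y} (hhA : h ∈ A) (hhB : h ∈ B)
    (hqB : q ∈ B) (hqh : q ≠ h) (hAB : A ∩ B ⊆ {h}) (hmax : ∀ x ∈ B, ψ x ≤ ψ h) :
    (∀ x ∈ A, φ h ≤ φ x) ∨ (∀ x ∈ A, φ x ≤ φ h) := by
  by_contra! hcon
  obtain ⟨⟨a, haA, ha⟩, b, hbA, hb⟩ := hcon
  refine hT _ (isSimpleTriod_iUnion_s4 (p := h)
    (A := ![A ∩ φ ⁻¹' Iic (φ h), A ∩ φ ⁻¹' Ici (φ h), B])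
    (φ := ![fun x => -φ x, φ, fun x => -ψ x]) ?_ ?_ ?_ ?_ ?_)
  · intro i
    fin_cases i
    · exact (hA.inter_preimage ordConnected_Iic isClosed_Iic).neg
    · exact hA.inter_preimage ordConnected_Ici isClosed_Ici
    · exact hB.neg
  · intro i
    fin_cases i
    · exact ⟨hhA, le_refl (φ h)⟩
    · exact ⟨hhA, le_refl (φ h)⟩
    · exact hhB
  · intro i
    fin_cases i
    · exact fun x hx => neg_le_neg hx.2
    · exact fun x hx => hx.2
    · exact fun x hx => neg_le_neg (hmax x hx)
  · intro i
    fin_cases i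
    · exact ⟨a, ⟨haA, ha.le⟩, fun e => ha.ne (by rw [e])⟩
    · exact ⟨b, ⟨hbA, hb.le⟩, fun e => hb.ne (by rw [e])⟩
    · exact ⟨q, hqB, hqh⟩
  · have h01 : ∀ x, x ∈ A → φ x ≤ φ h → φ h ≤ φ x → x = h :=
      fun x hx h1 h2 => hA.injOn hx hhA (le_antisymm h1 h2)
    have h2 : ∀ x, x ∈ A → x ∈ B → x = h := fun x hx hx' => hAB ⟨hx, hx'⟩
    intro i j hij x hx
    fin_cases i <;> fin_cases j <;> simp at hij hx ⊢ <;> grind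

section

variable {Y : Type*} [MetricSpace Y] [LocallyPathConnectedSpace Y]

theorem exists_isOpen_isPreconnected_subset {y : Y} {V : Set Y} (hV : V ∈ 𝓝 y) :
    ∃ U ⊆ V, IsOpen U ∧ IsPreconnected U ∧ y ∈ U := by
  obtain ⟨U, hUV, hUo, hy, hUc⟩ :=
    locallyConnectedSpace_iff_subsets_isOpen_isConnected.1 inferInstance y V hV
  exact ⟨U, hUV, hUo, hUc.isPreconnected, hy⟩

theorem IsArcChart.mem_nhds (hT : ∀ T : Set Y, ¬ IsSimpleTriod T) {A : Set Y} {φ : Y → ℝ}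
    (hA : IsArcChart A φ) {a b x : Y} (ha : a ∈ A) (hb : b ∈ A) (hx : x ∈ A)
    (hax : φ a < φ x) (hxb : φ x < φ b) : A ∈ 𝓝 x := by
  have hc1 := (hA.inter_preimage (S := Iic (φ a)) ordConnected_Iic isClosed_Iic).isClosed
  have hc2 := (hA.inter_preimage (S := Ici (φ b)) ordConnected_Ici isClosed_Ici).isClosed
  obtain ⟨U, hUV, hUo, hUc, hxU⟩ := exists_isOpen_isPreconnected_subset (y := x)
    (Filter.inter_mem (hc1.isOpen_compl.mem_nhds fun h => hax.not_ge h.2)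
      (hc2.isOpen_compl.mem_nhds fun h => hxb.not_ge h.2))
  refine Filter.mem_of_superset (hUo.mem_nhds hxU) fun q hq => ?_
  by_contra hqA
  obtain ⟨B, ψ, hB, hBU, hqB, hxB, hqx⟩ := exists_arc hUo hUc hq hxU
  obtain ⟨h, hhA, B', hB'B, hB', hqB', hhB', hqh, hAB⟩ :=
    hB.exists_first_hit hA.isClosed hqB hxB hx fun z hz => (hqx z hz).1
  have hhU := hUV (hBU (hB'B hhB'))
  have h1 : φ a < φ h := not_le.1 fun e => hhU.1 ⟨hhA, e⟩
  have h2 : φ h < φ b := not_le.1 fun e => hhU.2 ⟨hhA, e⟩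
  rcases hA.isExtreme_of_no_triod hT hB' hhA hhB' hqB' (fun e => hqA (e ▸ hhA)) hAB
    (fun z hz => (hqh z hz).2) with h | h
  · exact h1.not_ge (h a ha)
  · exact h2.not_ge (h b hb)

theorem exists_isArcChart_mem_nhds [PreconnectedSpace Y] [Nontrivial Y]
    (hT : ∀ T : Set Y, ¬ IsSimpleTriod T) (y : Y) : ∃ A φ, IsArcChart A φ ∧ A ∈ 𝓝 y := by
  obtain ⟨y', hy'⟩ := exists_ne y
  obtain ⟨A, φ, hA, -, hyA, hyA', hφ⟩ :=
    exists_arc isOpen_univ isPreconnected_univ (mem_univ y) (mem_univ y')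
  by_cases hAy : A ∈ 𝓝 y
  · exact ⟨A, φ, hA, hAy⟩
  have hlt : φ y < φ y' := lt_of_le_of_ne (hφ y hyA).2 fun e => hy' (hA.injOn hyA hyA' e).symm
  obtain ⟨U, hUV, hUo, hUc, hyU⟩ := exists_isOpen_isPreconnected_subset (y := y)
    (isOpen_compl_singleton.mem_nhds (show y ∈ ({y'} : Set Y)ᶜ from hy'.symm))
  obtain ⟨q, hqU, hqA⟩ : ∃ q ∈ U, q ∉ A := by
    by_contra! h
    exact hAy (Filter.mem_of_superset (hUo.mem_nhds hyU) h)
  obtain ⟨B, ψ, hB, hBU, hqB, hyB, hqy⟩ := exists_arc hUo hUc hqU hyU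
  obtain ⟨h, hhA, B', hB'B, hB', hqB', hhB', hqh, hAB⟩ :=
    hB.exists_first_hit hA.isClosed hqB hyB hyA fun z hz => (hqy z hz).1
  have hhy' : h ≠ y' := hUV (hBU (hB'B hhB'))
  have hqne : q ≠ h := fun e => hqA (e ▸ hhA)
  have hhy : h = y := by
    rcases hA.isExtreme_of_no_triod hT hB' hhA hhB' hqB' hqne hAB
      (fun z hz => (hqh z hz).2) with h' | h'
    · exact hA.injOn hhA hyA (le_antisymm (h' y hyA) (hφ h hhA).1)
    · exact absurd (hA.injOn hhA hyA' (le_antisymm (hφ h hhA).2 (h' y' hyA'))) hhy'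
  subst hhy
  obtain ⟨χ, hχ, h1, h2⟩ := hB'.union hA hhB' hhA (by rwa [inter_comm])
    (fun z hz => (hqh z hz).2) (fun z hz => (hφ z hz).1)
  refine ⟨B' ∪ A, χ, hχ, hχ.mem_nhds hT (Or.inl hqB') (Or.inr hyA') (Or.inl hhB') ?_ ?_⟩
  · rw [h1 hqB', h1 hhB']
    exact lt_of_le_of_ne (hqh h hhB').1 fun e => hqne (hB'.injOn hqB' hhB' e)
  · rw [h1 hhB', h2 y' hyA']
    linarith

theorem IsArcChart.exists_extension_mem [PreconnectedSpace Y]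
    (hT : ∀ T : Set Y, ¬ IsSimpleTriod T) {A : Set Y} {φ : Y → ℝ} (hA : IsArcChart A φ)
    (hne : A.Nonempty) (y : Y) : ∃ A' φ', IsArcChart A' φ' ∧ A ⊆ A' ∧ y ∈ A' ∧ EqOn φ' φ A := by
  by_cases hyA : y ∈ A
  · exact ⟨A, φ, hA, Subset.rfl, hyA, fun _ _ => rfl⟩
  obtain ⟨a, ha⟩ := hne
  obtain ⟨B, ψ, hB, -, hyB, haB, hψ⟩ :=
    exists_arc isOpen_univ isPreconnected_univ (mem_univ y) (mem_univ a)
  obtain ⟨h, hhA, B', -, hB', hyB', hhB', hyh, hAB⟩ :=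
    hB.exists_first_hit hA.isClosed hyB haB ha fun z hz => (hψ z hz).1
  rcases hA.isExtreme_of_no_triod hT hB' hhA hhB' hyB' (fun e => hyA (e ▸ hhA)) hAB
      (fun z hz => (hyh z hz).2) with h' | h'
  · obtain ⟨χ, hχ, h1, -⟩ := hA.neg.union hB'.neg hhA hhB' hAB (fun z hz => neg_le_neg (h' z hz))
      (fun z hz => neg_le_neg (hyh z hz).2)
    refine ⟨A ∪ B', _, hχ.neg, subset_union_left, Or.inr hyB', fun z hz => ?_⟩
    simp only [h1 hz, neg_neg]
  · obtain ⟨χ, hχ, h1, -⟩ := hA.union hB'.neg hhA hhB' hAB h'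
      (fun z hz => neg_le_neg (hyh z hz).2)
    exact ⟨A ∪ B', χ, hχ, subset_union_left, Or.inr hyB', h1⟩

end

theorem mk_sqrt_mem_sphere {t : ℝ} (ht : t ∈ Icc (0:ℝ) 1) {s : ℝ} (hs : s ^ 2 = 1) :
    (⟨2 * t - 1, s * √(1 - (2 * t - 1) ^ 2)⟩ : ℂ) ∈ sphere (0:ℂ) 1 := by
  have h : (0:ℝ) ≤ 1 - (2 * t - 1) ^ 2 := by nlinarith [ht.1, ht.2]
  rw [mem_sphere_zero_iff_norm, ← sq_eq_sq₀ (norm_nonneg _) zero_le_one, Complex.sq_norm,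
    Complex.normSq_mk]
  nlinarith [Real.mul_self_sqrt h]

/-- Two arcs meeting exactly in their end points form a circle. -/
theorem nonempty_homeomorph_sphere_of_union {Y : Type*} [TopologicalSpace Y] [T2Space Y]
    {A C : Set Y} {φ ψ : Y → ℝ} (hA : IsArcChart A φ) (hC : IsArcChart C ψ) {c d : Y}
    (hcA : c ∈ A) (hdA : d ∈ A) (hcC : c ∈ C) (hdC : d ∈ C) (hcd : c ≠ d)
    (hφ : ∀ x ∈ A, φ c ≤ φ x ∧ φ x ≤ φ d) (hψ : ∀ x ∈ C, ψ c ≤ ψ x ∧ ψ x ≤ ψ d)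
    (hAC : A ∩ C ⊆ {c, d}) : Nonempty (↥(A ∪ C) ≃ₜ sphere (0:ℂ) 1) := by
  classical
  obtain ⟨u, hu, huc, hud, hui⟩ := hA.exists_normalized hcA hdA hcd (fun x hx => (hφ x hx).1)
    (fun x hx => (hφ x hx).2)
  obtain ⟨v, hv, hvc, hvd, hvi⟩ := hC.exists_normalized hcC hdC hcd (fun x hx => (hψ x hx).1)
    (fun x hx => (hψ x hx).2)
  have hu01 : ∀ x ∈ A, u x ∈ Icc (0:ℝ) 1 := fun x hx => hui ▸ mem_image_of_mem u hx
  have hv01 : ∀ x ∈ C, v x ∈ Icc (0:ℝ) 1 := fun x hx => hvi ▸ mem_image_of_mem v hx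
  let G : ℝ → ℝ → ℂ := fun s t => ⟨2 * t - 1, s * √(1 - (2 * t - 1) ^ 2)⟩
  have hG : ∀ s, Continuous (G s) := by
    intro s
    have : G s = fun t => (((2 * t - 1 : ℝ) : ℂ) +
        ((s * √(1 - (2 * t - 1) ^ 2) : ℝ) : ℂ) * Complex.I) := by
      funext t
      exact Complex.mk_eq_add_mul_I _ _
    rw [this]
    fun_prop
  let F : Y → ℂ := fun x => if x ∈ A then G 1 (u x) else G (-1) (v x)
  have hFA : ∀ x ∈ A, F x = G 1 (u x) := fun x hx => if_pos hx
  have hFC : ∀ x ∈ C, F x = G (-1) (v x) := by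
    intro x hx
    by_cases hxA : x ∈ A
    · rw [hFA x hxA]
      rcases hAC ⟨hxA, hx⟩ with rfl | rfl
      · simp [G, huc, hvc]
      · norm_num [G, hud, hvd]
    · exact if_neg hxA
  have hinj : ∀ x ∈ A, ∀ y ∈ C, F x = F y → x = y := by
    intro x hx y hy h
    rw [hFA x hx, hFC y hy] at h
    have hre := congrArg Complex.re h
    have him := congrArg Complex.im h
    simp only [G] at hre him
    have huv : u x = v y := by linarith
    rw [huv] at him
    have h0 : √(1 - (2 * v y - 1) ^ 2) = 0 := by linarith
    have h1 := hv01 y hy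
    have h2 : v y * (1 - v y) ≤ 0 := by
      have := Real.sqrt_eq_zero'.1 h0
      nlinarith
    have h3 : v y = 0 ∨ v y = 1 := by
      have h4 : v y * (1 - v y) = 0 := le_antisymm h2 (mul_nonneg h1.1 (sub_nonneg.2 h1.2))
      rcases mul_eq_zero.1 h4 with h5 | h5
      · exact Or.inl h5
      · exact Or.inr (by linarith)
    rcases h3 with h3 | h3
    · rw [hu.injOn hx hcA (by rw [huv, h3, huc]), hv.injOn hy hcC (by rw [h3, hvc])]
    · rw [hu.injOn hx hdA (by rw [huv, h3, hud]), hv.injOn hy hdC (by rw [h3, hvd])]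
  have hGinj : ∀ s t t', G s t = G s t' → t = t' := by
    intro s t t' h
    have hre := congrArg Complex.re h
    simp only [G] at hre
    linarith
  refine nonempty_homeomorph_of_injOn (F := F) (hA.isCompact.union hC.isCompact) ?_ ?_ ?_
  · exact ContinuousOn.union_of_isClosed
      (((hG 1).comp_continuousOn hu.continuousOn).congr hFA)
      (((hG (-1)).comp_continuousOn hv.continuousOn).congr hFC) hA.isClosed hC.isClosed
  · rintro x (hx | hx) y (hy | hy) h
    · rw [hFA x hx, hFA y hy] at h
      exact hu.injOn hx hy (hGinj _ _ _ h)
    · exact hinj x hx y hy h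
    · exact (hinj y hy x hx h.symm).symm
    · rw [hFC x hx, hFC y hy] at h
      exact hv.injOn hx hy (hGinj _ _ _ h)
  · refine Subset.antisymm ?_ fun z hz => ?_
    · rintro _ ⟨x, hx | hx, rfl⟩
      · rw [hFA x hx]
        exact mk_sqrt_mem_sphere (hu01 x hx) (by norm_num)
      · rw [hFC x hx]
        exact mk_sqrt_mem_sphere (hv01 x hx) (by norm_num)
    · have hn : z.re ^ 2 + z.im ^ 2 = 1 := by
        have h1 := Complex.sq_norm z
        rw [mem_sphere_zero_iff_norm.1 hz, Complex.normSq_apply] at h1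
        nlinarith
      have ht : (z.re + 1) / 2 ∈ Icc (0:ℝ) 1 := by
        constructor <;> nlinarith [sq_nonneg z.im]
      have hs : 1 - (2 * ((z.re + 1) / 2) - 1) ^ 2 = z.im ^ 2 := by
        have : 2 * ((z.re + 1) / 2) - 1 = z.re := by ring
        rw [this]
        linarith
      have hGz : ∀ s : ℝ, s * |z.im| = z.im → G s ((z.re + 1) / 2) = z := by
        intro s h
        apply Complex.ext
        · simp only [G]
          ring
        · simp only [G, hs, Real.sqrt_sq_eq_abs, h]
      rcases le_total 0 z.im with h0 | h0
      · rw [← hui] at ht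
        obtain ⟨x, hx, hxt⟩ := ht
        refine ⟨x, Or.inl hx, ?_⟩
        rw [hFA x hx, hxt]
        exact hGz 1 (by rw [abs_of_nonneg h0, one_mul])
      · rw [← hvi] at ht
        obtain ⟨x, hx, hxt⟩ := ht
        refine ⟨x, Or.inr hx, ?_⟩
        rw [hFC x hx, hxt]
        exact hGz (-1) (by rw [abs_of_nonpos h0]; ring)

section

variable {Y : Type*} [MetricSpace Y] [LocallyPathConnectedSpace Y]

/-- Two arcs with the same end points and otherwise disjoint cover a neighbourhood of each
end point. -/
theorem IsArcChart.union_mem_nhds (hT : ∀ T : Set Y, ¬ IsSimpleTriod T)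
    {A C : Set Y} {φ ψ : Y → ℝ} (hA : IsArcChart A φ) (hC : IsArcChart C ψ) {c d : Y}
    (hcA : c ∈ A) (hdA : d ∈ A) (hcC : c ∈ C) (hdC : d ∈ C) (hcd : c ≠ d)
    (hφ : ∀ x ∈ A, φ c ≤ φ x) (hψ : ∀ x ∈ C, ψ c ≤ ψ x)
    (hAC : A ∩ C ⊆ {c, d}) : A ∪ C ∈ 𝓝 c := by
  have hlt : ψ c < ψ d := lt_of_le_of_ne (hψ d hdC) fun e => hcd (hC.injOn hcC hdC e)
  obtain ⟨m, hmC, hm⟩ := hC.isPreconnected.intermediate_value hcC hdC hC.continuousOn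
    (show (ψ c + ψ d) / 2 ∈ Icc (ψ c) (ψ d) from ⟨by linarith, by linarith⟩)
  have hcm : ψ c < ψ m := by linarith
  have hmd : ψ m < ψ d := by linarith
  have hD := hC.inter_preimage (S := Iic (ψ m)) ordConnected_Iic isClosed_Iic
  have hcD : c ∈ C ∩ ψ ⁻¹' Iic (ψ m) := ⟨hcC, hcm.le⟩
  obtain ⟨χ, hχ, h1, h2⟩ := hD.neg.union hA hcD hcA
    (by
      rintro x ⟨⟨hxC, hx⟩, hxA⟩
      rcases hAC ⟨hxA, hxC⟩ with h | h
      · exact h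
      · exact absurd (h ▸ hx) hmd.not_ge)
    (fun x hx => neg_le_neg (hψ x hx.1)) hφ
  refine Filter.mem_of_superset (hχ.mem_nhds hT (a := m) (b := d) (Or.inl ⟨hmC, le_refl (ψ m)⟩)
    (Or.inr hdA) (Or.inl hcD) ?_ ?_)
    (union_subset (inter_subset_left.trans subset_union_right) subset_union_left)
  · rw [h1 hcD, h1 ⟨hmC, le_refl (ψ m)⟩]
    exact neg_lt_neg hcm
  · rw [h1 hcD, h2 d hdA]
    have : φ c < φ d := lt_of_le_of_ne (hφ d hdA) fun e => hcd (hA.injOn hcA hdA e)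
    linarith

/-- An arc containing the end points of a second one contains it, unless the space is a
circle. -/
theorem IsArcChart.subset_of_ends_mem [PreconnectedSpace Y]
    (hT : ∀ T : Set Y, ¬ IsSimpleTriod T) (hY : ¬ Nonempty (Y ≃ₜ sphere (0:ℂ) 1))
    {A C : Set Y} {φ ψ : Y → ℝ} (hA : IsArcChart A φ) (hC : IsArcChart C ψ) {c d : Y}
    (hcA : c ∈ A) (hdA : d ∈ A) (hcC : c ∈ C) (hdC : d ∈ C)
    (hψ : ∀ x ∈ C, ψ c ≤ ψ x ∧ ψ x ≤ ψ d) : C ⊆ A := by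
  wlog hle : φ c ≤ φ d generalizing φ
  · exact this hA.neg (neg_le_neg (le_of_not_ge hle))
  rcases eq_or_ne c d with rfl | hcd
  · intro x hx
    rwa [hC.injOn hx hcC (le_antisymm (hψ x hx).2 (hψ x hx).1)]
  have hφlt : φ c < φ d := lt_of_le_of_ne hle fun e => hcd (hA.injOn hcA hdA e)
  have hψlt : ψ c < ψ d := lt_of_le_of_ne (hψ d hdC).1 fun e => hcd (hC.injOn hcC hdC e)
  have hD := hA.inter_preimage (S := Icc (φ c) (φ d)) ordConnected_Icc isClosed_Icc
  set D := A ∩ φ ⁻¹' Icc (φ c) (φ d) with hDdef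
  have hcD : c ∈ D := ⟨hcA, le_refl (φ c), hle⟩
  have hdD : d ∈ D := ⟨hdA, hle, le_refl (φ d)⟩
  have hnhds : ∀ x ∈ D, x ≠ c → x ≠ d → D ∈ 𝓝 x := by
    intro x hx hxc hxd
    refine hD.mem_nhds hT hcD hdD hx ?_ ?_
    · exact lt_of_le_of_ne hx.2.1 fun e => hxc (hA.injOn hx.1 hcA e.symm)
    · exact lt_of_le_of_ne hx.2.2 fun e => hxd (hA.injOn hx.1 hdA e)
  have hCnhds : ∀ x ∈ C, x ≠ c → x ≠ d → C ∈ 𝓝 x := by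
    intro x hx hxc hxd
    refine hC.mem_nhds hT hcC hdC hx ?_ ?_
    · exact lt_of_le_of_ne (hψ x hx).1 fun e => hxc (hC.injOn hx hcC e.symm)
    · exact lt_of_le_of_ne (hψ x hx).2 fun e => hxd (hC.injOn hx hdC e)
  have hpre := hC.isPreconnected_inter (S := Ioo (ψ c) (ψ d)) ordConnected_Ioo
  have hne : ∀ x ∈ C ∩ ψ ⁻¹' Ioo (ψ c) (ψ d), x ≠ c ∧ x ≠ d := by
    rintro x ⟨-, h1, h2⟩
    exact ⟨fun e => h1.ne (by rw [e]), fun e => h2.ne (by rw [e])⟩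
  have hmem : ∀ x ∈ C, x ≠ c → x ≠ d → x ∈ C ∩ ψ ⁻¹' Ioo (ψ c) (ψ d) := by
    intro x hx hxc hxd
    exact ⟨hx, lt_of_le_of_ne (hψ x hx).1 fun e => hxc (hC.injOn hx hcC e.symm),
      lt_of_le_of_ne (hψ x hx).2 fun e => hxd (hC.injOn hx hdC e)⟩
  by_cases hmeet : ∃ x ∈ C ∩ ψ ⁻¹' Ioo (ψ c) (ψ d), x ∈ D
  · obtain ⟨x, hx, hxD⟩ := hmeet
    have hsub : C ∩ ψ ⁻¹' Ioo (ψ c) (ψ d) ⊆ interior D := by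
      refine hpre.subset_left_of_subset_union isOpen_interior hD.isClosed.isOpen_compl
        (disjoint_compl_right.mono_left interior_subset) ?_
        ⟨x, hx, mem_interior_iff_mem_nhds.2 (hnhds x hxD (hne x hx).1 (hne x hx).2)⟩
      intro z hz
      by_cases hzD : z ∈ D
      · exact Or.inl (mem_interior_iff_mem_nhds.2 (hnhds z hzD (hne z hz).1 (hne z hz).2))
      · exact Or.inr hzD
    intro z hz
    by_cases hzc : z = c
    · rwa [hzc]
    by_cases hzd : z = d
    · rwa [hzd]
    exact (interior_subset (hsub (hmem z hz hzc hzd))).1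
  · have hDC : D ∩ C ⊆ {c, d} := by
      rintro z ⟨hzD, hzC⟩
      by_contra hz
      simp only [mem_insert_iff, mem_singleton_iff, not_or] at hz
      exact hmeet ⟨z, hmem z hzC hz.1 hz.2, hzD⟩
    have hDφ : ∀ x ∈ D, φ c ≤ φ x ∧ φ x ≤ φ d := fun x hx => hx.2
    have hopen : IsOpen (D ∪ C) := by
      rw [isOpen_iff_mem_nhds]
      intro z hz
      by_cases hzc : z = c
      · rw [hzc]
        exact hD.union_mem_nhds hT hC hcD hdD hcC hdC hcd (fun x hx => (hDφ x hx).1)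
          (fun x hx => (hψ x hx).1) hDC
      by_cases hzd : z = d
      · rw [hzd]
        exact hD.neg.union_mem_nhds hT hC.neg hdD hcD hdC hcC hcd.symm
          (fun x hx => neg_le_neg (hDφ x hx).2) (fun x hx => neg_le_neg (hψ x hx).2)
          (by rwa [pair_comm])
      rcases hz with hz | hz
      · exact Filter.mem_of_superset (hnhds z hz hzc hzd) subset_union_left
      · exact Filter.mem_of_superset (hCnhds z hz hzc hzd) subset_union_right
    have huniv : D ∪ C = univ := by
      rcases isClopen_iff.1 ⟨hD.isClosed.union hC.isClosed, hopen⟩ with h | h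
      · exact absurd (h ▸ Or.inl hcD : c ∈ (∅ : Set Y)) (notMem_empty c)
      · exact h
    obtain ⟨e⟩ := nonempty_homeomorph_sphere_of_union hD hC hcD hdD hcC hdC hcd hDφ hψ hDC
    exact absurd ⟨((Homeomorph.Set.univ Y).symm.trans (Homeomorph.setCongr huniv.symm)).trans e⟩ hY

end

theorem IsArcChart.exists_extension_subset {Y : Type*} [MetricSpace Y]
    [LocallyPathConnectedSpace Y] [PreconnectedSpace Y]
    (hT : ∀ T : Set Y, ¬ IsSimpleTriod T) (hY : ¬ Nonempty (Y ≃ₜ sphere (0:ℂ) 1))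
    {A C : Set Y} {φ ψ : Y → ℝ} (hA : IsArcChart A φ) (hne : A.Nonempty) (hC : IsArcChart C ψ) :
    ∃ A' φ', IsArcChart A' φ' ∧ A ⊆ A' ∧ C ⊆ A' ∧ EqOn φ' φ A := by
  rcases C.eq_empty_or_nonempty with rfl | hCne
  · exact ⟨A, φ, hA, Subset.rfl, empty_subset _, fun _ _ => rfl⟩
  obtain ⟨c, hcC, hc⟩ := hC.exists_min hCne
  obtain ⟨d, hdC, hd⟩ := hC.exists_max hCne
  obtain ⟨A₁, φ₁, hA₁, hAA₁, hc₁, he₁⟩ := hA.exists_extension_mem hT hne c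
  obtain ⟨A₂, φ₂, hA₂, hAA₂, hd₂, he₂⟩ := hA₁.exists_extension_mem hT ⟨c, hc₁⟩ d
  exact ⟨A₂, φ₂, hA₂, hAA₁.trans hAA₂,
    hA₂.subset_of_ends_mem hT hY hC (hAA₂ hc₁) hd₂ hcC hdC fun x hx => ⟨hc x hx, hd x hx⟩,
    fun x hx => (he₂ (hAA₁ hx)).trans (he₁ hx)⟩

/-- A space without simple triods which is not a circle injects continuously into the line. -/
theorem exists_continuous_injective_real {Y : Type*} [MetricSpace Y]
    [SecondCountableTopology Y] [LocallyPathConnectedSpace Y] [PreconnectedSpace Y] [Nontrivial Y]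
    (hT : ∀ T : Set Y, ¬ IsSimpleTriod T) (hY : ¬ Nonempty (Y ≃ₜ sphere (0:ℂ) 1)) :
    ∃ f : Y → ℝ, Continuous f ∧ Function.Injective f := by
  choose N ν hN hNy using exists_isArcChart_mem_nhds hT
  obtain ⟨s, hs, hsU⟩ := countable_cover_nhds_interior hNy
  have hsne : s.Nonempty := by
    obtain ⟨y⟩ : Nonempty Y := inferInstance
    have hy : y ∈ ⋃ x ∈ s, interior (N x) := hsU ▸ mem_univ y
    obtain ⟨x, hx, -⟩ := mem_iUnion₂.1 hy
    exact ⟨x, hx⟩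
  obtain ⟨c, hc⟩ := hs.exists_eq_range hsne
  let Chart := {p : Set Y × (Y → ℝ) // IsArcChart p.1 p.2 ∧ p.1.Nonempty}
  have step : ∀ (p : Chart) (y : Y), ∃ q : Chart,
      p.1.1 ⊆ q.1.1 ∧ N y ⊆ q.1.1 ∧ EqOn q.1.2 p.1.2 p.1.1 := by
    rintro ⟨⟨A, φ⟩, hA, hne⟩ y
    obtain ⟨A', φ', hA', h1, h2, h3⟩ := hA.exists_extension_subset hT hY hne (hN y)
    exact ⟨⟨(A', φ'), hA', hne.mono h1⟩, h1, h2, h3⟩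
  choose next hnext1 hnext2 hnext3 using step
  let p₀ : Chart := ⟨(N (c 0), ν (c 0)), hN _, ⟨c 0, mem_of_mem_nhds (hNy _)⟩⟩
  let p : ℕ → Chart := fun n => Nat.rec p₀ (fun n q => next q (c n)) n
  have hp : ∀ n, p (n + 1) = next (p n) (c n) := fun n => rfl
  have hmono : ∀ m n, m ≤ n → (p m).1.1 ⊆ (p n).1.1 ∧ EqOn (p n).1.2 (p m).1.2 (p m).1.1 := by
    intro m n hmn
    induction n, hmn using Nat.le_induction with
    | base => exact ⟨Subset.rfl, fun _ _ => rfl⟩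
    | succ n _ ih =>
      rw [hp]
      exact ⟨ih.1.trans (hnext1 _ _), fun x hx => (hnext3 _ _ (ih.1 hx)).trans (ih.2 hx)⟩
  have hcov : ∀ y, ∃ n, (p n).1.1 ∈ 𝓝 y := by
    intro y
    have hy : y ∈ ⋃ x ∈ s, interior (N x) := hsU ▸ mem_univ y
    obtain ⟨x, hx, hyx⟩ := mem_iUnion₂.1 hy
    obtain ⟨n, rfl⟩ := hc ▸ hx
    refine ⟨n + 1, Filter.mem_of_superset (mem_interior_iff_mem_nhds.1 hyx) ?_⟩
    rw [hp]
    exact hnext2 _ _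
  choose k hk using hcov
  have hf : ∀ n, ∀ y ∈ (p n).1.1, (p (k y)).1.2 y = (p n).1.2 y := by
    intro n y hy
    rcases le_total n (k y) with h | h
    · exact (hmono _ _ h).2 hy
    · exact ((hmono _ _ h).2 (mem_of_mem_nhds (hk y))).symm
  refine ⟨fun y => (p (k y)).1.2 y, continuous_iff_continuousAt.2 fun y => ?_, fun x y h => ?_⟩
  · exact ((p (k y)).2.1.continuousOn.congr (hf (k y))).continuousAt (hk y)
  · have hx := (hmono (k x) _ (le_max_left (k x) (k y))).1 (mem_of_mem_nhds (hk x))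
    have hy := (hmono (k y) _ (le_max_right (k x) (k y))).1 (mem_of_mem_nhds (hk y))
    refine (p (max (k x) (k y))).2.1.injOn hx hy ?_
    rw [← hf _ x hx, ← hf _ y hy]
    exact h

/-- One-sided neighbourhoods for an injective continuous function on a connected, locally
connected space. -/
theorem exists_forall_mem_of_continuous_injective {Y : Type*} [TopologicalSpace Y]
    [LocallyConnectedSpace Y] [PreconnectedSpace Y] {f : Y → ℝ} (hf : Continuous f)
    (hinj : Function.Injective f) {y : Y} {V : Set Y} (hV : V ∈ 𝓝 y) :
    ∃ ε > 0, ∀ z, f y ≤ f z → f z < f y + ε → z ∈ V := by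
  obtain ⟨U, hUV, hUo, hyU, hUc⟩ :=
    locallyConnectedSpace_iff_subsets_isOpen_isConnected.1 inferInstance y V hV
  by_cases hgt : ∃ w ∈ U, f y < f w
  · obtain ⟨w, hwU, hw⟩ := hgt
    refine ⟨f w - f y, sub_pos.2 hw, fun z hz1 hz2 => ?_⟩
    obtain ⟨z', hz'U, hz'⟩ := hUc.isPreconnected.intermediate_value hyU hwU hf.continuousOn
      (show f z ∈ Icc (f y) (f w) from ⟨hz1, by linarith⟩)
    exact hUV (hinj hz' ▸ hz'U)
  · push Not at hgt
    have hopen : IsOpen {z | f z ≤ f y} := by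
      rw [isOpen_iff_mem_nhds]
      intro z hz
      rcases eq_or_ne z y with rfl | hzy
      · exact Filter.mem_of_superset (hUo.mem_nhds hyU) hgt
      · have hlt : f z < f y := lt_of_le_of_ne hz fun e => hzy (hinj e)
        exact Filter.mem_of_superset ((isOpen_Iio.preimage hf).mem_nhds hlt)
          fun w (hw : f w < f y) => hw.le
    have huniv : {z | f z ≤ f y} = univ := by
      rcases isClopen_iff.1 ⟨isClosed_le hf continuous_const, hopen⟩ with h | h
      · exact absurd (h ▸ le_refl (f y) : y ∈ (∅ : Set Y)) (notMem_empty y)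
      · exact h
    refine ⟨1, one_pos, fun z hz1 _ => ?_⟩
    have hz2 : z ∈ {z | f z ≤ f y} := huniv ▸ mem_univ z
    exact hinj (le_antisymm hz1 hz2) ▸ mem_of_mem_nhds hV

theorem isEmbedding_of_continuous_injective_real {Y : Type*} [TopologicalSpace Y]
    [LocallyConnectedSpace Y] [PreconnectedSpace Y] {f : Y → ℝ} (hf : Continuous f)
    (hinj : Function.Injective f) : IsEmbedding f := by
  refine ⟨isInducing_iff_nhds.2 fun y => le_antisymm hf.continuousAt.tendsto.le_comap ?_, hinj⟩
  intro V hV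
  obtain ⟨ε, hε, h1⟩ := exists_forall_mem_of_continuous_injective hf hinj hV
  obtain ⟨δ, hδ, h2⟩ := exists_forall_mem_of_continuous_injective (f := fun z => -f z) hf.neg
    (neg_injective.comp hinj) hV
  refine ⟨Ioo (f y - δ) (f y + ε), Ioo_mem_nhds (by linarith) (by linarith), ?_⟩
  rintro z ⟨hz1, hz2⟩
  rcases le_total (f y) (f z) with h | h
  · exact h1 z h hz2
  · exact h2 z (neg_le_neg h) (by linarith)

/-- A connected, locally connected space which injects continuously into the line is an
interval. -/
theorem homeomorph_interval_of_continuous_injective {Y : Type*} [TopologicalSpace Y]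
    [LocallyConnectedSpace Y] [PreconnectedSpace Y] [Nontrivial Y] {f : Y → ℝ}
    (hf : Continuous f) (hinj : Function.Injective f) :
    Nonempty (Y ≃ₜ Ioo (0:ℝ) 1) ∨ Nonempty (Y ≃ₜ Ico (0:ℝ) 1) ∨ Nonempty (Y ≃ₜ Icc (0:ℝ) 1) := by
  have key : ∀ {g : Y → ℝ} {S : Set ℝ}, Continuous g → Function.Injective g → range g = S →
      Nonempty (Y ≃ₜ S) := by
    rintro g S hg hg' rfl
    exact ⟨(isEmbedding_of_continuous_injective_real hg hg').toHomeomorph⟩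
  let g : Y → ℝ := fun y => Real.arctan (f y)
  have hg : Continuous g := Real.continuous_arctan.comp hf
  have hginj : Function.Injective g := Real.arctan_injective.comp hinj
  have hconn : IsConnected (range g) := ⟨range_nonempty g, isPreconnected_range hg⟩
  have hb : BddBelow (range g) := ⟨-(Real.pi / 2), by
    rintro _ ⟨y, rfl⟩
    exact (Real.neg_pi_div_two_lt_arctan _).le⟩
  have ha : BddAbove (range g) := ⟨Real.pi / 2, by
    rintro _ ⟨y, rfl⟩
    exact (Real.arctan_lt_pi_div_two _).le⟩
  have hIoo := hconn.Ioo_csInf_csSup_subset hb ha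
  have hle : ∀ y, sInf (range g) ≤ g y ∧ g y ≤ sSup (range g) :=
    fun y => ⟨csInf_le hb (mem_range_self y), le_csSup ha (mem_range_self y)⟩
  set a := sInf (range g)
  set b := sSup (range g)
  have hab : a < b := by
    obtain ⟨x, y, hxy⟩ := exists_pair_ne Y
    by_contra! h
    exact hxy (hginj (by linarith [hle x, hle y]))
  have hba : 0 < b - a := sub_pos.2 hab
  let u : Y → ℝ := fun y => (g y - a) / (b - a)
  have hu : Continuous u := (hg.sub continuous_const).div_const _
  have huinj : Function.Injective u := by
    intro x y h
    have h' : (g x - a) / (b - a) = (g y - a) / (b - a) := h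
    rw [div_left_inj' hba.ne'] at h'
    exact hginj (by linarith)
  have hu01 : ∀ y, 0 ≤ u y ∧ u y ≤ 1 := fun y =>
    ⟨div_nonneg (by linarith [hle y]) hba.le, (div_le_one hba).2 (by linarith [hle y])⟩
  have hIoo' : ∀ t, 0 < t → t < 1 → t ∈ range u := by
    intro t h0 h1
    obtain ⟨y, hy⟩ := hIoo (show a + t * (b - a) ∈ Ioo a b from
      ⟨by nlinarith, by nlinarith⟩)
    refine ⟨y, ?_⟩
    simp only [u, hy]
    field_simp
    ring
  by_cases h0 : (0:ℝ) ∈ range u <;> by_cases h1 : (1:ℝ) ∈ range u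
  · right; right
    refine key hu huinj (Subset.antisymm ?_ ?_)
    · rintro _ ⟨y, rfl⟩
      exact hu01 y
    · rintro t ⟨ht0, ht1⟩
      rcases ht0.eq_or_lt with rfl | ht0
      · exact h0
      rcases ht1.eq_or_lt with rfl | ht1
      · exact h1
      exact hIoo' t ht0 ht1
  · right; left
    refine key hu huinj (Subset.antisymm ?_ ?_)
    · rintro _ ⟨y, rfl⟩
      exact ⟨(hu01 y).1, lt_of_le_of_ne (hu01 y).2 fun e => h1 ⟨y, e⟩⟩
    · rintro t ⟨ht0, ht1⟩
      rcases ht0.eq_or_lt with rfl | ht0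
      · exact h0
      exact hIoo' t ht0 ht1
  · right; left
    refine key (g := fun y => 1 - u y) (continuous_const.sub hu)
      (fun x y h => huinj (by simpa using h)) (Subset.antisymm ?_ ?_)
    · rintro _ ⟨y, rfl⟩
      have : 0 < u y := lt_of_le_of_ne (hu01 y).1 fun e => h0 ⟨y, e.symm⟩
      exact ⟨by linarith [hu01 y], by linarith⟩
    · rintro t ⟨ht0, ht1⟩
      rcases ht0.eq_or_lt with rfl | ht0
      · obtain ⟨y, hy⟩ := h1
        exact ⟨y, by simp [hy]⟩
      obtain ⟨y, hy⟩ := hIoo' (1 - t) (by linarith) (by linarith)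
      exact ⟨y, by simp [hy]⟩
  · left
    refine key hu huinj (Subset.antisymm ?_ ?_)
    · rintro _ ⟨y, rfl⟩
      exact ⟨lt_of_le_of_ne (hu01 y).1 fun e => h0 ⟨y, e.symm⟩,
        lt_of_le_of_ne (hu01 y).2 fun e => h1 ⟨y, e⟩⟩
    · rintro t ⟨ht0, ht1⟩
      exact hIoo' t ht0 ht1

/-- In a nondegenerate Peano continuum which is neither an arc nor
a circle, an open connected subset containing no simple triod is homeomorphic
to `(0,1)` or to `[0,1)`. -/
theorem stmt_4 (X : Type*) [MetricSpace X] [CompactSpace X] [ConnectedSpace X]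
    [LocallyConnectedSpace X] (hnd : Nontrivial X)
    (harc : ¬ SpaceIsArc X) (hcirc : ¬ SpaceIsCircle X)
    (I : Set X) (hIo : IsOpen I) (hIc : IsConnected I)
    (hT : ContainsNoTriod I) :
    Nonempty (I ≃ₜ Set.Ioo (0:ℝ) 1) ∨ Nonempty (I ≃ₜ Set.Ico (0:ℝ) 1) := by
  have : LocallyPathConnectedSpace X := locallyPathConnectedSpace_of_compact X
  have : LocallyPathConnectedSpace I := hIo.locallyPathConnectedSpace
  have : ConnectedSpace I := isConnected_iff_connectedSpace.1 hIc
  have : Nontrivial I := by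
    by_contra hI
    have hsub : I.Subsingleton := not_nontrivial_iff.1 fun h => hI h.coe_sort
    obtain ⟨x, rfl⟩ := hsub.eq_empty_or_singleton.resolve_left hIc.nonempty.ne_empty
    rcases isClopen_iff.1 ⟨isClosed_singleton, hIo⟩ with h | h
    · exact singleton_ne_empty x h
    · obtain ⟨y, hy⟩ := exists_ne x
      exact hy (h ▸ mem_univ y : y ∈ ({x} : Set X))
  have hcompact : CompactSpace I → Nonempty (X ≃ₜ I) := by
    intro h
    have hI : I = univ := by
      rcases isClopen_iff.1 ⟨(isCompact_iff_compactSpace.2 h).isClosed, hIo⟩ with h' | h'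
      · exact absurd h' hIc.nonempty.ne_empty
      · exact h'
    exact ⟨(Homeomorph.Set.univ X).symm.trans (Homeomorph.setCongr hI.symm)⟩
  have hTI : ∀ T : Set I, ¬ IsSimpleTriod T := by
    rintro T ⟨e⟩
    refine hT (Subtype.val '' T) (Subtype.coe_image_subset I T) ⟨Homeomorph.trans ?_ e⟩
    exact (IsEmbedding.subtypeVal.homeomorphImage T).symm
  have hcircI : ¬ Nonempty (I ≃ₜ sphere (0:ℂ) 1) := by
    rintro ⟨e⟩
    have : CompactSpace (sphere (0:ℂ) 1) := isCompact_iff_compactSpace.1 (isCompact_sphere _ _)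
    obtain ⟨e'⟩ := hcompact e.symm.compactSpace
    exact hcirc ⟨e'.trans e⟩
  obtain ⟨f, hf, hinj⟩ := exists_continuous_injective_real hTI hcircI
  rcases homeomorph_interval_of_continuous_injective hf hinj with h | h | ⟨⟨e⟩⟩
  · exact Or.inl h
  · exact Or.inr h
  · obtain ⟨e'⟩ := hcompact e.symm.compactSpace
    exact absurd ⟨e'.trans e⟩ harc
end
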